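/- Let K be a number field and let T be a nonempty finite set of real embeddings of K (ring homomorphisms K → ℝ) of even cardinality. Then there exists a central division algebra B₁ over K with dim_K B₁ = 4 such that: (i) for every real embedding σ : K → ℝ, the ℝ-algebra ℝ ⊗_{K,σ} B₁ (base change of B₁ along σ) is a division ring if and only if σ ∈ T; and (ii) for every finite place v of K, B₁ ⊗_K K_v is isomorphic as a K_v-algebra to the algebra of 2 × 2 matrices over the completion K_v. -/

import Mathlib

open scoped TensorProduct
open IsDedekindDomain NumberField

/-- Helper instance (`Algebra.to_smulCommClass`, which instance search fails to
find on its own for adic completions). -/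
noncomputable instance (K : Type) [Field K] [NumberField K]
    (v : HeightOneSpectrum (𝓞 K)) :
    SMulCommClass K (v.adicCompletion K) (v.adicCompletion K) :=
  Algebra.to_smulCommClass


/-- A (unital, nontrivial) ring is a division ring iff every nonzero element is invertible. -/
def IsDivisionRing (X : Type*) [Ring X] : Prop :=
  Nontrivial X ∧ ∀ x : X, x ≠ 0 → IsUnit x

theorem AddMonoidHom.index_range_eq_card_ker {B : Type*} [AddCommGroup B] [Finite B] (f : B →+ B) :
    f.range.index = Nat.card f.ker := by
  have h1 := f.range.card_mul_index
  have h2 := f.ker.card_mul_index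
  rw [AddSubgroup.index_ker] at h2
  have h3 : 0 < Nat.card f.range := Nat.card_pos
  exact Nat.eq_of_mul_eq_mul_left h3 (by rw [h1, mul_comm, h2])

theorem index_range_two_nsmul_prod (n : ℕ) (B : Type*) [AddCommGroup B] [Finite B] :
    (nsmulAddMonoidHom (α := (Fin n → ℤ) × B) 2).range.index =
      2 ^ n * Nat.card (nsmulAddMonoidHom (α := (Fin n → ℤ) × B) 2).ker := by
  have h1 : (nsmulAddMonoidHom (α := (Fin n → ℤ) × B) 2).range =
      (AddSubgroup.pi Set.univ fun _ : Fin n ↦ AddSubgroup.zmultiples (2 : ℤ)).prod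
        (nsmulAddMonoidHom (α := B) 2).range := by
    ext ⟨x, y⟩
    simp only [AddMonoidHom.mem_range, AddSubgroup.mem_prod, AddSubgroup.mem_pi,
      AddSubgroup.mem_zmultiples_iff, nsmulAddMonoidHom_apply, Prod.ext_iff, Prod.exists]
    constructor
    · rintro ⟨a, b, h1, h2⟩
      refine ⟨fun i _ ↦ ⟨a i, ?_⟩, b, h2⟩
      have h := congrFun h1 i
      simpa [mul_comm] using h
    · rintro ⟨h1, b, h2⟩
      choose a ha using fun i ↦ h1 i trivial
      refine ⟨a, b, funext fun i ↦ ?_, h2⟩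
      have h := ha i
      simpa [mul_comm] using h
  have h2 : Nat.card (nsmulAddMonoidHom (α := (Fin n → ℤ) × B) 2).ker =
      Nat.card (nsmulAddMonoidHom (α := B) 2).ker := by
    refine Nat.card_congr ⟨fun x ↦ ⟨x.1.2, ?_⟩, fun y ↦ ⟨(0, y.1), ?_⟩, ?_, ?_⟩
    · have h := x.2
      simp only [AddMonoidHom.mem_ker, nsmulAddMonoidHom_apply] at h ⊢
      exact congrArg Prod.snd h
    · have h := y.2
      simp only [AddMonoidHom.mem_ker, nsmulAddMonoidHom_apply] at h ⊢
      simp [h]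
    · rintro ⟨⟨x, y⟩, h⟩
      simp only [AddMonoidHom.mem_ker, nsmulAddMonoidHom_apply] at h
      have h1 : 2 • x = 0 := congrArg Prod.fst h
      have h2 : x = 0 := (nsmul_eq_zero_iff_right two_ne_zero).1 h1
      simp [h2]
    · intro y; rfl
  rw [h1, h2, ← AddMonoidHom.index_range_eq_card_ker, AddSubgroup.index_prod, AddSubgroup.index_pi]
  simp [Int.index_zmultiples]

theorem index_range_two_nsmul (M : Type*) [AddCommGroup M] [Module.Finite ℤ M] :
    (nsmulAddMonoidHom (α := M) 2).range.index =
      2 ^ Module.finrank ℤ M * Nat.card (nsmulAddMonoidHom (α := M) 2).ker := by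
  classical
  have hM : AddGroup.FG M := by
    rwa [← Module.Finite.iff_addGroup_fg]
  obtain ⟨n, ι, _, p, hp, e, ⟨f⟩⟩ := AddCommGroup.equiv_free_prod_directSum_zmod M
  have : ∀ i, NeZero (p i ^ e i) := fun i ↦ ⟨pow_ne_zero _ (hp i).ne_zero⟩
  let B := DirectSum ι fun i ↦ ZMod (p i ^ e i)
  have hB : Finite B := Finite.of_equiv _ (DirectSum.addEquivProd _).symm.toEquiv
  let g : M ≃+ (Fin n → ℤ) × B := f.trans
    (AddEquiv.prodCongr (Finsupp.linearEquivFunOnFinite ℤ ℤ (Fin n)).toAddEquiv (AddEquiv.refl B))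
  have hn : Module.finrank ℤ M = n := by
    rw [g.toIntLinearEquiv.finrank_eq]
    let F : ((Fin n → ℤ) × B) →ₗ[ℤ] (Fin n → ℤ) := LinearMap.fst ℤ _ _
    have h1 := (F.quotKerEquivOfSurjective LinearMap.fst_surjective).finrank_eq
    rw [← finrank_quotient_eq_of_le_torsion (M := (Fin n → ℤ) × B) (M' := F.ker), h1]
    · simp
    · rintro ⟨x, y⟩ hx
      have hx : x = 0 := hx
      subst hx
      rw [Submodule.mem_torsion_iff]
      refine ⟨⟨Nat.card B, ?_⟩, ?_⟩
      · rw [mem_nonZeroDivisors_iff_ne_zero]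
        exact_mod_cast Nat.card_pos.ne'
      · ext1
        · change ((Nat.card B : ℕ) : ℤ) • (0 : Fin n → ℤ) = 0
          simp
        · change ((Nat.card B : ℕ) : ℤ) • y = 0
          rw [natCast_zsmul]
          exact card_nsmul_eq_zero'
  have h1 := index_range_two_nsmul_prod n B
  have h2 : (nsmulAddMonoidHom (α := (Fin n → ℤ) × B) 2).range =
      (nsmulAddMonoidHom (α := M) 2).range.map (g : M →+ (Fin n → ℤ) × B) := by
    ext x
    simp only [AddMonoidHom.mem_range, AddSubgroup.mem_map, nsmulAddMonoidHom_apply]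
    constructor
    · rintro ⟨y, rfl⟩
      exact ⟨2 • g.symm y, ⟨_, rfl⟩, by simp⟩
    · rintro ⟨_, ⟨y, rfl⟩, rfl⟩
      exact ⟨g y, by simp⟩
  have h3 : Nat.card (nsmulAddMonoidHom (α := M) 2).ker =
      Nat.card (nsmulAddMonoidHom (α := (Fin n → ℤ) × B) 2).ker := by
    refine Nat.card_congr (g.toEquiv.subtypeEquiv fun x ↦ ?_)
    simp only [AddMonoidHom.mem_ker, nsmulAddMonoidHom_apply]
    rw [← map_eq_zero_iff g g.injective, map_nsmul]
    rfl
  rw [hn, h3, ← h1, h2, AddSubgroup.index_map_equiv]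

theorem Subgroup.two_pow_card_le_index {A : Type*} [CommGroup A] {ι : Type*} [Finite ι]
    (H : Subgroup A) [H.FiniteIndex] (P : ι → Subgroup A) (e : ι → A) (hP : ∀ i, H ≤ P i)
    (he : ∀ i, e i ∉ P i) (he' : ∀ i j, j ≠ i → e i ∈ P j) : 2 ^ Nat.card ι ≤ H.index := by
  classical
  have := Fintype.ofFinite ι
  let f : Finset ι → A ⧸ H := fun s ↦ QuotientGroup.mk (∏ i ∈ s, e i)
  have key : ∀ s t : Finset ι, f s = f t → s ⊆ t := by
    intro s t h j hj
    by_contra hjt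
    have h1 : (∏ i ∈ s, e i)⁻¹ * ∏ i ∈ t, e i ∈ P j := hP j (QuotientGroup.eq.1 h)
    have h2 : ∏ i ∈ t, e i ∈ P j := prod_mem fun i hi ↦ he' i j (by rintro rfl; exact hjt hi)
    have h3 : ∏ i ∈ s, e i ∈ P j := by
      rw [Subgroup.mul_mem_cancel_right _ h2] at h1
      simpa using h1
    rw [← Finset.mul_prod_erase s e hj, Subgroup.mul_mem_cancel_right] at h3
    · exact he j h3
    · exact prod_mem fun i hi ↦ he' i j (Finset.ne_of_mem_erase hi).symm
  have hf : Function.Injective f := fun s t h ↦ (key s t h).antisymm (key t s h.symm)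
  have := Nat.card_le_card_of_injective f hf
  simpa [Subgroup.index] using this

theorem Subgroup.relIndex_map_sq {F : Type*} [Field F] [CharZero F] (A : Subgroup Fˣ)
    [Module.Finite ℤ (Additive A)] (hA : -1 ∈ A) :
    (A.map (powMonoidHom 2)).relIndex A = 2 ^ (Module.finrank ℤ (Additive A) + 1) := by
  have h1 := index_range_two_nsmul (Additive A)
  have h2 : Nat.card (nsmulAddMonoidHom (α := Additive A) 2).ker = 2 := by
    rw [Nat.card_eq_two_iff]
    refine ⟨0, ⟨Additive.ofMul ⟨-1, hA⟩, ?_⟩, ?_, ?_⟩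
    · rw [AddMonoidHom.mem_ker, nsmulAddMonoidHom_apply, ← ofMul_pow]
      have : (⟨-1, hA⟩ : A) ^ 2 = 1 := Subtype.ext (by simp)
      rw [this]; rfl
    · intro h
      have h := congrArg (fun x ↦ ((Additive.toMul x.1 : A) : Fˣ)) h
      have h : (1 : Fˣ) = -1 := h
      have h := congrArg Units.val h
      simp at h
      norm_num [self_eq_neg] at h
    · rw [Set.eq_univ_iff_forall]
      rintro ⟨x, hx⟩
      rw [AddMonoidHom.mem_ker, nsmulAddMonoidHom_apply] at hx
      have hx : (Additive.toMul x : A) ^ 2 = 1 := hx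
      have hx : (((Additive.toMul x : A) : Fˣ) : F) ^ 2 = 1 := by
        simpa using congrArg (fun a : A ↦ ((a : Fˣ) : F)) hx
      rcases (sq_eq_sq_iff_eq_or_eq_neg.1 (hx.trans (one_pow 2).symm)) with h | h
      · left
        apply Subtype.ext; change (Additive.toMul x : A) = 1
        ext; simpa using h
      · right
        apply Subtype.ext; change (Additive.toMul x : A) = ⟨-1, hA⟩
        ext; simpa using h
  rw [pow_succ]
  rw [h2] at h1
  rw [← h1, Subgroup.relIndex]
  have h3 : ((A.map (powMonoidHom 2)).subgroupOf A) =
      AddSubgroup.toSubgroup' (nsmulAddMonoidHom (α := Additive A) 2).range := by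
    ext x
    constructor
    · rintro ⟨y, hy, hyx⟩
      exact ⟨Additive.ofMul ⟨y, hy⟩, Subtype.ext hyx⟩
    · rintro ⟨y, hy⟩
      exact ⟨(Additive.toMul y : A), (Additive.toMul y : A).2, congrArg Subtype.val hy⟩
  rw [h3]
  rfl

section
variable {F : Type*} [Field F] [NumberField F]

theorem IsDedekindDomain.HeightOneSpectrum.valuationOfNeZero_eq_one_iff
    (v : HeightOneSpectrum (𝓞 F)) (x : Fˣ) :
    v.valuationOfNeZero x = 1 ↔ v.valuation F (x : F) = 1 := by
  rw [← v.valuationOfNeZero_eq, ← WithZero.coe_one, WithZero.coe_inj]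

theorem IsDedekindDomain.HeightOneSpectrum.exists_generator_pow (v : HeightOneSpectrum (𝓞 F)) :
    ∃ x : Fˣ, v.valuation F (x : F) ≠ 1 ∧ ∀ w ≠ v, w.valuation F (x : F) = 1 := by
  obtain ⟨h, hh, x, hx⟩ : ∃ h ≠ 0, ∃ x : 𝓞 F, v.asIdeal ^ h = Ideal.span {x} := by
    let I : nonZeroDivisors (Ideal (𝓞 F)) := ⟨v.asIdeal, mem_nonZeroDivisors_of_ne_zero v.ne_bot⟩
    refine ⟨Fintype.card (ClassGroup (𝓞 F)), Fintype.card_ne_zero, ?_⟩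
    have h1 : ClassGroup.mk0 (I ^ Fintype.card (ClassGroup (𝓞 F))) = 1 := by
      rw [map_pow, pow_card_eq_one]
    rw [ClassGroup.mk0_eq_one_iff, Submodule.isPrincipal_iff] at h1
    obtain ⟨x, hx⟩ := h1
    exact ⟨x, hx⟩
  have hx0 : x ≠ 0 := by
    rintro rfl
    rw [Ideal.span_singleton_eq_bot.2 rfl] at hx
    exact v.ne_bot (eq_zero_of_pow_eq_zero hx)
  refine ⟨Units.mk0 (algebraMap _ F x) (by simpa using hx0), ?_, fun w hw ↦ ?_⟩
  · rw [Units.val_mk0, Ne, HeightOneSpectrum.valuation_eq_one_iff_notMem, not_not]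
    exact Ideal.pow_le_self hh (hx ▸ Ideal.mem_span_singleton_self x)
  · rw [Units.val_mk0, HeightOneSpectrum.valuation_eq_one_iff_notMem]
    intro hxw
    have h1 : v.asIdeal ^ h ≤ w.asIdeal := by
      rwa [hx, Ideal.span_singleton_le_iff_mem]
    have h2 : v.asIdeal ≤ w.asIdeal := w.isPrime.le_of_pow_le h1
    exact hw (HeightOneSpectrum.ext (v.isMaximal.eq_of_le w.isPrime.ne_top h2).symm)

/-- The valuations at the places of `S`, on the group of `S`-units. -/
noncomputable def unitOrd (S : Finset (HeightOneSpectrum (𝓞 F))) :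
    Additive ((S : Set (HeightOneSpectrum (𝓞 F))).unit F) →ₗ[ℤ] (S → ℤ) :=
  LinearMap.pi fun v ↦ ((MonoidHom.toAdditiveLeft
    (v.1.valuationOfNeZero.comp (Subgroup.subtype _))).toIntLinearMap)

theorem unitOrd_ker (S : Finset (HeightOneSpectrum (𝓞 F))) :
    ∃ f : Additive (𝓞 F)ˣ →ₗ[ℤ] Additive ((S : Set (HeightOneSpectrum (𝓞 F))).unit F),
      Function.Injective f ∧ LinearMap.range f = LinearMap.ker (unitOrd S) := by
  let g : (𝓞 F)ˣ →* (S : Set (HeightOneSpectrum (𝓞 F))).unit F :=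
    (Units.map (algebraMap (𝓞 F) F : 𝓞 F →* F)).codRestrict _ fun x v _ ↦ by
      have := v.valuation_of_unit_eq (K := F) x
      rwa [HeightOneSpectrum.valuationOfNeZero_eq_one_iff] at this
  refine ⟨(MonoidHom.toAdditive g).toIntLinearMap, fun x y hxy ↦ ?_, ?_⟩
  · have h : g x.toMul = g y.toMul := hxy
    have h := congrArg (fun z : (S : Set (HeightOneSpectrum (𝓞 F))).unit F ↦ ((z : Fˣ) : F)) h
    exact Additive.toMul.injective (Units.ext (RingOfIntegers.ext h))
  · ext x
    constructor
    · rintro ⟨y, rfl⟩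
      funext v
      exact v.1.valuation_of_unit_eq (K := F) y.toMul
    · intro hx
      have hx' : ∀ v : HeightOneSpectrum (𝓞 F), v.valuation F ((x.toMul : Fˣ) : F) = 1 := by
        intro v
        by_cases hv : v ∈ S
        · rw [← HeightOneSpectrum.valuationOfNeZero_eq_one_iff]
          exact congrFun hx ⟨v, hv⟩
        · exact x.toMul.2 v hv
      obtain ⟨a, ha⟩ := HeightOneSpectrum.mem_integers_of_valuation_le_one F
        ((x.toMul : Fˣ) : F) fun v ↦ (hx' v).le
      obtain ⟨b, hb⟩ := HeightOneSpectrum.mem_integers_of_valuation_le_one F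
        (((x.toMul : Fˣ)⁻¹ : Fˣ) : F) fun v ↦ by
          rw [Units.val_inv_eq_inv_val, map_inv₀, hx' v, inv_one]
      have hab : a * b = 1 := by
        apply RingOfIntegers.ext
        have : algebraMap (𝓞 F) F (a * b) = 1 := by rw [map_mul, ha, hb, Units.mul_inv]
        simpa using this
      refine ⟨Additive.ofMul ⟨a, b, hab, by rw [mul_comm, hab]⟩, ?_⟩
      apply Additive.toMul.injective
      apply Subtype.ext
      apply Units.ext
      exact ha

theorem unitOrd_range_finrank (S : Finset (HeightOneSpectrum (𝓞 F))) :
    Module.finrank ℤ (LinearMap.range (unitOrd S)) = S.card := by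
  classical
  have h := (LinearMap.range (unitOrd S)).finrank_quotient_add_finrank
  rw [Module.finrank_eq_zero_iff_isTorsion.2, zero_add] at h
  · rw [h]; simp
  · have h1 : ∀ v : S, ∃ a : ℤ, a ≠ 0 ∧
        a • (Pi.single v 1 : S → ℤ) ∈ LinearMap.range (unitOrd S) := by
      intro v
      obtain ⟨x, hx, hx'⟩ := v.1.exists_generator_pow
      rw [Ne, ← HeightOneSpectrum.valuationOfNeZero_eq_one_iff] at hx
      refine ⟨(v.1.valuationOfNeZero x).toAdd, fun h ↦ hx (Multiplicative.toAdd.injective h),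
        Additive.ofMul ⟨x, fun w hw ↦ hx' w ?_⟩, ?_⟩
      · rintro rfl; exact hw v.2
      · funext w
        by_cases hw : w = v
        · subst hw
          simp only [Pi.smul_apply, Pi.single_eq_same, smul_eq_mul, mul_one]
          rfl
        · rw [Pi.smul_apply, Pi.single_eq_of_ne hw, smul_zero]
          have := hx' w.1 fun h ↦ hw (Subtype.ext h)
          rw [← HeightOneSpectrum.valuationOfNeZero_eq_one_iff] at this
          exact this
    choose a ha ha' using h1
    intro y
    obtain ⟨y, rfl⟩ := Submodule.Quotient.mk_surjective _ y
    refine ⟨⟨∏ v, a v,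
      mem_nonZeroDivisors_of_ne_zero (Finset.prod_ne_zero_iff.2 fun v _ ↦ ha v)⟩, ?_⟩
    change (∏ v, a v) • Submodule.Quotient.mk (p := LinearMap.range (unitOrd S)) y = 0
    rw [← Submodule.Quotient.mk_smul, Submodule.Quotient.mk_eq_zero]
    have : y = ∑ v, y v • (Pi.single v 1 : S → ℤ) := by
      funext w
      simp [Finset.sum_apply, Pi.single_apply]
    rw [this, Finset.smul_sum]
    refine Submodule.sum_mem _ fun v _ ↦ ?_
    rw [← Finset.prod_erase_mul _ _ (Finset.mem_univ v), smul_comm, mul_smul]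
    exact Submodule.smul_mem _ _ (Submodule.smul_mem _ _ (ha' v))

instance unit_finite (S : Finset (HeightOneSpectrum (𝓞 F))) :
    Module.Finite ℤ (Additive ((S : Set (HeightOneSpectrum (𝓞 F))).unit F)) := by
  obtain ⟨f, hf, hfr⟩ := unitOrd_ker S
  refine ⟨Submodule.fg_of_fg_map_of_fg_inf_ker (unitOrd S) ?_ ?_⟩
  · exact IsNoetherian.noetherian _
  · rw [top_inf_eq, ← hfr, LinearMap.range_eq_map]
    exact Module.Finite.fg_top.map f

theorem unit_finrank (S : Finset (HeightOneSpectrum (𝓞 F))) :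
    Module.finrank ℤ (Additive ((S : Set (HeightOneSpectrum (𝓞 F))).unit F)) =
      NumberField.Units.rank F + S.card := by
  obtain ⟨f, hf, hfr⟩ := unitOrd_ker S
  refine (Submodule.finrank_quotient_add_finrank (LinearMap.ker (unitOrd S))).symm.trans ?_
  rw [(unitOrd S).quotKerEquivRange.finrank_eq, unitOrd_range_finrank, ← hfr,
    LinearMap.finrank_range_of_inj hf, NumberField.Units.finrank_eq, add_comm]
end

theorem Subgroup.relIndex_le_two {G : Type*} [CommGroup G] {H L : Subgroup G}
    (h : ∀ x ∈ L, ∀ y ∈ L, x ∉ H → y ∉ H → x * y ∈ H) : H.relIndex L ≠ 0 ∧ H.relIndex L ≤ 2 := by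
  by_cases hL : L ≤ H
  · rw [Subgroup.relIndex_eq_one.2 hL]; omega
  · obtain ⟨a, haL, haH⟩ := SetLike.not_le_iff_exists.1 hL
    have : H.relIndex L = 2 := by
      rw [Subgroup.relIndex, Subgroup.index_eq_two_iff]
      refine ⟨⟨a, haL⟩, fun b ↦ ?_⟩
      rw [Subgroup.mem_subgroupOf, Subgroup.mem_subgroupOf]
      by_cases hb : (b : G) ∈ H
      · right
        refine ⟨hb, fun h' ↦ haH ?_⟩
        have : (b : G) * a ∈ H := h'
        rwa [Subgroup.mul_mem_cancel_left _ hb] at this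
      · left
        exact ⟨h _ b.2 _ haL hb haH, hb⟩
    omega

section
variable {F : Type*} [Field F] [NumberField F] (v : HeightOneSpectrum (𝓞 F))

/-- The principal units at `v`. -/
def unitOne : Subgroup Fˣ where
  carrier := {x | v.valuation F ((x : F) - 1) < 1}
  one_mem' := by simp
  mul_mem' {x y} hx hy := by
    have h1 : v.valuation F (x : F) = 1 := by
      have := (v.valuation F).map_one_add_of_lt hx
      simpa using this
    have h2 : ((x * y : Fˣ) : F) - 1 = x * (y - 1) + (x - 1) := by push_cast; ring
    rw [Set.mem_ofPred_eq, h2]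
    refine Valuation.map_add_lt _ ?_ hx
    rwa [map_mul, h1, one_mul]
  inv_mem' {x} hx := by
    have h1 : v.valuation F (x : F) = 1 := by
      have := (v.valuation F).map_one_add_of_lt hx
      simpa using this
    have h2 : ((x⁻¹ : Fˣ) : F) - 1 = -((x : F)⁻¹ * (x - 1)) := by
      rw [mul_sub, inv_mul_cancel₀ x.ne_zero]; simp
    rw [Set.mem_ofPred_eq, h2, Valuation.map_neg, map_mul, map_inv₀, h1, inv_one, one_mul]
    exact hx

/-- The elements whose class modulo squares is represented by a principal unit at `v`; if `v` does
not divide `2` these are the squares of the completion. -/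
def locSq : Subgroup Fˣ := unitOne v ⊔ (powMonoidHom 2).range

variable {v}

theorem valuation_eq_one_of_mem_unitOne {x : Fˣ} (hx : x ∈ unitOne v) :
    v.valuation F (x : F) = 1 := by
  have := (v.valuation F).map_one_add_of_lt hx
  simpa using this

theorem mem_locSq {x : Fˣ} : x ∈ locSq v ↔ ∃ y : Fˣ, v.valuation F (x * y ^ 2 - 1) < 1 := by
  rw [locSq, Subgroup.mem_sup]
  constructor
  · rintro ⟨u, hu, _, ⟨y, rfl⟩, rfl⟩
    refine ⟨y⁻¹, ?_⟩
    have : ((u * powMonoidHom 2 y : Fˣ) : F) * ((y⁻¹ : Fˣ) : F) ^ 2 - 1 = u - 1 := by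
      simp [mul_assoc, ← mul_pow]
    rw [this]
    exact hu
  · rintro ⟨y, hy⟩
    refine ⟨x * y ^ 2, ?_, y⁻¹ ^ 2, ⟨y⁻¹, rfl⟩, by simp [mul_assoc]⟩
    change v.valuation F _ < 1
    simpa using hy

theorem sq_mem_locSq (x : Fˣ) : x ^ 2 ∈ locSq v :=
  Subgroup.mem_sup_right ⟨x, rfl⟩

theorem locSq_ord {x : Fˣ} (hx : x ∈ locSq v) :
    ∃ m : Multiplicative ℤ, v.valuationOfNeZero x = m ^ 2 := by
  obtain ⟨y, hy⟩ := mem_locSq.1 hx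
  refine ⟨(v.valuationOfNeZero y)⁻¹, ?_⟩
  have h1 : x * y ^ 2 ∈ unitOne v := by
    change v.valuation F _ < 1
    simpa using hy
  have h2 := valuation_eq_one_of_mem_unitOne h1
  rw [← HeightOneSpectrum.valuationOfNeZero_eq_one_iff, map_mul, map_pow] at h2
  rw [inv_pow]
  exact eq_inv_of_mul_eq_one_left h2

theorem mem_locSq_of_sub_mem {a b : 𝓞 F} {x : Fˣ} (hx : (x : F) = algebraMap (𝓞 F) F a)
    (ha : a ∉ v.asIdeal) (hb : a - b ^ 2 ∈ v.asIdeal) : x ∈ locSq v := by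
  have hb' : b ∉ v.asIdeal := fun h ↦ ha (by
    have := v.asIdeal.add_mem hb (v.asIdeal.mul_mem_left b h)
    rwa [← pow_two, sub_add_cancel] at this)
  have hb0 : algebraMap (𝓞 F) F b ≠ 0 := by
    rw [Ne, FaithfulSMul.algebraMap_eq_zero_iff]
    rintro rfl; exact hb' (zero_mem _)
  rw [mem_locSq]
  refine ⟨(Units.mk0 _ hb0)⁻¹, ?_⟩
  have h1 : (x : F) * (((Units.mk0 _ hb0)⁻¹ : Fˣ) : F) ^ 2 - 1 =
      algebraMap (𝓞 F) F (a - b ^ 2) * (algebraMap (𝓞 F) F b ^ 2)⁻¹ := by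
    rw [Units.val_inv_eq_inv_val, Units.val_mk0, hx, map_sub, map_pow]
    field_simp
  have h2 : v.valuation F (algebraMap (𝓞 F) F b) = 1 := by
    rwa [HeightOneSpectrum.valuation_eq_one_iff_notMem]
  rw [h1, map_mul, map_inv₀, map_pow, h2, one_pow, inv_one, mul_one,
    HeightOneSpectrum.valuation_lt_one_iff_mem]
  exact hb

theorem exists_sub_mem_of_mem_locSq {a : 𝓞 F} {x : Fˣ} (hx : (x : F) = algebraMap (𝓞 F) F a)
    (ha : a ∉ v.asIdeal) (h : x ∈ locSq v) : ∃ b, a - b ^ 2 ∈ v.asIdeal := by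
  obtain ⟨y, hy⟩ := mem_locSq.1 h
  have hy1 : v.valuation F (y : F) = 1 := by
    have h1 : v.valuation F (x : F) = 1 := by
      rwa [hx, HeightOneSpectrum.valuation_eq_one_iff_notMem]
    have h2 := (v.valuation F).map_one_add_of_lt hy
    rw [add_sub_cancel, map_mul, h1, one_mul, map_pow] at h2
    exact (pow_eq_one_iff.1 h2).resolve_right two_ne_zero
  obtain ⟨n, d, hnd⟩ := v.exists_primeCompl_mul_eq_of_integer (y : F) hy1.le
  have hd : (d : 𝓞 F) ∉ v.asIdeal := d.2
  have hd1 : v.valuation F (algebraMap (𝓞 F) F d) = 1 := by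
    rwa [HeightOneSpectrum.valuation_eq_one_iff_notMem]
  have hn1 : v.valuation F (algebraMap (𝓞 F) F n) = 1 := by rw [← hnd, map_mul, hd1, hy1, one_mul]
  have hn : n ∉ v.asIdeal := by rwa [HeightOneSpectrum.valuation_eq_one_iff_notMem] at hn1
  have h3 : a * n ^ 2 - d ^ 2 ∈ v.asIdeal := by
    rw [← HeightOneSpectrum.valuation_lt_one_iff_mem (K := F)]
    have : algebraMap (𝓞 F) F (a * n ^ 2 - d ^ 2) =
        (x * y ^ 2 - 1) * algebraMap (𝓞 F) F d ^ 2 := by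
      rw [map_sub, map_mul, map_pow, map_pow, ← hnd, ← hx]; ring
    change v.valuation F (algebraMap (𝓞 F) F _) < 1
    rw [this, map_mul, map_pow, hd1, one_pow, mul_one]
    exact hy
  obtain ⟨m, hm⟩ : ∃ m, n * m - 1 ∈ v.asIdeal := by
    have : IsUnit (Ideal.Quotient.mk v.asIdeal n) := by
      let _ := Ideal.Quotient.field v.asIdeal
      rw [isUnit_iff_ne_zero, Ne, Ideal.Quotient.eq_zero_iff_mem]
      exact hn
    obtain ⟨m, hm⟩ := this.exists_right_inv
    obtain ⟨m, rfl⟩ := Ideal.Quotient.mk_surjective m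
    exact ⟨m, by rw [← Ideal.Quotient.eq, map_mul, hm, map_one]⟩
  refine ⟨d * m, ?_⟩
  have : a - (d * m) ^ 2 = (a * n ^ 2 - d ^ 2) * m ^ 2 - a * (n * m + 1) * (n * m - 1) := by ring
  rw [this]
  exact v.asIdeal.sub_mem (v.asIdeal.mul_mem_right _ h3) (v.asIdeal.mul_mem_left _ hm)

theorem exists_eq_sq_mul_of_valuation_eq_one {x : Fˣ} (hx : v.valuation F (x : F) = 1) :
    ∃ (a : 𝓞 F) (y z : Fˣ), a ∉ v.asIdeal ∧ (y : F) = algebraMap (𝓞 F) F a ∧ x = y * z ^ 2 := by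
  obtain ⟨n, d, hnd⟩ := v.exists_primeCompl_mul_eq_of_integer (x : F) hx.le
  have hd : (d : 𝓞 F) ∉ v.asIdeal := d.2
  have hd1 : v.valuation F (algebraMap (𝓞 F) F d) = 1 := by
    rwa [HeightOneSpectrum.valuation_eq_one_iff_notMem]
  have hn1 : v.valuation F (algebraMap (𝓞 F) F n) = 1 := by rw [← hnd, map_mul, hd1, hx, one_mul]
  have hn : n ∉ v.asIdeal := by rwa [HeightOneSpectrum.valuation_eq_one_iff_notMem] at hn1
  have h0 : ∀ {c : 𝓞 F}, c ∉ v.asIdeal → algebraMap (𝓞 F) F c ≠ 0 := by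
    intro c hc
    rw [Ne, FaithfulSMul.algebraMap_eq_zero_iff]
    rintro rfl; exact hc (zero_mem _)
  have hnd' : n * d ∉ v.asIdeal := v.isPrime.mul_notMem hn hd
  refine ⟨n * d, Units.mk0 _ (h0 hnd'), (Units.mk0 _ (h0 hd))⁻¹, hnd', rfl, ?_⟩
  apply Units.ext
  have hd0 := h0 hd
  simp only [Units.val_mul, Units.val_pow_eq_pow_val, Units.val_inv_eq_inv_val, Units.val_mk0,
    map_mul, ← hnd]
  field_simp

theorem mul_mem_locSq (h2 : (2 : 𝓞 F) ∉ v.asIdeal) {x y : Fˣ} (hx : v.valuation F (x : F) = 1)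
    (hy : v.valuation F (y : F) = 1) (hx' : x ∉ locSq v) (hy' : y ∉ locSq v) : x * y ∈ locSq v := by
  obtain ⟨a, x, z, ha, hxa, rfl⟩ := exists_eq_sq_mul_of_valuation_eq_one hx
  obtain ⟨b, y, t, hb, hyb, rfl⟩ := exists_eq_sq_mul_of_valuation_eq_one hy
  rw [Subgroup.mul_mem_cancel_right _ (sq_mem_locSq _)] at hx' hy'
  rw [mul_mul_mul_comm, Subgroup.mul_mem_cancel_right _ (mul_mem (sq_mem_locSq _) (sq_mem_locSq _))]
  let _ := Ideal.Quotient.field v.asIdeal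
  have hfin : Finite (𝓞 F ⧸ v.asIdeal) := Ideal.finiteQuotientOfFreeOfNeBot _ v.ne_bot
  let _ := Fintype.ofFinite (𝓞 F ⧸ v.asIdeal)
  classical
  have hch : ringChar (𝓞 F ⧸ v.asIdeal) ≠ 2 := by
    intro h
    have h3 : ((2 : ℕ) : 𝓞 F ⧸ v.asIdeal) = 0 := by rw [← h]; exact ringChar.Nat.cast_ringChar
    apply h2
    rw [← Ideal.Quotient.eq_zero_iff_mem]
    exact_mod_cast h3
  have key : ∀ {c : 𝓞 F} {x : Fˣ}, c ∉ v.asIdeal → (x : F) = algebraMap (𝓞 F) F c →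
      (x ∈ locSq v ↔ quadraticChar _ (Ideal.Quotient.mk v.asIdeal c) = 1) := by
    intro c x hc hxc
    have hc0 : Ideal.Quotient.mk v.asIdeal c ≠ 0 := by rwa [Ne, Ideal.Quotient.eq_zero_iff_mem]
    rw [quadraticChar_one_iff_isSquare hc0]
    constructor
    · intro h
      obtain ⟨b, hb⟩ := exists_sub_mem_of_mem_locSq hxc hc h
      refine ⟨Ideal.Quotient.mk _ b, ?_⟩
      rw [← pow_two, ← map_pow, Ideal.Quotient.eq]
      exact hb
    · rintro ⟨b, hb⟩
      obtain ⟨b, rfl⟩ := Ideal.Quotient.mk_surjective b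
      rw [← pow_two, ← map_pow, Ideal.Quotient.eq] at hb
      exact mem_locSq_of_sub_mem hxc hc hb
  rw [key (v.isPrime.mul_notMem ha hb) (by rw [Units.val_mul, hxa, hyb, map_mul]), map_mul, map_mul]
  rw [key ha hxa] at hx'
  rw [key hb hyb] at hy'
  have ha0 : Ideal.Quotient.mk v.asIdeal a ≠ 0 := by rwa [Ne, Ideal.Quotient.eq_zero_iff_mem]
  have hb0 : Ideal.Quotient.mk v.asIdeal b ≠ 0 := by rwa [Ne, Ideal.Quotient.eq_zero_iff_mem]
  rw [(quadraticChar_dichotomy ha0).resolve_left hx',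
    (quadraticChar_dichotomy hb0).resolve_left hy']
  norm_num

theorem card_quotient_mod_four (h2 : (2 : 𝓞 F) ∉ v.asIdeal) (h : (-1 : Fˣ) ∈ locSq v) :
    Ideal.absNorm v.asIdeal % 4 = 1 := by
  let _ := Ideal.Quotient.field v.asIdeal
  have hfin : Finite (𝓞 F ⧸ v.asIdeal) := Ideal.finiteQuotientOfFreeOfNeBot _ v.ne_bot
  let _ := Fintype.ofFinite (𝓞 F ⧸ v.asIdeal)
  obtain ⟨b, hb⟩ := exists_sub_mem_of_mem_locSq (a := -1) (x := -1) (by simp)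
    (by rw [neg_mem_iff]; exact fun h ↦ v.isPrime.ne_top ((Ideal.eq_top_iff_one _).2 h)) h
  have h1 : IsSquare (-1 : 𝓞 F ⧸ v.asIdeal) := by
    refine ⟨Ideal.Quotient.mk _ b, ?_⟩
    rw [← pow_two, ← map_pow, ← map_one (Ideal.Quotient.mk v.asIdeal), ← map_neg,
      Ideal.Quotient.eq]
    exact hb
  rw [FiniteField.isSquare_neg_one_iff] at h1
  have h3 : Ideal.absNorm v.asIdeal = Fintype.card (𝓞 F ⧸ v.asIdeal) := by
    rw [Ideal.absNorm_apply, ← Nat.card_eq_fintype_card]; rfl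
  have hch : ringChar (𝓞 F ⧸ v.asIdeal) ≠ 2 := by
    intro h
    have h3 : ((2 : ℕ) : 𝓞 F ⧸ v.asIdeal) = 0 := by rw [← h]; exact ringChar.Nat.cast_ringChar
    apply h2
    rw [← Ideal.Quotient.eq_zero_iff_mem]
    exact_mod_cast h3
  have h4 := FiniteField.odd_card_of_char_ne_two hch
  rw [h3]
  omega

theorem locSq_relIndex_ker (h2 : (2 : 𝓞 F) ∉ v.asIdeal) {A : Subgroup Fˣ}
    (hA : ∀ x ∈ A, v.valuation F (x : F) = 1) :
    (locSq v).relIndex A ≠ 0 ∧ (locSq v).relIndex A ≤ 2 :=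
  Subgroup.relIndex_le_two fun x hx y hy hx' hy' ↦ mul_mem_locSq h2 (hA x hx) (hA y hy) hx' hy'

variable (v) in
/-- The elements of even valuation at `v`. -/
noncomputable def evenOrd : Subgroup Fˣ :=
  (powMonoidHom 2 : Multiplicative ℤ →* Multiplicative ℤ).range.comap v.valuationOfNeZero

theorem locSq_le_evenOrd : locSq v ≤ evenOrd v := fun _ hx ↦
  let ⟨m, hm⟩ := locSq_ord hx
  ⟨m, hm.symm⟩

theorem evenOrd_relIndex (A : Subgroup Fˣ) :
    (evenOrd v).relIndex A ≠ 0 ∧ (evenOrd v).relIndex A ≤ 2 := by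
  refine Subgroup.relIndex_le_two fun x _ y _ hx hy ↦ ?_
  have key : ∀ x : Fˣ, x ∈ evenOrd v ↔ Even (v.valuationOfNeZero x).toAdd := by
    intro x
    constructor
    · rintro ⟨m, hm⟩
      exact ⟨m.toAdd, by rw [← hm]; exact two_nsmul _⟩
    · rintro ⟨m, hm⟩
      exact ⟨Multiplicative.ofAdd m, Multiplicative.toAdd.injective
        ((two_nsmul _).trans hm.symm)⟩
  rw [key, Int.not_even_iff_odd] at hx hy
  rw [key, map_mul, toAdd_mul]
  exact hx.add_odd hy

theorem mem_evenOrd {x : Fˣ} : x ∈ evenOrd v ↔ Even (v.valuationOfNeZero x).toAdd := by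
    constructor
    · rintro ⟨m, hm⟩
      exact ⟨m.toAdd, by rw [← hm]; exact two_nsmul _⟩
    · rintro ⟨m, hm⟩
      exact ⟨Multiplicative.ofAdd m, Multiplicative.toAdd.injective
        ((two_nsmul _).trans hm.symm)⟩

theorem exists_sq_mul_valuation_eq_one {x : Fˣ} (hx : x ∈ evenOrd v) :
    ∃ y : Fˣ, v.valuation F ((x * y ^ 2 : Fˣ) : F) = 1 := by
  obtain ⟨π, hπ⟩ := v.valuation_exists_uniformizer F
  have hπ0 : π ≠ 0 := by
    rintro rfl
    rw [map_zero] at hπ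
    exact WithZero.coe_ne_zero hπ.symm
  obtain ⟨m, hm⟩ := mem_evenOrd.1 hx
  have h1 : v.valuationOfNeZero (Units.mk0 π hπ0) = Multiplicative.ofAdd (-1) := by
    rw [← WithZero.coe_inj, v.valuationOfNeZero_eq, Units.val_mk0, hπ]; rfl
  refine ⟨(Units.mk0 π hπ0) ^ m, ?_⟩
  rw [← HeightOneSpectrum.valuationOfNeZero_eq_one_iff, map_mul, map_pow, map_zpow, h1]
  apply Multiplicative.toAdd.injective
  simp [hm]
  ring

theorem locSq_relIndex (h2 : (2 : 𝓞 F) ∉ v.asIdeal) (A : Subgroup Fˣ) :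
    (locSq v).relIndex A ≠ 0 ∧ (locSq v).relIndex A ≤ 4 := by
  have h1 := evenOrd_relIndex (v := v) A
  have h3 : (locSq v).relIndex (evenOrd v ⊓ A) ≠ 0 ∧ (locSq v).relIndex (evenOrd v ⊓ A) ≤ 2 := by
    refine Subgroup.relIndex_le_two fun x hx y hy hx' hy' ↦ ?_
    obtain ⟨z, hz⟩ := exists_sq_mul_valuation_eq_one hx.1
    obtain ⟨t, ht⟩ := exists_sq_mul_valuation_eq_one hy.1
    have := mul_mem_locSq h2 hz ht (by rwa [Subgroup.mul_mem_cancel_right _ (sq_mem_locSq _)])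
      (by rwa [Subgroup.mul_mem_cancel_right _ (sq_mem_locSq _)])
    rwa [mul_mul_mul_comm,
      Subgroup.mul_mem_cancel_right _ (mul_mem (sq_mem_locSq _) (sq_mem_locSq _))] at this
  have h4 := Subgroup.inf_relIndex_right (locSq v) A
  have h5 : (locSq v).relIndex (evenOrd v ⊓ A) * (evenOrd v).relIndex A = (locSq v).relIndex A := by
    rw [← Subgroup.inf_relIndex_right (evenOrd v) A,
      ← Subgroup.inf_relIndex_right (locSq v) (_ ⊓ A),
      Subgroup.relIndex_mul_relIndex _ _ _ inf_le_right inf_le_right,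
      ← inf_assoc, inf_eq_left.2 (locSq_le_evenOrd (v := v)), Subgroup.inf_relIndex_right]
  rw [← h5]
  exact ⟨mul_ne_zero h3.1 h1.1, by nlinarith⟩
end

/-- The generating sum over all finite multisets of elements of weight `q`. -/
noncomputable def mzeta {X : Type*} (q : X → ENNReal) : ENNReal :=
  ∑' m : Multiset X, (m.map q).prod

theorem mzeta_le_of_injective {X Y : Type*} (q : X → ENNReal) (r : Y → ENNReal) (f : X → Y)
    (hf : Function.Injective f) (h : ∀ x, r (f x) = q x) : mzeta q ≤ mzeta r := by
  have : mzeta q = ∑' m : Multiset X, ((m.map f).map r).prod := by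
    simp only [mzeta, Multiset.map_map, Function.comp_def, h]
  rw [this]
  exact ENNReal.tsum_comp_le_tsum_of_injective (Multiset.map_injective hf)
    fun m ↦ (Multiset.map r m).prod

theorem mzeta_sum {X Y : Type*} (q : X ⊕ Y → ENNReal) :
    mzeta q = mzeta (fun x ↦ q (Sum.inl x)) * mzeta (fun y ↦ q (Sum.inr y)) := by
  let f : Multiset X × Multiset Y → Multiset (X ⊕ Y) := fun p ↦ p.1.map Sum.inl + p.2.map Sum.inr
  have hf : Function.Bijective f := by
    constructor
    · rintro ⟨a, b⟩ ⟨c, d⟩ h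
      have h1 := congrArg (Multiset.filterMap Sum.getLeft?) h
      have h2 := congrArg (Multiset.filterMap Sum.getRight?) h
      simp [f, Multiset.filterMap_add, Multiset.filterMap_map, Function.comp_def] at h1 h2
      have key : ∀ {A B : Type _} (m : Multiset A),
          Multiset.filterMap (fun _ ↦ (none : Option B)) m = 0 := by
        intro A B m
        induction m using Multiset.induction with
        | empty => simp
        | cons a m ih => simpa using ih
      have key' : ∀ {A B : Type _} (m : Multiset A),
          Multiset.filterMap (fun _ ↦ (none : Option B)) m = 0 := by
        intro A B m
        induction m using Multiset.induction with
        | empty => simp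
        | cons a m ih => simpa using ih
      rw [key, key, add_zero, add_zero] at h1
      rw [key', key', zero_add, zero_add] at h2
      rw [h1, h2]
    · intro m
      induction m using Multiset.induction with
      | empty => exact ⟨(0, 0), rfl⟩
      | cons a m ih =>
        obtain ⟨⟨b, c⟩, rfl⟩ := ih
        cases a with
        | inl x => exact ⟨(x ::ₘ b, c), by simp [f]⟩
        | inr y => exact ⟨(b, y ::ₘ c), by simp [f]⟩
  rw [mzeta, ← (Equiv.ofBijective f hf).tsum_eq, ENNReal.tsum_prod']
  simp only [Equiv.ofBijective_apply, f, Multiset.map_add, Multiset.prod_add, Multiset.map_map,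
    ENNReal.tsum_mul_left, ENNReal.tsum_mul_right, Function.comp_def]
  rfl

theorem mzeta_unit (q : Unit → ENNReal) : mzeta q = (1 - q ())⁻¹ := by
  rw [← ENNReal.tsum_geometric, mzeta]
  let f : Multiset Unit ≃ ℕ :=
    ⟨Multiset.card, fun n ↦ Multiset.replicate n (), fun m ↦ by
      exact (Multiset.eq_replicate.2 ⟨rfl, fun _ _ ↦ rfl⟩).symm, fun n ↦ by simp⟩
  rw [← f.symm.tsum_eq]
  simp [f]

theorem mzeta_finite (Y : Type*) [Finite Y] :
    ∃ C : ENNReal, C ≠ ⊤ ∧ ∀ q : Y → ENNReal, (∀ y, q y ≤ 2⁻¹) → mzeta q ≤ C := by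
  induction Y using Finite.induction_empty_option with
  | of_equiv e h =>
    obtain ⟨C, hC, h⟩ := h
    refine ⟨C, hC, fun q hq ↦ le_trans ?_ (h (q ∘ e) fun y ↦ hq _)⟩
    exact mzeta_le_of_injective _ _ e.symm e.symm.injective (by simp)
  | h_empty =>
    refine ⟨1, by simp, fun q _ ↦ ?_⟩
    rw [mzeta, tsum_eq_single 0 fun m hm ↦ (hm (Subsingleton.elim _ _)).elim]
    simp
  | h_option h =>
    rename_i α _
    obtain ⟨C, hC, h⟩ := h
    refine ⟨C * 2, ENNReal.mul_ne_top hC (by simp), fun q hq ↦ ?_⟩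
    have h1 := mzeta_le_of_injective q (fun x : α ⊕ Unit ↦ q ((Equiv.optionEquivSumPUnit _).symm x))
      (Equiv.optionEquivSumPUnit _) (Equiv.injective _) (by simp)
    refine h1.trans ?_
    rw [mzeta_sum, mzeta_unit]
    refine mul_le_mul' (h _ fun y ↦ hq _) ?_
    rw [← inv_inv (2 : ENNReal), ENNReal.inv_le_inv]
    refine le_trans ?_ (tsub_le_tsub_left (hq _) 1)
    rw [ENNReal.one_sub_inv_two]

section
variable (F : Type*) [Field F] [NumberField F]

/-- The Dedekind zeta function on the real axis, as a sum over multisets of primes. -/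
noncomputable def realZeta (s : ℝ) : ENNReal :=
  mzeta fun w : HeightOneSpectrum (𝓞 F) ↦ ENNReal.ofReal ((Ideal.absNorm w.asIdeal : ℝ) ^ (-s))

theorem multiset_prod_bijOn : Function.Bijective
    (fun m : Multiset (HeightOneSpectrum (𝓞 F)) ↦
      (⟨(m.map HeightOneSpectrum.asIdeal).prod, by
        rw [Ne, ← Ideal.zero_eq_bot, Multiset.prod_eq_zero_iff, Multiset.mem_map]
        rintro ⟨v, -, hv⟩
        exact v.ne_bot hv⟩ : {I : Ideal (𝓞 F) // I ≠ ⊥})) := by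
  have hprime : ∀ m : Multiset (HeightOneSpectrum (𝓞 F)),
      ∀ p ∈ m.map HeightOneSpectrum.asIdeal, Prime p := by
    intro m p hp
    obtain ⟨v, -, rfl⟩ := Multiset.mem_map.1 hp
    exact v.prime
  have hinj : Function.Injective (HeightOneSpectrum.asIdeal (R := 𝓞 F)) :=
    fun _ _ h ↦ HeightOneSpectrum.ext h
  constructor
  · intro m n h
    have h := congrArg Subtype.val h
    have h := congrArg UniqueFactorizationMonoid.normalizedFactors h
    simp only at h
    rw [UniqueFactorizationMonoid.normalizedFactors_prod_of_prime (hprime m),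
      UniqueFactorizationMonoid.normalizedFactors_prod_of_prime (hprime n)] at h
    exact Multiset.map_injective hinj h
  · rintro ⟨I, hI⟩
    refine ⟨(UniqueFactorizationMonoid.normalizedFactors I).pmap
      (fun p (hp : Prime p) ↦ ⟨p, Ideal.isPrime_of_prime hp, hp.ne_zero⟩)
      (fun p hp ↦ UniqueFactorizationMonoid.prime_of_normalized_factor p hp), ?_⟩
    apply Subtype.ext
    simp only [Multiset.map_pmap, Multiset.pmap_eq_map, Multiset.map_id']
    exact Ideal.prod_normalizedFactors_eq_self hI

theorem realZeta_eq (s : ℝ) : realZeta F s = ∑' n : ℕ, ENNReal.ofReal (if n = 0 then 0 else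
    Nat.card {I : Ideal (𝓞 F) // Ideal.absNorm I = n} * (n : ℝ) ^ (-s)) := by
  have h1 : realZeta F s = ∑' I : {I : Ideal (𝓞 F) // I ≠ ⊥},
      ENNReal.ofReal ((Ideal.absNorm I.1 : ℝ) ^ (-s)) := by
    rw [← (Equiv.ofBijective _ (multiset_prod_bijOn F)).tsum_eq]
    refine tsum_congr fun m ↦ ?_
    simp only [Equiv.ofBijective_apply]
    induction m using Multiset.induction with
    | empty => simp
    | cons a m ih =>
      simp only [Multiset.map_cons, Multiset.prod_cons, ih, map_mul, Nat.cast_mul]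
      rw [Real.mul_rpow (Nat.cast_nonneg _) (Nat.cast_nonneg _), ENNReal.ofReal_mul (by positivity)]
  rw [h1, ← (Equiv.sigmaFiberEquiv fun I : {I : Ideal (𝓞 F) // I ≠ ⊥} ↦
    Ideal.absNorm I.1).tsum_eq, ENNReal.tsum_sigma']
  refine tsum_congr fun n ↦ ?_
  have h2 : ∀ I : {I : {I : Ideal (𝓞 F) // I ≠ ⊥} // Ideal.absNorm I.1 = n},
      ENNReal.ofReal ((Ideal.absNorm ((Equiv.sigmaFiberEquiv fun I : {I : Ideal (𝓞 F) // I ≠ ⊥} ↦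
    Ideal.absNorm I.1) ⟨n, I⟩).1 : ℝ) ^ (-s)) = ENNReal.ofReal ((n : ℝ) ^ (-s)) := by
    intro I
    change ENNReal.ofReal ((Ideal.absNorm I.1.1 : ℝ) ^ (-s)) = _
    rw [I.2]
  rw [tsum_congr h2]
  split_ifs with hn
  · subst hn
    have : IsEmpty {I : {I : Ideal (𝓞 F) // I ≠ ⊥} // Ideal.absNorm I.1 = 0} :=
      ⟨fun I ↦ I.1.2 (Ideal.absNorm_eq_zero_iff.1 I.2)⟩
    simp
  · have hfin : Finite {I : Ideal (𝓞 F) // Ideal.absNorm I = n} :=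
      Ideal.finite_setOfPred_absNorm_eq n
    have e : {I : {I : Ideal (𝓞 F) // I ≠ ⊥} // Ideal.absNorm I.1 = n} ≃
        {I : Ideal (𝓞 F) // Ideal.absNorm I = n} :=
      ⟨fun I ↦ ⟨I.1.1, I.2⟩, fun I ↦ ⟨⟨I.1, fun h ↦ hn (by rw [← I.2, h]; simp)⟩, I.2⟩,
        fun _ ↦ rfl, fun _ ↦ rfl⟩
    have := Finite.of_equiv _ e.symm
    rw [← Nat.card_congr e, ENNReal.ofReal_mul (Nat.cast_nonneg _), ENNReal.tsum_const,
      ENNReal.ofReal_natCast, ENat.card_eq_coe_natCard]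
    rfl

theorem realZeta_eq_dedekindZeta (s : ℝ) (h : dedekindZeta F s ≠ 0) :
    dedekindZeta F s = ((dedekindZeta F s).re : ℂ) ∧
    realZeta F s = ENNReal.ofReal (dedekindZeta F s).re := by
  set a : ℕ → ℝ := fun n ↦ if n = 0 then 0 else
    Nat.card {I : Ideal (𝓞 F) // Ideal.absNorm I = n} * (n : ℝ) ^ (-s) with ha
  have ha0 : ∀ n, 0 ≤ a n := fun n ↦ by
    simp only [ha]; split_ifs <;> positivity
  have h1 : dedekindZeta F s = ((∑' n, a n : ℝ) : ℂ) := by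
    rw [dedekindZeta, LSeries, Complex.ofReal_tsum]
    refine tsum_congr fun n ↦ ?_
    rw [LSeries.term_def]
    simp only [ha]
    split_ifs with hn
    · simp
    · rw [Complex.ofReal_mul, Complex.ofReal_cpow (Nat.cast_nonneg _), Complex.ofReal_neg,
        Complex.cpow_neg, div_eq_mul_inv]
      simp
  have hs : Summable a := by
    by_contra hs
    rw [tsum_eq_zero_of_not_summable hs] at h1
    exact h (by simpa using h1)
  rw [h1, Complex.ofReal_re, ENNReal.ofReal_tsum_of_nonneg ha0 hs, realZeta_eq]
  exact ⟨rfl, rfl⟩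

theorem tendsto_realZeta : Filter.Tendsto (fun s : ℝ ↦ ENNReal.ofReal (s - 1) * realZeta F s)
    (nhdsWithin 1 (Set.Ioi 1)) (nhds (ENNReal.ofReal (dedekindZeta_residue F))) := by
  have h1 := tendsto_sub_one_mul_dedekindZeta_nhdsGT F
  have h2 : ∀ᶠ s : ℝ in nhdsWithin 1 (Set.Ioi 1), ((s : ℂ) - 1) * dedekindZeta F s ≠ 0 :=
    h1.eventually_ne (by exact_mod_cast dedekindZeta_residue_ne_zero F)
  have h3 := (ENNReal.continuous_ofReal.tendsto _).comp ((Complex.continuous_re.tendsto _).comp h1)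
  rw [Complex.ofReal_re] at h3
  refine h3.congr' ?_
  filter_upwards [h2, self_mem_nhdsWithin] with s hs hs1
  obtain ⟨h4, h5⟩ := realZeta_eq_dedekindZeta F s (right_ne_zero_of_mul hs)
  have hs1 : 1 < s := hs1
  rw [h5, ← ENNReal.ofReal_mul (by linarith), Function.comp_apply, Function.comp_apply]
  congr 1
  rw [h4, ← Complex.ofReal_one, ← Complex.ofReal_sub, ← Complex.ofReal_mul, Complex.ofReal_re,
    Complex.ofReal_re]
end

theorem not_realZeta_sq_le (E L : Type*) [Field E] [NumberField E] [Field L] [NumberField L]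
    (C : ENNReal) (hC : C ≠ ⊤) (h : ∀ s : ℝ, 1 < s → realZeta E s ^ 2 ≤ C * realZeta L s) :
    False := by
  have h1 := tendsto_realZeta E
  have h2 := tendsto_realZeta L
  have h3 : Filter.Tendsto (fun s : ℝ ↦ ENNReal.ofReal (s - 1)) (nhdsWithin 1 (Set.Ioi 1))
      (nhds 0) := by
    have : Filter.Tendsto (fun s : ℝ ↦ ENNReal.ofReal (s - 1)) (nhds 1)
        (nhds (ENNReal.ofReal (1 - 1))) :=
      (ENNReal.continuous_ofReal.comp (continuous_id.sub continuous_const)).tendsto 1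
    rw [sub_self, ENNReal.ofReal_zero] at this
    exact this.mono_left nhdsWithin_le_nhds
  have h4 := ENNReal.Tendsto.const_mul (ENNReal.Tendsto.mul h3 (Or.inr ENNReal.ofReal_ne_top) h2
    (Or.inr ENNReal.zero_ne_top)) (Or.inr hC)
  have h5 := ENNReal.Tendsto.pow (n := 2) h1
  rw [zero_mul, mul_zero] at h4
  have h6 := le_of_tendsto_of_tendsto h5 h4 (by
    filter_upwards [self_mem_nhdsWithin] with s hs
    calc _ = ENNReal.ofReal (s - 1) ^ 2 * realZeta E s ^ 2 := by rw [mul_pow]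
      _ ≤ ENNReal.ofReal (s - 1) ^ 2 * (C * realZeta L s) := mul_le_mul_right (h s hs) _
      _ = _ := by ring)
  have h7 : ENNReal.ofReal (dedekindZeta_residue E) = 0 := by
    simpa using h6
  rw [ENNReal.ofReal_eq_zero] at h7
  exact absurd (dedekindZeta_residue_pos E) (not_lt.2 h7)

section
variable (K : Type*) {L : Type*} [Field K] [NumberField K] [Field L] [NumberField L] [Algebra K L]

instance under_liesOver (W : HeightOneSpectrum (𝓞 L)) :
    W.asIdeal.LiesOver (W.under (𝓞 K)).asIdeal := ⟨rfl⟩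

variable {K} in
theorem exists_under_eq (v : HeightOneSpectrum (𝓞 K)) :
    ∃ W : HeightOneSpectrum (𝓞 L), W.under (𝓞 K) = v := by
  have := v.isPrime
  obtain ⟨P, hP, hPv⟩ := Ideal.nonempty_primesOver (S := 𝓞 L) (P := v.asIdeal)
  refine ⟨⟨P, hP, Ideal.ne_bot_of_liesOver_of_ne_bot v.ne_bot P⟩, ?_⟩
  ext1
  exact hPv.over.symm

theorem valuation_under_pow (W : HeightOneSpectrum (𝓞 L)) (x : K) :
    ((W.under (𝓞 K)).valuation K x) ^ (W.under (𝓞 K)).asIdeal.ramificationIdx' W.asIdeal =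
      W.valuation L (algebraMap K L x) :=
  HeightOneSpectrum.valuation_liesOver L _ W x

theorem ramificationIdx'_under_ne_zero (W : HeightOneSpectrum (𝓞 L)) :
    (W.under (𝓞 K)).asIdeal.ramificationIdx' W.asIdeal ≠ 0 := by
  have := W.isPrime
  exact Ideal.IsDedekindDomain.ramificationIdx'_ne_zero_of_liesOver _ (W.under (𝓞 K)).ne_bot

theorem valuation_algebraMap_lt_one_iff (W : HeightOneSpectrum (𝓞 L)) (x : K) :
    W.valuation L (algebraMap K L x) < 1 ↔ (W.under (𝓞 K)).valuation K x < 1 := by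
  rw [← valuation_under_pow]
  exact pow_lt_one_iff (ramificationIdx'_under_ne_zero K W)

theorem valuation_algebraMap_eq_one_iff (W : HeightOneSpectrum (𝓞 L)) (x : K) :
    W.valuation L (algebraMap K L x) = 1 ↔ (W.under (𝓞 K)).valuation K x = 1 := by
  rw [← valuation_under_pow]
  rw [pow_eq_one_iff, or_iff_left (ramificationIdx'_under_ne_zero K W)]

variable {K} in
theorem map_mem_locSq (W : HeightOneSpectrum (𝓞 L)) {x : Kˣ} (hx : x ∈ locSq (W.under (𝓞 K))) :
    Units.map (algebraMap K L : K →* L) x ∈ locSq W := by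
  rw [mem_locSq] at hx ⊢
  obtain ⟨y, hy⟩ := hx
  refine ⟨Units.map (algebraMap K L : K →* L) y, ?_⟩
  rw [← valuation_algebraMap_lt_one_iff] at hy
  simpa using hy

theorem two_mem_iff (W : HeightOneSpectrum (𝓞 L)) :
    (2 : 𝓞 L) ∈ W.asIdeal ↔ (2 : 𝓞 K) ∈ (W.under (𝓞 K)).asIdeal := by
  change _ ↔ algebraMap (𝓞 K) (𝓞 L) 2 ∈ W.asIdeal
  rw [map_ofNat]

end

theorem withZero_eq_of_le_exp_iff {a b : WithZero (Multiplicative ℤ)} (ha : a ≤ 1) (hb : b ≤ 1)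
    (h : ∀ n : ℕ, a ≤ WithZero.exp (-(n : ℤ)) ↔ b ≤ WithZero.exp (-(n : ℤ))) : a = b := by
  wlog hab : a < b generalizing a b
  · rcases lt_trichotomy a b with h1 | h1 | h1
    · exact absurd h1 hab
    · exact h1
    · exact (this hb ha (fun n ↦ (h n).symm) h1).symm
  have hb0 : b ≠ 0 := (zero_le.trans_lt hab).ne'
  have h1 : b = WithZero.exp (WithZero.log b) := (WithZero.exp_log hb0).symm
  have h2 : WithZero.log b ≤ 0 := by
    rwa [h1, ← WithZero.exp_zero, WithZero.exp_le_exp] at hb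
  obtain ⟨n, hn⟩ := Int.eq_ofNat_of_zero_le (a := -WithZero.log b) (by omega)
  have h3 : WithZero.log b = -(n : ℤ) := by omega
  rw [h3] at h1
  have h4 := (h (n + 1)).1 (by
    by_cases ha0 : a = 0
    · simp [ha0]
    have h5 : a = WithZero.exp (WithZero.log a) := (WithZero.exp_log ha0).symm
    rw [h1, h5, WithZero.exp_lt_exp] at hab
    rw [h5, WithZero.exp_le_exp]
    push_cast
    omega)
  rw [h1, WithZero.exp_le_exp] at h4
  push_cast at h4
  omega

section
variable {K L : Type*} [Field K] [NumberField K] [Field L] [NumberField L] [Algebra K L]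

/-- The action of an automorphism on the finite places. -/
noncomputable def conjPlace (τ : L ≃ₐ[K] L) (W : HeightOneSpectrum (𝓞 L)) :
    HeightOneSpectrum (𝓞 L) :=
  W.comap (RingOfIntegers.mapRingEquiv τ.toRingEquiv : 𝓞 L →+* 𝓞 L)
    (RingOfIntegers.mapRingEquiv τ.toRingEquiv).surjective

theorem mem_conjPlace {τ : L ≃ₐ[K] L} {W : HeightOneSpectrum (𝓞 L)} {x : 𝓞 L} :
    x ∈ (conjPlace τ W).asIdeal ↔ RingOfIntegers.mapRingEquiv τ.toRingEquiv x ∈ W.asIdeal :=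
  Iff.rfl

theorem valuation_conjPlace (τ : L ≃ₐ[K] L) (W : HeightOneSpectrum (𝓞 L)) (x : L) :
    (conjPlace τ W).valuation L x = W.valuation L (τ x) := by
  set e := RingOfIntegers.mapRingEquiv τ.toRingEquiv with he
  have hpow (n : ℕ) (r : 𝓞 L) : r ∈ (conjPlace τ W).asIdeal ^ n ↔ e r ∈ W.asIdeal ^ n := by
    have : (conjPlace τ W).asIdeal = W.asIdeal.map (e.symm : 𝓞 L →+* 𝓞 L) := by
      exact (Ideal.map_symm e).symm
    rw [this, ← Ideal.map_pow]
    erw [Ideal.map_symm e, Ideal.mem_comap]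
  have hint (r : 𝓞 L) : (conjPlace τ W).intValuation r = W.intValuation (e r) := by
    refine withZero_eq_of_le_exp_iff (HeightOneSpectrum.intValuation_le_one _ _)
      (HeightOneSpectrum.intValuation_le_one _ _) fun n ↦ ?_
    rw [HeightOneSpectrum.intValuation_le_pow_iff_mem,
      HeightOneSpectrum.intValuation_le_pow_iff_mem,
      hpow]
  have hr (r : 𝓞 L) : (conjPlace τ W).valuation L (r : L) = W.valuation L (τ r) := by
    have : τ (r : L) = algebraMap (𝓞 L) L (e r) := rfl
    rw [this]
    erw [HeightOneSpectrum.valuation_of_algebraMap, HeightOneSpectrum.valuation_of_algebraMap]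
    exact hint r
  obtain ⟨a, b, -, rfl⟩ := IsFractionRing.div_surjective (A := 𝓞 L) x
  rw [map_div₀, map_div₀, map_div₀]
  erw [hr, hr]

theorem conjPlace_under (τ : L ≃ₐ[K] L) (W : HeightOneSpectrum (𝓞 L)) :
    (conjPlace τ W).under (𝓞 K) = W.under (𝓞 K) := by
  ext x
  change RingOfIntegers.mapRingEquiv τ.toRingEquiv (algebraMap (𝓞 K) (𝓞 L) x) ∈ W.asIdeal ↔
    algebraMap (𝓞 K) (𝓞 L) x ∈ W.asIdeal
  have : RingOfIntegers.mapRingEquiv τ.toRingEquiv (algebraMap (𝓞 K) (𝓞 L) x) =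
      algebraMap (𝓞 K) (𝓞 L) x := by
    ext
    exact τ.commutes (x : K)
  rw [this]

/-- `τ` is the nontrivial automorphism of a quadratic extension. -/
structure IsQuadConj (τ : L ≃ₐ[K] L) : Prop where
  finrank_eq : Module.finrank K L = 2
  apply_apply : ∀ x, τ (τ x) = x
  fixed : ∀ x, τ x = x → ∃ c, algebraMap K L c = x

namespace IsQuadConj
variable {τ : L ≃ₐ[K] L} (hτ : IsQuadConj τ)
include hτ

theorem conjPlace_conjPlace (W : HeightOneSpectrum (𝓞 L)) :
    conjPlace τ (conjPlace τ W) = W := by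
  ext x
  rw [mem_conjPlace, mem_conjPlace]
  have : RingOfIntegers.mapRingEquiv τ.toRingEquiv
      (RingOfIntegers.mapRingEquiv τ.toRingEquiv x) = x := by
    ext
    exact hτ.apply_apply (x : L)
  rw [this]

theorem eq_or_eq {W W' : HeightOneSpectrum (𝓞 L)} (h : W'.under (𝓞 K) = W.under (𝓞 K)) :
    W' = W ∨ W' = conjPlace τ W := by
  have key (V : HeightOneSpectrum (𝓞 L)) (hV : W'.asIdeal ≤ V.asIdeal) : W' = V := by
    ext1
    exact W'.isMaximal.eq_of_le V.isPrime.ne_top hV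
  have hsub : (W'.asIdeal : Set (𝓞 L)) ⊆ W.asIdeal ∪ (conjPlace τ W).asIdeal := by
    intro a ha
    set e := RingOfIntegers.mapRingEquiv τ.toRingEquiv with he
    have h1 : τ ((a * e a : 𝓞 L) : L) = ((a * e a : 𝓞 L) : L) := by
      change τ ((a : L) * τ (a : L)) = (a : L) * τ (a : L)
      rw [map_mul, hτ.apply_apply, mul_comm]
    obtain ⟨c, hc⟩ := hτ.fixed _ h1
    have hcint : IsIntegral ℤ c := by
      have := (a * e a).2
      rw [← isIntegral_algebraMap_iff (B := L) (algebraMap K L).injective, hc]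
      exact this
    let c' : 𝓞 K := ⟨c, hcint⟩
    have h2 : algebraMap (𝓞 K) (𝓞 L) c' = a * e a := by
      ext
      exact hc
    have h3 : c' ∈ (W'.under (𝓞 K)).asIdeal := by
      change algebraMap (𝓞 K) (𝓞 L) c' ∈ W'.asIdeal
      rw [h2]
      exact Ideal.mul_mem_right _ _ ha
    rw [h] at h3
    have h4 : a * e a ∈ W.asIdeal := by
      rw [← h2]; exact h3
    exact W.isPrime.mem_or_mem h4
  rw [Ideal.subset_union] at hsub
  exact hsub.imp (key _) (key _)

theorem efCases (W : HeightOneSpectrum (𝓞 L)) :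
    (conjPlace τ W = W ∧ (W.under (𝓞 K)).asIdeal.ramificationIdx' W.asIdeal *
      (W.under (𝓞 K)).asIdeal.inertiaDeg' W.asIdeal = 2) ∨
    (conjPlace τ W ≠ W ∧ (W.under (𝓞 K)).asIdeal.ramificationIdx' W.asIdeal = 1 ∧
      (W.under (𝓞 K)).asIdeal.inertiaDeg' W.asIdeal = 1) := by
  classical
  set v := W.under (𝓞 K) with hv
  have := v.isMaximal
  have hsum := Ideal.sum_ramification_inertia (𝓞 L) K L (p := v.asIdeal) v.ne_bot
  rw [hτ.finrank_eq] at hsum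
  have hset : IsDedekindDomain.primesOverFinset v.asIdeal (𝓞 L) =
      {W.asIdeal, (conjPlace τ W).asIdeal} := by
    ext P
    rw [IsDedekindDomain.mem_primesOverFinset_iff v.ne_bot]
    simp only [Finset.mem_insert, Finset.mem_singleton]
    constructor
    · rintro ⟨hP, hPv⟩
      let P' : HeightOneSpectrum (𝓞 L) := ⟨P, hP, Ideal.ne_bot_of_liesOver_of_ne_bot v.ne_bot P⟩
      have h1 : P'.under (𝓞 K) = W.under (𝓞 K) := by
        ext1
        exact hPv.over.symm
      exact (hτ.eq_or_eq h1).imp (congrArg HeightOneSpectrum.asIdeal)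
        (congrArg HeightOneSpectrum.asIdeal)
    · rintro (rfl | rfl)
      · exact ⟨W.isPrime, ⟨rfl⟩⟩
      · refine ⟨(conjPlace τ W).isPrime, ⟨?_⟩⟩
        exact congrArg HeightOneSpectrum.asIdeal (conjPlace_under τ W).symm
  rw [hset] at hsum
  by_cases hW : conjPlace τ W = W
  · left
    refine ⟨hW, ?_⟩
    rw [hW] at hsum
    simpa using hsum
  · right
    refine ⟨hW, ?_⟩
    rw [Finset.sum_pair (fun h ↦ hW (HeightOneSpectrum.ext h.symm))] at hsum
    have hlies : (conjPlace τ W).asIdeal.LiesOver v.asIdeal :=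
      ⟨congrArg HeightOneSpectrum.asIdeal (conjPlace_under τ W).symm⟩
    have hlies' : W.asIdeal.LiesOver v.asIdeal := ⟨rfl⟩
    have p1 := Nat.pos_of_ne_zero (ramificationIdx'_under_ne_zero K W)
    have p2 := Ideal.inertiaDeg'_pos v.asIdeal W.asIdeal
    have p3 := Nat.pos_of_ne_zero (ramificationIdx'_under_ne_zero K (conjPlace τ W))
    rw [conjPlace_under, ← hv] at p3
    have p4 := Ideal.inertiaDeg'_pos v.asIdeal (conjPlace τ W).asIdeal
    have q1 := Nat.mul_pos p1 p2
    have q2 := Nat.mul_pos p3 p4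
    have : v.asIdeal.ramificationIdx' W.asIdeal * v.asIdeal.inertiaDeg' W.asIdeal = 1 := by
      change 0 < v.asIdeal.ramificationIdx' W.asIdeal * v.asIdeal.inertiaDeg' W.asIdeal at q1
      omega
    exact ⟨Nat.eq_one_of_mul_eq_one_right this, Nat.eq_one_of_mul_eq_one_left this⟩

theorem absNorm_eq (W : HeightOneSpectrum (𝓞 L)) (hW : conjPlace τ W ≠ W) :
    Ideal.absNorm W.asIdeal = Ideal.absNorm (W.under (𝓞 K)).asIdeal := by
  rw [Ideal.absNorm_eq_pow_inertiaDeg'_of_liesOver W.asIdeal (W.under (𝓞 K)).asIdeal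
    (W.under (𝓞 K)).isPrime (W.under (𝓞 K)).ne_bot]
  rcases hτ.efCases W with h | h
  · exact absurd h.1 hW
  · rw [h.2.2, pow_one]

end IsQuadConj

end

section
variable {K L : Type*} [Field K] [NumberField K] [Field L] [NumberField L] [Algebra K L]

theorem two_le_absNorm (v : HeightOneSpectrum (𝓞 K)) : 2 ≤ Ideal.absNorm v.asIdeal := by
  have h1 : Ideal.absNorm v.asIdeal ≠ 1 := fun h ↦ v.isPrime.ne_top (Ideal.absNorm_eq_one_iff.1 h)
  have h0 : Ideal.absNorm v.asIdeal ≠ 0 := fun h ↦ v.ne_bot (Ideal.absNorm_eq_zero_iff.1 h)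
  omega

theorem IsQuadConj.finite_preimage {τ : L ≃ₐ[K] L} (hτ : IsQuadConj τ)
    {Bad : Set (HeightOneSpectrum (𝓞 K))} (hBad : Bad.Finite) :
    {W : HeightOneSpectrum (𝓞 L) | W.under (𝓞 K) ∈ Bad}.Finite := by
  refine hBad.preimage' fun v _ ↦ ?_
  obtain ⟨W, hW⟩ := exists_under_eq (L := L) v
  refine (Set.toFinite {W, conjPlace τ W}).subset fun W' hW' ↦ ?_
  exact hτ.eq_or_eq ((show W'.under (𝓞 K) = v from hW').trans hW.symm)

theorem IsQuadConj.exists_conjPlace_eq {τ : L ≃ₐ[K] L} (hτ : IsQuadConj τ)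
    {Bad : Set (HeightOneSpectrum (𝓞 K))} (hBad : Bad.Finite) :
    ∃ W : HeightOneSpectrum (𝓞 L), W.under (𝓞 K) ∉ Bad ∧ conjPlace τ W = W := by
  classical
  by_contra! hcon
  choose f hf using fun v : HeightOneSpectrum (𝓞 K) ↦ exists_under_eq (L := L) v
  have := hBad.to_subtype
  obtain ⟨C, hC, hCle⟩ := mzeta_finite Bad
  refine not_realZeta_sq_le K L (C ^ 2) (ENNReal.pow_ne_top hC) fun s hs ↦ ?_
  set q : HeightOneSpectrum (𝓞 K) → ENNReal :=
    fun w ↦ ENNReal.ofReal ((Ideal.absNorm w.asIdeal : ℝ) ^ (-s)) with hq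
  have hq2 (w) : q w ≤ 2⁻¹ := by
    rw [hq]
    have h2 : (2 : ℝ) ≤ Ideal.absNorm w.asIdeal := by exact_mod_cast two_le_absNorm w
    have h3 : ((Ideal.absNorm w.asIdeal : ℝ) ^ (-s)) ≤ 2⁻¹ := by
      calc _ ≤ (Ideal.absNorm w.asIdeal : ℝ) ^ (-1 : ℝ) :=
            Real.rpow_le_rpow_of_exponent_le (by linarith) (by linarith)
        _ = (Ideal.absNorm w.asIdeal : ℝ)⁻¹ := by rw [Real.rpow_neg_one]
        _ ≤ 2⁻¹ := by gcongr
    calc _ ≤ ENNReal.ofReal 2⁻¹ := ENNReal.ofReal_le_ofReal h3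
      _ = 2⁻¹ := by
        rw [ENNReal.ofReal_inv_of_pos two_pos, ENNReal.ofReal_ofNat]
  have h1 : realZeta K s ≤ mzeta (fun x : Bad ↦ q x) * mzeta (fun x : (Badᶜ : Set _) ↦ q x) := by
    have := mzeta_le_of_injective q (fun x ↦ q (Equiv.Set.sumCompl Bad x))
      (Equiv.Set.sumCompl Bad).symm (Equiv.injective _) (by simp)
    rw [mzeta_sum] at this
    simpa only [Equiv.apply_symm_apply, Equiv.Set.sumCompl_apply_inl, Equiv.Set.sumCompl_apply_inr]
      using (show realZeta K s = mzeta q from rfl).trans_le this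
  have h2 : mzeta (fun x : (Badᶜ : Set _) ↦ q x) ^ 2 ≤ realZeta L s := by
    let q2 : (Badᶜ : Set (HeightOneSpectrum (𝓞 K))) ⊕ (Badᶜ : Set (HeightOneSpectrum (𝓞 K))) →
      ENNReal := Sum.elim (fun x ↦ q x) (fun x ↦ q x)
    have h3 := mzeta_sum q2
    simp only [q2, Sum.elim_inl, Sum.elim_inr] at h3
    rw [pow_two, ← h3]
    have hne (x : (Badᶜ : Set (HeightOneSpectrum (𝓞 K)))) : conjPlace τ (f x) ≠ f x :=
      hcon _ (by rw [hf]; exact x.2)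
    refine mzeta_le_of_injective _ _ (Sum.elim (fun x ↦ f x) (fun x ↦ conjPlace τ (f x))) ?_ ?_
    · have hinj (x y : (Badᶜ : Set (HeightOneSpectrum (𝓞 K)))) (h : f x = f y) : x = y := by
        ext1
        rw [← hf x, h, hf]
      have hmix (x y : (Badᶜ : Set (HeightOneSpectrum (𝓞 K)))) : f x ≠ conjPlace τ (f y) := by
        intro h
        have h4 : x = y := by
          ext1
          rw [← hf x, h, conjPlace_under, hf]
        subst h4
        exact hne _ h.symm
      rintro (x | x) (y | y) h
      · rw [hinj x y h]
      · exact absurd h (hmix x y)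
      · exact absurd h.symm (hmix y x)
      · simp only [Sum.elim_inr] at h
        have h5 := congrArg (conjPlace τ) h
        rw [hτ.conjPlace_conjPlace, hτ.conjPlace_conjPlace] at h5
        rw [hinj x y h5]
    · rintro (x | x)
      · simp only [Sum.elim_inl, hq]
        rw [hτ.absNorm_eq _ (hne x), hf]
      · simp only [Sum.elim_inr, hq]
        rw [hτ.absNorm_eq _ (by rw [hτ.conjPlace_conjPlace]; exact (hne x).symm), conjPlace_under,
          hf]
  calc realZeta K s ^ 2 ≤ (C * mzeta (fun x : (Badᶜ : Set _) ↦ q x)) ^ 2 := by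
        gcongr
        exact h1.trans (by gcongr; exact hCle _ fun y ↦ hq2 y)
    _ = C ^ 2 * mzeta (fun x : (Badᶜ : Set _) ↦ q x) ^ 2 := mul_pow _ _ _
    _ ≤ _ := by gcongr

end

/-- Existence of the quadratic extension `K(√u)`. -/
theorem exists_quadratic (K : Type) [Field K] [NumberField K] (u : K) (hu : ¬ IsSquare u) :
    ∃ (L : Type) (_ : Field L) (_ : NumberField L) (_ : Algebra K L) (τ : L ≃ₐ[K] L) (s : L),
      IsQuadConj τ ∧ s ^ 2 = algebraMap K L u ∧ τ s = -s := by
  open Polynomial in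
  have hirr : Irreducible (X ^ 2 - C u) := by
    refine X_pow_sub_C_irreducible_of_prime Nat.prime_two fun b hb ↦ hu ⟨b, ?_⟩
    rw [← hb, pow_two]
  have : Fact (Irreducible (Polynomial.X ^ 2 - Polynomial.C u)) := ⟨hirr⟩
  let L := AdjoinRoot (Polynomial.X ^ 2 - Polynomial.C u)
  let s : L := AdjoinRoot.root _
  have hs : s ^ 2 = algebraMap K L u := by
    have := AdjoinRoot.eval₂_root (Polynomial.X ^ 2 - Polynomial.C u)
    rw [Polynomial.eval₂_sub, Polynomial.eval₂_pow, Polynomial.eval₂_X, Polynomial.eval₂_C,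
      sub_eq_zero] at this
    exact this
  have hne : (Polynomial.X ^ 2 - Polynomial.C u) ≠ 0 := hirr.ne_zero
  let pb := AdjoinRoot.powerBasis hne
  have hdim : pb.dim = 2 := by
    rw [AdjoinRoot.powerBasis_dim]
    compute_degree!
  have hfin : Module.Finite K L := pb.finite
  have hrank : Module.finrank K L = 2 := by rw [pb.finrank, hdim]
  have hnf : NumberField L :=
    { to_charZero := charZero_of_injective_algebraMap (algebraMap K L).injective
      to_finiteDimensional := by
        have : CharZero L := charZero_of_injective_algebraMap (algebraMap K L).injective
        exact FiniteDimensional.trans ℚ K L }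
  let t : L →ₐ[K] L := AdjoinRoot.liftAlgHom _ (Algebra.ofId K L) (-s) (by
    rw [Polynomial.eval₂_sub, Polynomial.eval₂_pow, Polynomial.eval₂_X,
      Polynomial.eval₂_C, neg_sq, hs]
    exact sub_self _)
  have hts : t s = -s := AdjoinRoot.liftAlgHom_root _ _ _ _
  have htt : t.comp t = AlgHom.id K L := by
    apply AdjoinRoot.algHom_ext
    change t (t s) = s
    rw [hts, map_neg, hts, neg_neg]
  let τ : L ≃ₐ[K] L := AlgEquiv.ofAlgHom t t htt htt
  have hmem (x : L) : ∃ a b : K, x = algebraMap K L a + algebraMap K L b * s := by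
    obtain ⟨f, hf, hx⟩ := pb.exists_eq_aeval x
    rw [hdim] at hf
    obtain ⟨a, b, hab⟩ := Polynomial.exists_eq_X_add_C_of_natDegree_le_one (p := f) (by omega)
    refine ⟨b, a, ?_⟩
    rw [hx, hab]
    have : pb.gen = s := rfl
    rw [this, map_add, map_mul, Polynomial.aeval_C, Polynomial.aeval_C, Polynomial.aeval_X,
      add_comm]
  refine ⟨L, inferInstance, hnf, inferInstance, τ, s, ⟨hrank, fun x ↦ DFunLike.congr_fun htt x, ?_⟩,
    hs, hts⟩
  intro x hx
  obtain ⟨a, b, rfl⟩ := hmem x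
  have h1 : t (algebraMap K L a + algebraMap K L b * s) =
    algebraMap K L a + algebraMap K L b * s := hx
  rw [map_add, map_mul, hts, AlgHom.commutes, AlgHom.commutes] at h1
  have h2 : (2 : L) * (algebraMap K L b * s) = 0 := by linear_combination -h1
  have h3 : algebraMap K L b * s = 0 := (mul_eq_zero.1 h2).resolve_left two_ne_zero
  exact ⟨a, by rw [h3, add_zero]⟩

section
variable {K L : Type*} [Field K] [NumberField K] [Field L] [NumberField L] [Algebra K L]

/-- An odd place at which `s ^ 2` is a local square splits in `K(s)`. -/
theorem conjPlace_ne_of_mem_locSq {τ : L ≃ₐ[K] L} {s : L} {u : Kˣ} (hs : s ^ 2 = algebraMap K L u)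
    (hτs : τ s = -s) (W : HeightOneSpectrum (𝓞 L)) (h2 : (2 : 𝓞 K) ∉ (W.under (𝓞 K)).asIdeal)
    (hu : u ∈ locSq (W.under (𝓞 K))) : conjPlace τ W ≠ W := by
  intro hW
  have hτW (x : L) : W.valuation L (τ x) = W.valuation L x := by
    rw [← valuation_conjPlace, hW]
  obtain ⟨y, hy⟩ := mem_locSq.1 hu
  rw [← valuation_algebraMap_lt_one_iff] at hy
  set z : L := s * algebraMap K L y with hz
  have h1 : W.valuation L ((z - 1) * (z + 1)) < 1 := by
    convert hy using 2
    rw [map_sub, map_mul, map_pow, map_one, ← hs, hz]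
    ring
  have h3 : W.valuation L (z + 1) = W.valuation L (z - 1) := by
    rw [← hτW (z - 1), ← Valuation.map_neg]
    congr 1
    rw [hz, map_sub, map_mul, hτs, AlgEquiv.commutes, map_one]
    ring
  have h4 : W.valuation L (z - 1) < 1 := by
    rw [map_mul, h3, ← pow_two] at h1
    exact (pow_lt_one_iff two_ne_zero).1 h1
  have h5 : W.valuation L ((z + 1) - (z - 1)) < 1 := Valuation.map_sub_lt _ (h3 ▸ h4) h4
  have h6 : (z + 1) - (z - 1) = algebraMap K L (algebraMap (𝓞 K) K 2) := by
    rw [map_ofNat, map_ofNat]; ring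
  rw [h6, valuation_algebraMap_lt_one_iff, HeightOneSpectrum.valuation_lt_one_iff_mem] at h5
  exact h2 h5

theorem finite_valuation_ne_one (x : Kˣ) :
    {v : HeightOneSpectrum (𝓞 K) | v.valuation K (x : K) ≠ 1}.Finite := by
  refine ((HeightOneSpectrum.Support.finite (𝓞 K) (x : K)).union
    (HeightOneSpectrum.Support.finite (𝓞 K) ((x⁻¹ : Kˣ) : K))).subset fun v hv ↦ ?_
  rcases lt_or_gt_of_ne hv with h | h
  · right
    change 1 < v.valuation K ((x⁻¹ : Kˣ) : K)
    rw [Units.val_inv_eq_inv_val, map_inv₀]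
    exact (one_lt_inv₀ (by simp [zero_lt_iff])).2 h
  · exact Or.inl h

theorem finite_two_mem : {v : HeightOneSpectrum (𝓞 K) | (2 : 𝓞 K) ∈ v.asIdeal}.Finite := by
  refine (finite_valuation_ne_one (Units.mk0 (2 : K) two_ne_zero)).subset fun v hv ↦ ?_
  have h1 : v.valuation K (algebraMap (𝓞 K) K 2) < 1 :=
    (HeightOneSpectrum.valuation_lt_one_iff_mem _ _).2 hv
  rw [map_ofNat] at h1
  exact h1.ne
end

theorem exists_notMem_locSq {K : Type} [Field K] [NumberField K] (u : Kˣ) (hu : ¬ IsSquare (u : K))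
    {Bad : Set (HeightOneSpectrum (𝓞 K))} (hBad : Bad.Finite) :
    ∃ v : HeightOneSpectrum (𝓞 K), v ∉ Bad ∧ (2 : 𝓞 K) ∉ v.asIdeal ∧ v.valuation K (u : K) = 1 ∧
      u ∉ locSq v := by
  obtain ⟨L, _, _, _, τ, s, hτ, hs, hτs⟩ := exists_quadratic K u hu
  obtain ⟨W, hW, hWW⟩ := hτ.exists_conjPlace_eq
    ((hBad.union finite_two_mem).union (finite_valuation_ne_one u))
  simp only [Set.mem_union, not_or, Set.mem_ofPred_eq, not_not] at hW
  exact ⟨_, hW.1.1, hW.1.2, hW.2, fun h ↦ conjPlace_ne_of_mem_locSq hs hτs W hW.1.2 h hWW⟩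

/-- If `u` is not `±` a square in the real field `K`, it is a local nonsquare at some odd place at
which `-1` is a local square. -/
theorem exists_neg_one_mem_locSq {K : Type} [Field K] [NumberField K] (h1 : ¬ IsSquare (-1 : K))
    (u : Kˣ) (hu : ¬ IsSquare (u : K)) (hu' : ¬ IsSquare (-u : K))
    {Bad : Set (HeightOneSpectrum (𝓞 K))} (hBad : Bad.Finite) :
    ∃ v : HeightOneSpectrum (𝓞 K), v ∉ Bad ∧ (2 : 𝓞 K) ∉ v.asIdeal ∧ v.valuation K (u : K) = 1 ∧
      u ∉ locSq v ∧ (-1 : Kˣ) ∈ locSq v := by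
  obtain ⟨E, _, _, _, τ, i, hτ, hi, hτi⟩ := exists_quadratic K (-1) h1
  set U : Eˣ := Units.map (algebraMap K E : K →* E) u with hU
  have hsq : ¬ IsSquare (U : E) := by
    rintro ⟨z, hz⟩
    have hz' : algebraMap K E u = z * z := hz
    have hi0 : i ≠ 0 := by
      rintro rfl
      simp at hi
    have h3 : τ z = z ∨ τ z = -z := by
      have : τ z * τ z = z * z := by rw [← map_mul, ← hz', AlgEquiv.commutes]
      exact mul_self_eq_mul_self_iff.1 this
    rcases h3 with h3 | h3
    · obtain ⟨c, rfl⟩ := hτ.fixed z h3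
      rw [← map_mul] at hz'
      exact hu ⟨c, (algebraMap K E).injective hz'⟩
    · obtain ⟨c, hc⟩ := hτ.fixed (z * i) (by rw [map_mul, h3, hτi]; ring)
      refine hu' ⟨c, (algebraMap K E).injective ?_⟩
      rw [map_mul, hc, map_neg, hz', show z * i * (z * i) = z * z * i ^ 2 by ring, hi]
      simp
  obtain ⟨w, hw, hw2, hwu, hwl⟩ := exists_notMem_locSq U hsq
    (Bad := {w | w.under (𝓞 K) ∈ Bad}) (hτ.finite_preimage hBad)
  have hv1 := (valuation_algebraMap_eq_one_iff K w _).1 hwu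
  have hw2' := (two_mem_iff K w).not.1 hw2
  refine ⟨w.under (𝓞 K), hw, hw2', hv1,
    fun h ↦ hwl (map_mem_locSq w h), ?_⟩
  by_contra hneg
  have h3 := mul_mem_locSq hw2' (x := -1) (by simp) hv1 hneg (fun h ↦ hwl (map_mem_locSq w h))
  have h4 := map_mem_locSq w h3
  have hi0 : i ≠ 0 := by
    rintro rfl
    simp at hi
  have h5 := sq_mem_locSq (v := w) (Units.mk0 i hi0)
  have h6 := mul_mem h4 h5
  refine hwl ?_
  convert h6 using 1
  ext
  simp [hi, hU]

section
variable {K : Type*} [Field K] [NumberField K]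

theorem exists_coprime_two_mk0_eq (c : ClassGroup (𝓞 K)) :
    ∃ I : nonZeroDivisors (Ideal (𝓞 K)), ClassGroup.mk0 I = c ∧
      (I : Ideal (𝓞 K)) ⊔ Ideal.span {2} = ⊤ := by
  obtain ⟨⟨J, hJ⟩, hJc⟩ := ClassGroup.mk0_surjective c⁻¹
  have hJ0 : J ≠ ⊥ := nonZeroDivisors.ne_zero hJ
  have h2 : (Ideal.span {2} : Ideal (𝓞 K)) ≠ ⊥ := by simp
  obtain ⟨a, ha⟩ := IsDedekindDomain.exists_sup_span_eq (I := Ideal.span {2} * J) (J := J)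
    Ideal.mul_le_right (mul_ne_zero h2 hJ0)
  have haJ : J ∣ Ideal.span {a} := by
    rw [Ideal.dvd_iff_le, ← ha]
    exact le_sup_right
  obtain ⟨I, hI⟩ := haJ
  have hsup : I ⊔ Ideal.span {2} = ⊤ := by
    have h3 : J * (I ⊔ Ideal.span {2}) = J * ⊤ := by
      rw [Ideal.mul_sup, ← hI, Ideal.mul_top, sup_comm, mul_comm J, ha]
    exact mul_left_cancel₀ hJ0 h3
  have hI0 : I ≠ ⊥ := by
    rintro rfl
    rw [bot_sup_eq] at hsup
    have h4 := congrArg Ideal.absNorm hsup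
    rw [Ideal.absNorm_top, Ideal.absNorm_span_singleton] at h4
    have h5 : Algebra.norm ℤ (2 : 𝓞 K) = 2 ^ Module.finrank ℤ (𝓞 K) := by
      have := Algebra.norm_algebraMap (S := 𝓞 K) (2 : ℤ)
      rwa [map_ofNat] at this
    rw [h5, Int.natAbs_pow, show (2 : ℤ).natAbs = 2 from rfl, RingOfIntegers.rank] at h4
    have := Module.finrank_pos (R := ℚ) (M := K)
    exact absurd h4 (Nat.one_lt_two_pow this.ne').ne'
  refine ⟨⟨I, mem_nonZeroDivisors_of_ne_zero hI0⟩, ?_, hsup⟩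
  have ha0 : a ≠ 0 := by
    rintro rfl
    rw [Ideal.span_singleton_zero] at hI
    exact mul_ne_zero hJ0 hI0 hI.symm
  have h6 : ClassGroup.mk0 (⟨J, hJ⟩ * ⟨I, mem_nonZeroDivisors_of_ne_zero hI0⟩) = 1 := by
    rw [ClassGroup.mk0_eq_one_iff]
    change (J * I).IsPrincipal
    rw [← hI]
    exact ⟨a, rfl⟩
  rw [map_mul, hJc, inv_mul_eq_one] at h6
  exact h6.symm

variable (K) in
/-- There is a finite set of odd places generating the class group, in the form that all other
places have a generator up to this set. -/
theorem exists_classGroup_generators : ∃ S : Finset (HeightOneSpectrum (𝓞 K)),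
    (∀ v ∈ S, (2 : 𝓞 K) ∉ v.asIdeal) ∧ ∀ v ∉ S, ∃ π : Kˣ,
      v.valuation K (π : K) = WithZero.exp (-1 : ℤ) ∧
      ∀ w ∉ S, w ≠ v → w.valuation K (π : K) = 1 := by
  classical
  choose I hI hI2 using exists_coprime_two_mk0_eq (K := K)
  have hfin : {v : HeightOneSpectrum (𝓞 K) | ∃ c, v.asIdeal ∣ (I c : Ideal (𝓞 K))}.Finite := by
    have : {v : HeightOneSpectrum (𝓞 K) | ∃ c, v.asIdeal ∣ (I c : Ideal (𝓞 K))} =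
        ⋃ c, {v | v.asIdeal ∣ (I c : Ideal (𝓞 K))} := by ext; simp
    rw [this]
    exact Set.finite_iUnion fun c ↦ Ideal.finite_factors (nonZeroDivisors.ne_zero (I c).2)
  refine ⟨hfin.toFinset, ?_, ?_⟩
  · intro v hv h2
    rw [Set.Finite.mem_toFinset] at hv
    obtain ⟨c, hc⟩ := hv
    refine v.isPrime.ne_top (top_le_iff.1 ?_)
    rw [← hI2 c]
    exact sup_le (Ideal.dvd_iff_le.1 hc) ((Ideal.span_singleton_le_iff_mem _).2 h2)
  · intro v hv
    rw [Set.Finite.mem_toFinset] at hv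
    set c := (ClassGroup.mk0 ⟨v.asIdeal, mem_nonZeroDivisors_of_ne_zero v.ne_bot⟩)⁻¹ with hc
    have h1 : ClassGroup.mk0 (⟨v.asIdeal, mem_nonZeroDivisors_of_ne_zero v.ne_bot⟩ * I c) = 1 := by
      rw [map_mul, hI, hc, mul_inv_cancel]
    rw [ClassGroup.mk0_eq_one_iff] at h1
    obtain ⟨g, hg⟩ := h1
    replace hg : v.asIdeal * (I c : Ideal (𝓞 K)) = Ideal.span {g} := hg
    have hIc : (I c : Ideal (𝓞 K)) ≠ 0 := nonZeroDivisors.ne_zero (I c).2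
    have hg0 : g ≠ 0 := by
      rintro rfl
      rw [Ideal.span_singleton_zero] at hg
      exact mul_ne_zero v.ne_bot hIc hg
    have hg0' : algebraMap (𝓞 K) K g ≠ 0 := by simpa using hg0
    refine ⟨Units.mk0 _ hg0', ?_, ?_⟩
    · rw [Units.val_mk0]
      have h3 : v.intValuation g ≤ WithZero.exp (-((1 : ℕ) : ℤ)) := by
        rw [HeightOneSpectrum.intValuation_le_pow_iff_mem, pow_one]
        rw [← Ideal.dvd_span_singleton, ← hg]
        exact dvd_mul_right _ _
      have h4 : ¬ v.intValuation g ≤ WithZero.exp (-((2 : ℕ) : ℤ)) := by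
        rw [HeightOneSpectrum.intValuation_le_pow_iff_mem, ← Ideal.dvd_span_singleton, ← hg,
          pow_two,
          mul_dvd_mul_iff_left v.ne_bot]
        exact fun h ↦ hv ⟨c, h⟩
      rw [HeightOneSpectrum.valuation_of_algebraMap]
      have h5 := v.intValuation_ne_zero g hg0
      rw [← WithZero.exp_log h5, WithZero.exp_le_exp] at h3 h4
      rw [← WithZero.exp_log h5]
      congr 1
      push_cast at h3 h4
      omega
    · intro w hw hwv
      rw [Set.Finite.mem_toFinset] at hw
      rw [Units.val_mk0, HeightOneSpectrum.valuation_eq_one_iff_notMem]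
      intro hgw
      rw [← Ideal.dvd_span_singleton, ← hg, w.prime.dvd_mul] at hgw
      rcases hgw with h | h
      · refine hwv (HeightOneSpectrum.ext ?_)
        exact (v.isMaximal.eq_of_le w.isPrime.ne_top (Ideal.dvd_iff_le.1 h)).symm
      · exact hw ⟨c, h⟩

end

theorem mem_unit_of_sq_mem {K : Type*} [Field K] [NumberField K]
    {S : Set (HeightOneSpectrum (𝓞 K))} {x : Kˣ} (h : x ^ 2 ∈ S.unit K) : x ∈ S.unit K := by
  intro v hv
  have h1 := h v hv
  rw [Units.val_pow_eq_pow_val, map_pow, pow_eq_one_iff] at h1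
  exact h1.resolve_right two_ne_zero

theorem neg_one_mem_unit {K : Type*} [Field K] [NumberField K]
    (S : Set (HeightOneSpectrum (𝓞 K))) : (-1 : Kˣ) ∈ S.unit K := fun v _ ↦ by simp

theorem Subgroup.relIndex_sup_neg_one_le {F : Type*} [Field F] (A : Subgroup Fˣ) :
    (A.map (powMonoidHom 2)).relIndex (A.map (powMonoidHom 2) ⊔ Subgroup.zpowers (-1)) ≤ 2 := by
  rw [Subgroup.relIndex_sup_left]
  have h (x : Fˣ) (hx : x ∈ Subgroup.zpowers (-1 : Fˣ)) : x = 1 ∨ x = -1 := by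
    obtain ⟨n, rfl⟩ := hx
    exact (Int.even_or_odd n).imp (fun h ↦ h.neg_one_zpow) fun h ↦ h.neg_one_zpow
  refine (Subgroup.relIndex_le_two fun x hx y hy hx' hy' ↦ ?_).2
  rcases h x hx with rfl | rfl
  · exact absurd (one_mem _) hx'
  rcases h y hy with rfl | rfl
  · exact absurd (one_mem _) hy'
  simp [one_mem]

theorem exists_nonsquare_unit {K : Type*} [Field K] [NumberField K]
    (S : Finset (HeightOneSpectrum (𝓞 K))) {ι : Type*} [Fintype ι]
    (v : ι → HeightOneSpectrum (𝓞 K)) (hS : ∀ i, v i ∉ S) (hv2 : ∀ i, (2 : 𝓞 K) ∉ (v i).asIdeal)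
    (hr : Fintype.card ι <
      Module.finrank ℤ (Additive ((S : Set (HeightOneSpectrum (𝓞 K))).unit K))) :
    ∃ u ∈ (S : Set (HeightOneSpectrum (𝓞 K))).unit K, (∀ i, u ∈ locSq (v i)) ∧
      ¬ IsSquare (u : K) ∧ ¬ IsSquare (-u : K) := by
  by_contra! hcon
  obtain ⟨U, hU⟩ : ∃ U, U = (S : Set (HeightOneSpectrum (𝓞 K))).unit K := ⟨_, rfl⟩
  have hfin : Module.Finite ℤ (Additive U) := hU ▸ unit_finite S
  rw [← hU] at hr hcon
  have hUv (x : Kˣ) (hx : x ∈ U) (w : HeightOneSpectrum (𝓞 K)) (hw : w ∉ S) :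
      w.valuation K (x : K) = 1 := (hU ▸ hx :) w hw
  have hnegU : (-1 : Kˣ) ∈ U := hU ▸ neg_one_mem_unit _
  have hsqU (x : Kˣ) (hx : x ^ 2 ∈ U) : x ∈ U := by
    subst hU
    exact mem_unit_of_sq_mem hx
  obtain ⟨D, hD⟩ : ∃ D, D = U.map (powMonoidHom 2) ⊔ Subgroup.zpowers (-1 : Kˣ) := ⟨_, rfl⟩
  have hsqD : U.map (powMonoidHom 2) ≤ D := hD ▸ le_sup_left
  have hDU : D ≤ U := by
    rw [hD]
    refine sup_le ?_ ((Subgroup.zpowers_le).2 hnegU)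
    rintro _ ⟨x, hx, rfl⟩
    exact pow_mem hx 2
  have hDle : U ⊓ ⨅ i, locSq (v i) ≤ D := by
    rintro u ⟨huU, hu⟩
    have hsq : u ∈ D ∨ -u ∈ D := by
      by_cases hu' : IsSquare (u : K)
      · obtain ⟨c, hc⟩ := hu'
        have hc0 : c ≠ 0 := by
          rintro rfl
          simp at hc
        have hc2 : Units.mk0 c hc0 ^ 2 = u := by
          ext
          rw [hc, Units.val_pow_eq_pow_val, Units.val_mk0, pow_two]
        exact Or.inl (hsqD
          ⟨Units.mk0 c hc0, hsqU _ (hc2 ▸ huU), hc2⟩)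
      · obtain ⟨c, hc⟩ := hcon u huU (by simpa using hu) hu'
        have hc0 : c ≠ 0 := by
          rintro rfl
          simp at hc
        have hc2 : Units.mk0 c hc0 ^ 2 = -u := by
          ext
          rw [Units.val_neg, hc, Units.val_pow_eq_pow_val, Units.val_mk0, pow_two]
        have huU' : -u ∈ U := by
          rw [← neg_one_mul]
          exact mul_mem hnegU huU
        exact Or.inr (hsqD
          ⟨Units.mk0 c hc0, hsqU _ (hc2 ▸ huU'), hc2⟩)
    refine hsq.elim id fun h ↦ ?_
    have h2 : (-1 : Kˣ) ∈ D := by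
        rw [hD]
        exact Subgroup.mem_sup_right (Subgroup.mem_zpowers _)
    have h3 := mul_mem h2 h
    rwa [neg_mul_neg, one_mul] at h3
  have h3 (i : ι) := locSq_relIndex_ker (hv2 i) (A := U) fun x hx ↦ hUv x hx _ (hS i)
  have h4 : (⨅ i, locSq (v i)).relIndex U ≠ 0 := Subgroup.relIndex_iInf_ne_zero fun i ↦ (h3 i).1
  have h5 : (⨅ i, locSq (v i)).relIndex U ≤ 2 ^ Fintype.card ι := by
    refine (Subgroup.relIndex_iInf_le _).trans ?_
    calc _ ≤ ∏ _i : ι, 2 := Finset.prod_le_prod' fun i _ ↦ (h3 i).2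
      _ = 2 ^ Fintype.card ι := by simp
  rw [← Subgroup.inf_relIndex_right, inf_comm] at h4 h5
  have h6 := Subgroup.relIndex_le_of_le_left hDle h4
  have h7 := Subgroup.relIndex_mul_relIndex (U.map (powMonoidHom 2)) D U hsqD hDU
  rw [Subgroup.relIndex_map_sq U hnegU] at h7
  have h8 := Subgroup.relIndex_sup_neg_one_le U
  rw [← hD] at h8
  have h9 : 2 ^ (Module.finrank ℤ (Additive U) + 1) ≤ 2 * 2 ^ Fintype.card ι := by
    rw [← h7]
    exact Nat.mul_le_mul h8 (h6.trans h5)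
  rw [← pow_succ'] at h9
  have := (Nat.pow_le_pow_iff_right (by norm_num)).1 h9
  omega

/-- Auxiliary places at which `-1` is a square, with a dual family of `S`-units. -/
theorem exists_dual_places {K : Type} [Field K] [NumberField K] (h1 : ¬ IsSquare (-1 : K))
    (S : Finset (HeightOneSpectrum (𝓞 K))) (r : ℕ)
    (hr : r ≤ Module.finrank ℤ (Additive ((S : Set (HeightOneSpectrum (𝓞 K))).unit K))) :
    ∃ (ι : Type) (_ : Fintype ι) (v : ι → HeightOneSpectrum (𝓞 K)) (e : ι → Kˣ),
      Fintype.card ι = r ∧ Function.Injective v ∧ (∀ i, v i ∉ S) ∧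
      (∀ i, (2 : 𝓞 K) ∉ (v i).asIdeal) ∧ (∀ i, (-1 : Kˣ) ∈ locSq (v i)) ∧
      (∀ i, e i ∈ (S : Set (HeightOneSpectrum (𝓞 K))).unit K) ∧ (∀ i, e i ∉ locSq (v i)) ∧
      ∀ i j, j ≠ i → e i ∈ locSq (v j) := by
  classical
  induction r with
  | zero =>
    exact ⟨Empty, inferInstance, fun i ↦ i.elim, fun i ↦ i.elim, rfl, fun i ↦ i.elim,
      fun i ↦ i.elim, fun i ↦ i.elim, fun i ↦ i.elim, fun i ↦ i.elim, fun i ↦ i.elim,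
      fun i ↦ i.elim⟩
  | succ r ih =>
    obtain ⟨ι, _, v, e, hcard, hinj, hS, hv2, hneg, heU, he, he'⟩ := ih (by omega)
    set U := (S : Set (HeightOneSpectrum (𝓞 K))).unit K with hU
    have hUv (x : Kˣ) (hx : x ∈ U) (w : HeightOneSpectrum (𝓞 K)) (hw : w ∉ S) :
        w.valuation K (x : K) = 1 := hx w hw
    have hnegU : (-1 : Kˣ) ∈ U := neg_one_mem_unit _
    obtain ⟨u, huU, huv, hu1, hu2⟩ : ∃ u ∈ U, (∀ i, u ∈ locSq (v i)) ∧ ¬ IsSquare (u : K) ∧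
        ¬ IsSquare (-u : K) := by
      exact exists_nonsquare_unit S v hS hv2 (hcard.symm ▸ hr)
    obtain ⟨w, hw, hw2, hwu, hwl, hw1⟩ := exists_neg_one_mem_locSq h1 u hu1 hu2
      (Bad := S ∪ Set.range v) (S.finite_toSet.union (Set.finite_range v))
    simp only [Set.mem_union, Finset.mem_coe, Set.mem_range, not_or, not_exists] at hw
    refine ⟨Option ι, inferInstance, fun o ↦ o.elim w v, fun o ↦ o.elim u fun i ↦
      if e i ∈ locSq w then e i else e i * u, by simp [hcard], ?_, ?_, ?_, ?_, ?_, ?_, ?_⟩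
    · rintro (_ | i) (_ | j) h
      · rfl
      · exact absurd h.symm (hw.2 j)
      · exact absurd h (hw.2 i)
      · exact congrArg some (hinj h)
    · rintro (_ | i)
      exacts [hw.1, hS i]
    · rintro (_ | i)
      exacts [hw2, hv2 i]
    · rintro (_ | i)
      exacts [hw1, hneg i]
    · rintro (_ | i)
      · exact huU
      · simp only [Option.elim_some]
        split_ifs
        exacts [heU i, mul_mem (heU i) huU]
    · rintro (_ | i)
      · exact hwl
      · simp only [Option.elim_some]
        split_ifs
        · exact he i
        · rw [Subgroup.mul_mem_cancel_right _ (huv i)]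
          exact he i
    · rintro (_ | i) (_ | j) hij
      · exact absurd rfl hij
      · exact huv j
      · simp only [Option.elim_some, Option.elim_none]
        split_ifs with h
        · exact h
        · exact mul_mem_locSq hw2 (hUv _ (heU i) _ hw.1) hwu h hwl
      · have hji : j ≠ i := fun h ↦ hij (congrArg some h)
        simp only [Option.elim_some]
        split_ifs
        exacts [he' i j hji, mul_mem (he' i j hji) (huv j)]

section
variable (K : Type*) [Field K] [NumberField K]

theorem absNorm_span_two :
    Ideal.absNorm (Ideal.span {(2 : 𝓞 K)}) = 2 ^ Module.finrank ℚ K := by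
  rw [Ideal.absNorm_span_singleton]
  have h5 := Algebra.norm_algebraMap (S := 𝓞 K) (2 : ℤ)
  rw [map_ofNat] at h5
  rw [h5, Int.natAbs_pow, RingOfIntegers.rank]
  rfl

variable {K}

theorem ne_zero_of_isCoprime_two {a : 𝓞 K} (ha : IsCoprime a 2) : a ≠ 0 := by
  rintro rfl
  rw [isCoprime_zero_left] at ha
  have h1 := absNorm_span_two K
  rw [Ideal.span_singleton_eq_top.2 ha, Ideal.absNorm_top] at h1
  have := Module.finrank_pos (R := ℚ) (M := K)
  exact absurd h1 (Nat.one_lt_two_pow this.ne').ne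

variable (K) in
/-- The elements that are quotients of algebraic integers coprime to `2`. -/
def oddUnits : Subgroup Kˣ where
  carrier := {x | ∃ a d : 𝓞 K, IsCoprime a 2 ∧ IsCoprime d 2 ∧ (x : K) * d = a}
  one_mem' := ⟨1, 1, isCoprime_one_left, isCoprime_one_left, by simp⟩
  mul_mem' {x y} := by
    rintro ⟨a, d, ha, hd, h⟩ ⟨a', d', ha', hd', h'⟩
    refine ⟨a * a', d * d', ha.mul_left ha', hd.mul_left hd', ?_⟩
    push_cast
    linear_combination (y : K) * d' * h + (a : K) * h'
  inv_mem' {x} := by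
    rintro ⟨a, d, ha, hd, h⟩
    refine ⟨d, a, hd, ha, ?_⟩
    rw [← h, Units.val_inv_eq_inv_val, inv_mul_cancel_left₀ x.ne_zero]

variable (K) in
/-- The elements that are, up to squares of odd elements, congruent to a square modulo `4`. -/
def sqModFour : Subgroup Kˣ where
  carrier := {x | ∃ t d c : 𝓞 K, IsCoprime t 2 ∧ IsCoprime d 2 ∧ (x : K) * d ^ 2 = t ^ 2 + 4 * c}
  one_mem' := ⟨1, 1, 0, isCoprime_one_left, isCoprime_one_left, by simp⟩
  mul_mem' {x y} := by
    rintro ⟨t, d, c, ht, hd, h⟩ ⟨t', d', c', ht', hd', h'⟩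
    refine ⟨t * t', d * d', t ^ 2 * c' + c * t' ^ 2 + 4 * c * c', ht.mul_left ht',
      hd.mul_left hd', ?_⟩
    simp only [map_mul, map_add, map_pow, map_ofNat, Units.val_mul]
    linear_combination (y : K) * d' ^ 2 * h + (t ^ 2 + 4 * c : K) * h'
  inv_mem' {x} := by
    rintro ⟨t, d, c, ht, hd, h⟩
    have hB : IsCoprime (t ^ 2 + 4 * c) 2 := by
      have := (ht.pow_left (m := 2)).add_mul_left_left (2 * c)
      convert this using 1
      ring
    refine ⟨d * t, t ^ 2 + 4 * c, c * d ^ 2, hd.mul_left ht, hB, ?_⟩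
    have h2 : ((t ^ 2 + 4 * c : 𝓞 K) : K) = x * d ^ 2 := by
      rw [h]; push_cast; norm_cast
    rw [h2, Units.val_inv_eq_inv_val]
    field_simp
    push_cast
    linear_combination (d : K) ^ 2 * h

theorem sqModFour_le : sqModFour K ≤ oddUnits K := by
  rintro x ⟨t, d, c, ht, hd, h⟩
  refine ⟨t ^ 2 + 4 * c, d ^ 2, ?_, hd.pow_left, ?_⟩
  · have := (ht.pow_left (m := 2)).add_mul_left_left (2 * c)
    convert this using 1
    ring
  · push_cast
    rw [h]
    norm_cast

variable (K) in
theorem card_units_mod_four :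
    ((powMonoidHom 2 : (𝓞 K ⧸ Ideal.span {(4 : 𝓞 K)})ˣ →* _).range).index ≠ 0 ∧
    ((powMonoidHom 2 : (𝓞 K ⧸ Ideal.span {(4 : 𝓞 K)})ˣ →* _).range).index ≤
      2 ^ Module.finrank ℚ K := by
  set R := 𝓞 K ⧸ Ideal.span {(4 : 𝓞 K)} with hR
  have hfinR : Finite R := Ideal.finiteQuotientOfFreeOfNeBot _ (by simp)
  have hfin2 : Finite (𝓞 K ⧸ Ideal.span {(2 : 𝓞 K)}) :=
    Ideal.finiteQuotientOfFreeOfNeBot _ (by simp)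
  set f : Rˣ →* Rˣ := powMonoidHom 2 with hf
  have hidx : f.range.index = Nat.card f.ker := by
    have h1 := f.range.card_mul_index
    have h2 := f.ker.card_mul_index
    rw [Subgroup.index_ker] at h2
    have h3 : 0 < Nat.card f.range := Nat.card_pos
    refine Nat.eq_of_mul_eq_mul_left h3 ?_
    rw [h1, ← h2, mul_comm]
  refine ⟨Subgroup.index_ne_zero_of_finite, ?_⟩
  rw [hidx, ← absNorm_span_two, Ideal.absNorm_apply, Submodule.cardQuot_apply]
  have key (u : f.ker) : ∃ z : 𝓞 K, ((u : Rˣ) : R) = Ideal.Quotient.mk _ (1 + 2 * z) := by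
    obtain ⟨⟨u, hu'⟩, hu⟩ := u
    obtain ⟨b, hb⟩ := Ideal.Quotient.mk_surjective (u : R)
    have h1 : Ideal.Quotient.mk (Ideal.span {(4 : 𝓞 K)}) (b ^ 2 - 1) = 0 := by
      have h2 := congrArg Units.val hu
      rw [map_sub, map_pow, hb, map_one, sub_eq_zero]
      exact h2
    rw [Ideal.Quotient.eq_zero_iff_mem, Ideal.mem_span_singleton] at h1
    obtain ⟨c, hc⟩ := h1
    have hint : IsIntegral (𝓞 K) (((b : K) - 1) / 2) := by
      refine ⟨Polynomial.X ^ 2 + Polynomial.X - Polynomial.C c, ?_, ?_⟩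
      · monicity!
      · have hc' : (b : K) ^ 2 - 1 = 4 * c := by
          simpa only [map_sub, map_pow, map_one, map_mul, map_ofNat] using
            congrArg (algebraMap (𝓞 K) K) hc
        simp only [Polynomial.eval₂_sub, Polynomial.eval₂_add, Polynomial.eval₂_pow,
          Polynomial.eval₂_X, Polynomial.eval₂_C]
        change _ - (c : K) = 0
        linear_combination hc' / 4
    obtain ⟨z, hz⟩ := IsIntegrallyClosed.algebraMap_eq_of_integral hint
    refine ⟨z, ?_⟩
    change u = _
    rw [← hb]
    congr 1
    ext
    change algebraMap (𝓞 K) K b = algebraMap (𝓞 K) K (1 + 2 * z)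
    rw [map_add, map_mul, map_one, map_ofNat, hz]
    ring
  choose z hz using key
  refine Nat.card_le_card_of_injective (fun u ↦ Ideal.Quotient.mk (Ideal.span {(2 : 𝓞 K)}) (z u)) ?_
  intro u u' h
  simp only at h
  rw [Ideal.Quotient.eq, Ideal.mem_span_singleton] at h
  obtain ⟨c, hc⟩ := h
  ext
  rw [hz, hz, Ideal.Quotient.eq, Ideal.mem_span_singleton]
  exact ⟨c, by linear_combination 2 * hc⟩

theorem isUnit_mk_four {a : 𝓞 K} (ha : IsCoprime a 2) :
    IsUnit (Ideal.Quotient.mk (Ideal.span {(4 : 𝓞 K)}) a) := by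
  have h4 : IsCoprime a 4 := by
    have := ha.pow_right (n := 2)
    norm_num at this
    exact this
  obtain ⟨u, w, h⟩ := h4
  refine IsUnit.of_mul_eq_one (Ideal.Quotient.mk _ u) ?_
  rw [← map_mul, ← map_one (Ideal.Quotient.mk _), Ideal.Quotient.eq, Ideal.mem_span_singleton]
  exact ⟨-w, by linear_combination h⟩

variable (K) in
theorem sqModFour_relIndex : (sqModFour K).relIndex (oddUnits K) ≠ 0 ∧
    (sqModFour K).relIndex (oddUnits K) ≤ 2 ^ Module.finrank ℚ K := by
  set R := 𝓞 K ⧸ Ideal.span {(4 : 𝓞 K)} with hR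
  set G := Rˣ ⧸ (powMonoidHom 2 : Rˣ →* Rˣ).range with hG
  have hfinR : Finite R := Ideal.finiteQuotientOfFreeOfNeBot _ (by simp)
  have hcard : Nat.card G ≤ 2 ^ Module.finrank ℚ K := (card_units_mod_four K).2
  choose a d ha hd h using fun x : oddUnits K ↦ x.2
  let u (x : oddUnits K) : Rˣ := (isUnit_mk_four ((ha x).mul_left (hd x))).unit
  let F (q : oddUnits K ⧸ (sqModFour K).subgroupOf (oddUnits K)) : G :=
    QuotientGroup.mk (u q.out)
  have hF : Function.Injective F := by
    intro q q' hq
    rw [← q.out_eq', ← q'.out_eq']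
    set x := q.out with hx
    set y := q'.out with hy
    have h1 := QuotientGroup.eq.1 hq
    obtain ⟨t, ht⟩ := h1
    rw [QuotientGroup.eq]
    obtain ⟨t', ht'⟩ := Ideal.Quotient.mk_surjective (t : R)
    obtain ⟨r', hr'⟩ := Ideal.Quotient.mk_surjective ((t⁻¹ : Rˣ) : R)
    have h3 : IsCoprime t' 2 := by
      have h4 : Ideal.Quotient.mk (Ideal.span {(4 : 𝓞 K)}) (t' * r') =
          Ideal.Quotient.mk _ 1 := by
        rw [map_mul, ht', hr', map_one, Units.mul_inv]
      rw [Ideal.Quotient.eq, Ideal.mem_span_singleton] at h4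
      obtain ⟨c, hc⟩ := h4
      exact ⟨r', -2 * c, by linear_combination hc⟩
    have h5 : u y = u x * t ^ 2 := by
      rw [eq_inv_mul_iff_mul_eq] at ht
      exact ht.symm
    have h6 : Ideal.Quotient.mk (Ideal.span {(4 : 𝓞 K)}) (a y * d y) =
        Ideal.Quotient.mk (Ideal.span {(4 : 𝓞 K)}) (a x * d x * t' ^ 2) := by
      have := congrArg Units.val h5
      rw [Units.val_mul, Units.val_pow_eq_pow_val, ← ht'] at this
      rw [map_mul _ (a x * d x), map_pow]
      exact this
    rw [Ideal.Quotient.eq, Ideal.mem_span_singleton] at h6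
    obtain ⟨c, hc⟩ := h6
    refine ⟨a x * d x * t', d y * a x, a x * d x * c, ((ha x).mul_left (hd x)).mul_left h3,
      (hd y).mul_left (ha x), ?_⟩
    have hc' : algebraMap (𝓞 K) K (a y) * algebraMap (𝓞 K) K (d y) - algebraMap (𝓞 K) K (a x) *
        algebraMap (𝓞 K) K (d x) * algebraMap (𝓞 K) K t' ^ 2 = 4 * algebraMap (𝓞 K) K c := by
      simpa only [map_sub, map_pow, map_mul, map_ofNat] using congrArg (algebraMap (𝓞 K) K) hc
    have hx0 := (x : Kˣ).ne_zero
    have h7 : ((x : Kˣ) : K) * algebraMap (𝓞 K) K (d x) = algebraMap (𝓞 K) K (a x) := h x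
    have h8 : ((y : Kˣ) : K) * algebraMap (𝓞 K) K (d y) = algebraMap (𝓞 K) K (a y) := h y
    change (((x : Kˣ)⁻¹ * (y : Kˣ) : Kˣ) : K) * _ = _
    rw [Units.val_mul, Units.val_inv_eq_inv_val]
    simp only [map_mul]
    rw [← h7]
    rw [← h7, ← h8] at hc'
    field_simp
    linear_combination (algebraMap (𝓞 K) K (d x)) ^ 2 * hc'
  have hfinG : Finite G := inferInstance
  have : Finite (oddUnits K ⧸ (sqModFour K).subgroupOf (oddUnits K)) := Finite.of_injective F hF
  refine ⟨Subgroup.index_ne_zero_of_finite, (Nat.card_le_card_of_injective F hF).trans hcard⟩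

/-- The elements positive at a real embedding. -/
def posAt (σ : K →+* ℝ) : Subgroup Kˣ where
  carrier := {x | 0 < σ x}
  one_mem' := by simp
  mul_mem' {x y} hx hy := by
    rw [Set.mem_ofPred_eq] at *
    push_cast
    rw [map_mul]
    exact mul_pos hx hy
  inv_mem' {x} hx := by
    rw [Set.mem_ofPred_eq] at *
    rw [Units.val_inv_eq_inv_val, map_inv₀]
    exact inv_pos.2 hx

theorem mem_posAt {σ : K →+* ℝ} {x : Kˣ} : x ∈ posAt σ ↔ 0 < σ x := Iff.rfl

theorem posAt_relIndex (σ : K →+* ℝ) (A : Subgroup Kˣ) :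
    (posAt σ).relIndex A ≠ 0 ∧ (posAt σ).relIndex A ≤ 2 := by
  refine Subgroup.relIndex_le_two fun x _ y _ hx' hy' ↦ ?_
  have hx0 : σ x ≠ 0 := by simp
  have hy0 : σ y ≠ 0 := by simp
  rw [mem_posAt, not_lt] at hx' hy'
  rw [mem_posAt, Units.val_mul, map_mul]
  exact mul_pos_of_neg_of_neg (lt_of_le_of_ne hx' hx0) (lt_of_le_of_ne hy' hy0)

variable (K) in
theorem card_real_embeddings_le :
    Fintype.card (K →+* ℝ) + Module.finrank ℚ K ≤ 2 * (NumberField.Units.rank K + 1) := by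
  classical
  have h1 : Fintype.card (K →+* ℝ) ≤ InfinitePlace.nrRealPlaces K := by
    rw [← InfinitePlace.card_real_embeddings]
    refine Fintype.card_le_of_injective (fun σ ↦ ⟨Complex.ofRealHom.comp σ, ?_⟩) ?_
    · rw [ComplexEmbedding.isReal_iff]
      ext x
      simp
    · intro σ σ' h
      ext x
      have := RingHom.congr_fun (congrArg Subtype.val h) x
      simpa using this
  have h2 := InfinitePlace.card_add_two_mul_card_eq_rank K
  have h3 := InfinitePlace.card_eq_nrRealPlaces_add_nrComplexPlaces K
  have h4 : 0 < Fintype.card (InfinitePlace K) := Fintype.card_pos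
  rw [NumberField.Units.rank]
  omega

/-- The odd elements that are squares modulo `4`, totally positive and local squares in `S`. -/
def primaryUnits (S : Finset (HeightOneSpectrum (𝓞 K))) : Subgroup Kˣ :=
  sqModFour K ⊓ ((⨅ σ : K →+* ℝ, posAt σ) ⊓ ⨅ v : S, locSq v.1)

theorem primaryUnits_relIndex (S : Finset (HeightOneSpectrum (𝓞 K)))
    (hS : ∀ v ∈ S, (2 : 𝓞 K) ∉ v.asIdeal) :
    (primaryUnits S).relIndex (oddUnits K) ≠ 0 ∧
    (primaryUnits S).relIndex (oddUnits K) ≤ 2 ^ (2 * (NumberField.Units.rank K + 1 + S.card)) := by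
  obtain ⟨a1, a2⟩ := sqModFour_relIndex K
  have b1 : (⨅ σ : K →+* ℝ, posAt σ).relIndex (oddUnits K) ≠ 0 :=
    Subgroup.relIndex_iInf_ne_zero fun σ ↦ (posAt_relIndex σ _).1
  have b2 : (⨅ σ : K →+* ℝ, posAt σ).relIndex (oddUnits K) ≤ 2 ^ Fintype.card (K →+* ℝ) := by
    refine (Subgroup.relIndex_iInf_le _).trans ?_
    exact (Finset.prod_le_prod' fun σ _ ↦ (posAt_relIndex σ _).2).trans_eq (by simp)
  have c1 : (⨅ v : S, locSq v.1).relIndex (oddUnits K) ≠ 0 :=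
    Subgroup.relIndex_iInf_ne_zero fun v ↦ (locSq_relIndex (hS _ v.2) _).1
  have c2 : (⨅ v : S, locSq v.1).relIndex (oddUnits K) ≤ 4 ^ S.card := by
    refine (Subgroup.relIndex_iInf_le _).trans ?_
    exact (Finset.prod_le_prod' fun v _ ↦ (locSq_relIndex (hS _ v.2) _).2).trans_eq (by simp)
  refine ⟨Subgroup.relIndex_inf_ne_zero a1 (Subgroup.relIndex_inf_ne_zero b1 c1), ?_⟩
  have h := card_real_embeddings_le K
  calc _ ≤ 2 ^ Module.finrank ℚ K * (2 ^ Fintype.card (K →+* ℝ) * 4 ^ S.card) :=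
        Subgroup.relIndex_inf_le.trans
          (Nat.mul_le_mul a2 (Subgroup.relIndex_inf_le.trans (Nat.mul_le_mul b2 c2)))
    _ = 2 ^ (Module.finrank ℚ K + Fintype.card (K →+* ℝ) + 2 * S.card) := by
        rw [show 4 = 2 ^ 2 by norm_num, ← pow_mul, ← pow_add, ← pow_add]
        congr 1
        ring
    _ ≤ _ := Nat.pow_le_pow_right two_pos (by omega)
end

section
variable {G G' : Type*} [CommGroup G] [CommGroup G']

theorem Subgroup.finrank_inf_ker_add_finrank_map (M : Subgroup G) (φ : G →* G')
    [Module.Finite ℤ (Additive M)] :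
    Module.finrank ℤ (Additive (M ⊓ φ.ker : Subgroup G)) +
      Module.finrank ℤ (Additive (M.map φ)) = Module.finrank ℤ (Additive M) := by
  let f : Additive M →ₗ[ℤ] Additive (M.map φ) := (φ.subgroupMap M).toAdditive.toIntLinearMap
  have hf : Function.Surjective f := φ.subgroupMap_surjective M
  let g : LinearMap.ker f ≃+ Additive (M ⊓ φ.ker : Subgroup G) :=
    { toFun x := Additive.ofMul ⟨(x.1.toMul : G), x.1.toMul.2, congrArg Subtype.val x.2⟩
      invFun x := ⟨Additive.ofMul ⟨(x.toMul : G), x.toMul.2.1⟩, Subtype.ext x.toMul.2.2⟩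
      left_inv _ := rfl
      right_inv _ := rfl
      map_add' _ _ := rfl }
  rw [← (LinearMap.ker f).finrank_quotient_add_finrank, add_comm,
    (f.quotKerEquivOfSurjective hf).finrank_eq, g.toIntLinearEquiv.finrank_eq]

variable {τ : G →* G} (hτ : ∀ x, τ (τ x) = x) {M : Subgroup G}
include hτ

theorem Subgroup.map_sq_relIndex_map_norm
    (hH : M ⊓ (MonoidHom.id G * τ).ker = M.map (MonoidHom.id G / τ)) :
    ((M ⊓ (MonoidHom.id G / τ).ker).map (powMonoidHom 2)).relIndex (M.map (MonoidHom.id G * τ)) =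
      ((M ⊓ (MonoidHom.id G * τ).ker).map (powMonoidHom 2)).relIndex
        (M ⊓ (MonoidHom.id G * τ).ker) := by
  conv_rhs => enter [2]; rw [hH]
  rw [← Subgroup.relIndex_comap, ← Subgroup.relIndex_comap, ← Subgroup.inf_relIndex_right,
    ← Subgroup.inf_relIndex_right (Subgroup.comap (MonoidHom.id G / τ) _)]
  congr 1
  ext y
  simp only [Subgroup.mem_inf, Subgroup.mem_comap, Subgroup.mem_map, MonoidHom.mem_ker,
    MonoidHom.div_apply, MonoidHom.mul_apply, MonoidHom.id_apply, powMonoidHom_apply]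
  refine and_congr_left fun hy ↦ ⟨?_, ?_⟩
  · rintro ⟨a, ⟨ha, ha'⟩, h⟩
    rw [div_eq_one] at ha'
    have h2 : τ y = a ^ 2 / y := by rw [h, mul_div_cancel_left]
    refine ⟨y / a, ⟨M.div_mem hy ha, ?_⟩, ?_⟩
    · rw [map_div, h2, ← ha', div_div, div_mul_div_comm, div_eq_one, pow_two, mul_left_comm]
    · rw [h2, div_pow, div_div_eq_mul_div, pow_two]
  · rintro ⟨b, ⟨hb, hb'⟩, h⟩
    have h2 : τ y = y / b ^ 2 := by rw [h, div_div_cancel]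
    have h3 : τ b = b⁻¹ := (inv_eq_of_mul_eq_one_right hb').symm
    refine ⟨y / b, ⟨M.div_mem hy hb, ?_⟩, ?_⟩
    · rw [map_div, h2, h3, div_eq_one]
      rw [div_inv_eq_mul, pow_two, div_mul_eq_div_div, div_mul_cancel]
    · rw [h2, div_pow, pow_two, mul_div_assoc]

end

section
variable {K : Type*} [Field K] [NumberField K] {v : HeightOneSpectrum (𝓞 K)}

theorem mem_evenOrd_of_eq {n : Kˣ} (y : Kˣ) (h : v.valuation K n = v.valuation K y ^ 2) :
    n ∈ evenOrd v := by
  have h1 : v.valuation K ((n * (y⁻¹) ^ 2 : Kˣ) : K) = 1 := by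
    rw [Units.val_mul, Units.val_pow_eq_pow_val, map_mul, map_pow, h, ← mul_pow, ← map_mul]
    simp
  have h2 : n * (y⁻¹) ^ 2 ∈ evenOrd v := by
    rw [← HeightOneSpectrum.valuationOfNeZero_eq_one_iff] at h1
    rw [mem_evenOrd, h1]
    simp
  have h3 : y ^ 2 ∈ evenOrd v := locSq_le_evenOrd (sq_mem_locSq y)
  have := mul_mem h2 h3
  simpa using this

/-- Norms from an extension unramified at `v` have even order if `v` is inert. -/
theorem norm_mem_evenOrd {x : Kˣ} (hx : x ∈ evenOrd v) (hx' : x ∉ locSq v) {n : Kˣ} {α β : K}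
    (h : (n : K) = α ^ 2 - x * β ^ 2) : n ∈ evenOrd v := by
  rcases eq_or_ne β 0 with rfl | hβ
  · have hα : α ≠ 0 := by
      rintro rfl
      exact n.ne_zero (by rw [h]; ring)
    exact mem_evenOrd_of_eq (Units.mk0 α hα) (by simp [h])
  obtain ⟨w, hw⟩ := exists_sq_mul_valuation_eq_one hx
  rw [Units.val_mul, Units.val_pow_eq_pow_val] at hw
  have hw0 := w.ne_zero
  set g : K := α * w / β with hg
  have hn : (n : K) = (β / w) ^ 2 * (g ^ 2 - x * w ^ 2) := by
    rw [h, hg]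
    field_simp
  have hβw : β / w ≠ 0 := div_ne_zero hβ hw0
  rcases lt_trichotomy (v.valuation K g) 1 with h1 | h1 | h1
  · refine mem_evenOrd_of_eq (Units.mk0 _ hβw) ?_
    have h2 : v.valuation K (g ^ 2) < v.valuation K (x * w ^ 2) := by
      rw [hw, map_pow]
      exact pow_lt_one₀ zero_le h1 two_ne_zero
    rw [hn, map_mul, map_pow, Valuation.map_sub_eq_of_lt_right _ h2, hw, mul_one, Units.val_mk0]
  · refine mem_evenOrd_of_eq (Units.mk0 _ hβw) ?_
    have h2 : v.valuation K (g ^ 2 - x * w ^ 2) = 1 := by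
      refine le_antisymm ((Valuation.map_sub _ _ _).trans ?_) ?_
      · rw [hw, map_pow, h1]
        simp
      · by_contra! h3
        have hg0 : g ≠ 0 := by
          intro h0
          rw [h0, map_zero] at h1
          exact zero_ne_one h1
        refine hx' (mem_locSq.2 ⟨w * (Units.mk0 g hg0)⁻¹, ?_⟩)
        have h4 : (x : K) * ((w * (Units.mk0 g hg0)⁻¹ : Kˣ) : K) ^ 2 - 1 =
            -((g ^ 2 - x * w ^ 2) / g ^ 2) := by
          rw [Units.val_mul, Units.val_inv_eq_inv_val, Units.val_mk0]
          field_simp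
          ring
        rw [h4, Valuation.map_neg, map_div₀, map_pow, h1, one_pow, div_one]
        exact h3
    rw [hn, map_mul, map_pow, h2, mul_one, Units.val_mk0]
  · have hg0 : g ≠ 0 := by
      intro h0
      rw [h0, map_zero] at h1
      exact not_lt_zero h1
    refine mem_evenOrd_of_eq (Units.mk0 _ (mul_ne_zero hβw hg0)) ?_
    have h2 : v.valuation K (x * w ^ 2) < v.valuation K (g ^ 2) := by
      rw [hw, map_pow]
      exact one_lt_pow₀ h1 two_ne_zero
    rw [hn, map_mul, map_pow, Valuation.map_sub_eq_of_lt_left _ h2, Units.val_mk0, map_mul,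
      map_pow, mul_pow]

/-- Unit norms from an extension ramified at `v` are local squares. -/
theorem norm_mem_locSq {x : Kˣ} (hx : x ∉ evenOrd v) {n : Kˣ} {α β : K}
    (h : (n : K) = α ^ 2 - x * β ^ 2) (hn : v.valuation K n = 1) : n ∈ locSq v := by
  have hne (hβ : β ≠ 0) : v.valuation K (x * β ^ 2) ≠ v.valuation K α ^ 2 := by
    intro h1
    have hα : α ≠ 0 := by
      rintro rfl
      rw [map_zero, zero_pow two_ne_zero] at h1
      simp [hβ] at h1
    refine hx (mem_evenOrd_of_eq (Units.mk0 (α / β) (div_ne_zero hα hβ)) ?_)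
    rw [Units.val_mk0, map_div₀, div_pow, ← h1, map_mul, map_pow, mul_div_cancel_right₀]
    simpa using hβ
  have key : v.valuation K (x * β ^ 2) < v.valuation K α ^ 2 := by
    rcases eq_or_ne β 0 with rfl | hβ
    · rw [h] at hn
      simp only [ne_eq, OfNat.ofNat_ne_zero, not_false_eq_true, zero_pow, mul_zero, sub_zero,
        map_pow] at hn
      simp [hn]
    refine lt_of_le_of_ne (not_lt.1 fun h1 ↦ ?_) (hne hβ)
    rw [← map_pow] at h1
    rw [h, Valuation.map_sub_eq_of_lt_right _ h1] at hn
    refine hx (mem_evenOrd_of_eq (Units.mk0 β hβ)⁻¹ ?_)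
    rw [map_mul, map_pow] at hn
    rw [Units.val_inv_eq_inv_val, Units.val_mk0, map_inv₀, inv_pow]
    exact eq_inv_of_mul_eq_one_left hn
  have hα : v.valuation K α ^ 2 = 1 := by
    rw [← map_pow] at key ⊢
    rwa [h, Valuation.map_sub_eq_of_lt_left _ key] at hn
  have hα0 : α ≠ 0 := by
    rintro rfl
    simp at hα
  refine mem_locSq.2 ⟨(Units.mk0 α hα0)⁻¹, ?_⟩
  have h4 : (n : K) * (((Units.mk0 α hα0)⁻¹ : Kˣ) : K) ^ 2 - 1 = -(x * β ^ 2 / α ^ 2) := by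
    rw [Units.val_inv_eq_inv_val, Units.val_mk0, h]
    field_simp
    ring
  rw [h4, Valuation.map_neg, map_div₀, map_pow _ α, hα, div_one]
  rwa [hα] at key

end

section
variable {K L : Type*} [Field K] [NumberField K] [Field L] [NumberField L] [Algebra K L]

theorem exists_sub_mem_of_absNorm_eq (W : HeightOneSpectrum (𝓞 L))
    (h : Ideal.absNorm W.asIdeal = Ideal.absNorm (W.under (𝓞 K)).asIdeal) (θ : 𝓞 L) :
    ∃ c : 𝓞 K, θ - algebraMap (𝓞 K) (𝓞 L) c ∈ W.asIdeal := by
  have h1 : Finite (𝓞 L ⧸ W.asIdeal) := Ideal.finiteQuotientOfFreeOfNeBot _ W.ne_bot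
  let f : 𝓞 K ⧸ (W.under (𝓞 K)).asIdeal →+* 𝓞 L ⧸ W.asIdeal :=
    Ideal.quotientMap W.asIdeal (algebraMap (𝓞 K) (𝓞 L)) le_rfl
  have hf : Function.Injective f := Ideal.quotientMap_injective
  have hcard : Nat.card (𝓞 L ⧸ W.asIdeal) ≤ Nat.card (𝓞 K ⧸ (W.under (𝓞 K)).asIdeal) := by
    rw [Ideal.absNorm_apply, Ideal.absNorm_apply, Submodule.cardQuot_apply,
      Submodule.cardQuot_apply] at h
    exact h.le
  obtain ⟨q, hq⟩ := (hf.bijective_of_nat_card_le hcard).2 (Ideal.Quotient.mk _ θ)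
  obtain ⟨c, rfl⟩ := Ideal.Quotient.mk_surjective q
  refine ⟨c, ?_⟩
  rw [← Ideal.Quotient.eq, ← hq]
  rfl

namespace IsQuadConj
variable {τ : L ≃ₐ[K] L} (hτ : IsQuadConj τ)
include hτ

theorem ramificationIdx'_eq_one_of_sub (W : HeightOneSpectrum (𝓞 L)) (θ : 𝓞 L)
    (hθ : W.valuation L ((θ : L) - τ θ) = 1) :
    (W.under (𝓞 K)).asIdeal.ramificationIdx' W.asIdeal = 1 := by
  rcases hτ.efCases W with h | h
  · have h2 := Nat.prime_two.eq_one_or_self_of_dvd _ ⟨_, h.2.symm⟩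
    refine h2.resolve_right fun h3 ↦ ?_
    have hf : (W.under (𝓞 K)).asIdeal.inertiaDeg' W.asIdeal = 1 := by
      have := h.2
      rw [h3] at this
      omega
    have hN : Ideal.absNorm W.asIdeal = Ideal.absNorm (W.under (𝓞 K)).asIdeal := by
      rw [Ideal.absNorm_eq_pow_inertiaDeg'_of_liesOver W.asIdeal (W.under (𝓞 K)).asIdeal
        (W.under (𝓞 K)).isPrime (W.under (𝓞 K)).ne_bot, hf, pow_one]
    obtain ⟨c, hc⟩ := exists_sub_mem_of_absNorm_eq W hN θ
    have h4 : W.valuation L ((θ : L) - algebraMap K L c) < 1 := by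
      rw [← HeightOneSpectrum.valuation_lt_one_iff_mem (K := L)] at hc
      exact hc
    have h5 : W.valuation L (τ θ - algebraMap K L c) < 1 := by
      rw [← AlgEquiv.commutes τ, ← map_sub, ← valuation_conjPlace, h.1]
      exact h4
    have h6 := Valuation.map_sub_lt _ h4 h5
    rw [sub_sub_sub_cancel_right, hθ] at h6
    exact lt_irrefl _ h6
  · exact h.2.1

variable {s : L} {x : Kˣ} (hs : s ^ 2 = algebraMap K L x) (hτs : τ s = -s)
include hs hτs

theorem ramificationIdx'_eq_one (W : HeightOneSpectrum (𝓞 L))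
    (hx : (W.under (𝓞 K)).valuation K x = 1)
    (hx' : (2 : 𝓞 K) ∉ (W.under (𝓞 K)).asIdeal ∨ x ∈ sqModFour K) :
    (W.under (𝓞 K)).asIdeal.ramificationIdx' W.asIdeal = 1 := by
  have hs1 : W.valuation L s = 1 := by
    have h1 := (valuation_algebraMap_eq_one_iff K W (x : K)).2 hx
    rw [← hs, map_pow] at h1
    exact (pow_eq_one_iff.1 h1).resolve_right two_ne_zero
  by_cases h2 : (2 : 𝓞 K) ∈ (W.under (𝓞 K)).asIdeal
  · obtain ⟨t, d, c, ht, hd, h⟩ := hx'.resolve_left (not_not.2 h2)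
    have hh : algebraMap K L x * algebraMap K L d ^ 2 =
        algebraMap K L t ^ 2 + 4 * algebraMap K L c := by
      have := congrArg (algebraMap K L) h
      simpa only [map_mul, map_add, map_pow, map_ofNat] using this
    have hint : IsIntegral (𝓞 L) ((algebraMap K L t + algebraMap K L d * s) / 2) := by
      refine ⟨Polynomial.X ^ 2 - Polynomial.C (algebraMap (𝓞 K) (𝓞 L) t) * Polynomial.X -
        Polynomial.C (algebraMap (𝓞 K) (𝓞 L) c), ?_, ?_⟩
      · monicity!
      · simp only [Polynomial.eval₂_sub, Polynomial.eval₂_mul, Polynomial.eval₂_pow,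
          Polynomial.eval₂_X, Polynomial.eval₂_C]
        change _ - algebraMap K L t * _ - algebraMap K L c = 0
        linear_combination hh / 4 + algebraMap K L d ^ 2 * hs / 4
    obtain ⟨θ, hθ⟩ := IsIntegrallyClosed.algebraMap_eq_of_integral hint
    refine hτ.ramificationIdx'_eq_one_of_sub W θ ?_
    change (θ : L) = _ at hθ
    have h4 : (θ : L) - τ θ = algebraMap K L d * s := by
      rw [hθ, map_div₀, map_add, map_mul, hτs, AlgEquiv.commutes, AlgEquiv.commutes, map_ofNat]
      ring
    rw [h4, map_mul, hs1, mul_one, valuation_algebraMap_eq_one_iff]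
    change HeightOneSpectrum.valuation K _ (algebraMap (𝓞 K) K d) = 1
    rw [HeightOneSpectrum.valuation_eq_one_iff_notMem]
    intro h5
    obtain ⟨a, b, hab⟩ := hd
    refine (W.under (𝓞 K)).isPrime.ne_top ((Ideal.eq_top_iff_one _).2 (hab ▸ ?_))
    exact Ideal.add_mem _ (Ideal.mul_mem_left _ _ h5) (Ideal.mul_mem_left _ _ h2)
  · obtain ⟨n, d, h⟩ := HeightOneSpectrum.exists_primeCompl_mul_eq_of_integer _ (x : K) hx.le
    have hh : algebraMap K L x * algebraMap K L (d : 𝓞 K) = algebraMap K L n := by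
      rw [← map_mul]
      exact congrArg _ h
    have hint : IsIntegral (𝓞 L) (algebraMap K L (d : 𝓞 K) * s) := by
      refine ⟨Polynomial.X ^ 2 - Polynomial.C (algebraMap (𝓞 K) (𝓞 L) (d * n)), ?_, ?_⟩
      · monicity!
      · simp only [Polynomial.eval₂_sub, Polynomial.eval₂_pow,
          Polynomial.eval₂_X, Polynomial.eval₂_C]
        change _ - algebraMap K L (algebraMap (𝓞 K) K (d * n)) = 0
        rw [map_mul, map_mul]
        change _ - algebraMap K L (d : 𝓞 K) * algebraMap K L n = 0
        rw [← hh, ← hs]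
        ring
    obtain ⟨θ, hθ⟩ := IsIntegrallyClosed.algebraMap_eq_of_integral hint
    refine hτ.ramificationIdx'_eq_one_of_sub W θ ?_
    change (θ : L) = _ at hθ
    have h4 : (θ : L) - τ θ = algebraMap K L (algebraMap (𝓞 K) K (2 * d)) * s := by
      rw [hθ, map_mul, hτs, AlgEquiv.commutes, map_mul, map_ofNat, map_mul, map_ofNat]
      ring
    rw [h4, map_mul, hs1, mul_one, valuation_algebraMap_eq_one_iff,
      HeightOneSpectrum.valuation_eq_one_iff_notMem]
    intro h5
    exact ((W.under (𝓞 K)).isPrime.mem_or_mem h5).elim h2 d.2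

theorem exists_eq_add_mul (y : L) : ∃ a b : K, y = algebraMap K L a + algebraMap K L b * s := by
  have hs0 : s ≠ 0 := by
    rintro rfl
    refine x.ne_zero ((map_eq_zero (algebraMap K L)).1 ?_)
    rw [← hs, zero_pow two_ne_zero]
  obtain ⟨a, ha⟩ := hτ.fixed ((y + τ y) / 2) (by
    rw [map_div₀, map_add, hτ.apply_apply, map_ofNat, add_comm])
  obtain ⟨b, hb⟩ := hτ.fixed ((y - τ y) / (2 * s)) (by
    rw [map_div₀, map_sub, hτ.apply_apply, map_mul, hτs, map_ofNat, mul_neg, div_neg,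
      ← neg_div, neg_sub])
  refine ⟨a, b, ?_⟩
  rw [ha, hb]
  field_simp
  ring

theorem isUnramifiedAtInfinitePlaces (hpos : ∀ σ : K →+* ℝ, 0 < σ x) :
    IsUnramifiedAtInfinitePlaces K L := by
  refine ⟨fun w ↦ InfinitePlace.isUnramified_iff.2 ?_⟩
  by_contra! h
  rw [InfinitePlace.not_isComplex_iff_isReal] at h
  obtain ⟨h1, h2⟩ := h
  refine h1 ?_
  obtain ⟨φ, rfl⟩ : ∃ φ : L →+* ℂ, InfinitePlace.mk φ = w := ⟨w.embedding, w.mk_embedding⟩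
  rw [InfinitePlace.comap_mk, InfinitePlace.isReal_mk_iff] at h2
  rw [InfinitePlace.isReal_mk_iff, ComplexEmbedding.isReal_iff]
  have hK (a : K) : star (φ (algebraMap K L a)) = φ (algebraMap K L a) :=
    RingHom.congr_fun (ComplexEmbedding.isReal_iff.1 h2) a
  have hs2 : star (φ s) = φ s := by
    have h3 : φ s ^ 2 = ((√(h2.embedding x) : ℝ) : ℂ) ^ 2 := by
      rw [← Complex.ofReal_pow, Real.sq_sqrt (hpos _).le, h2.coe_embedding_apply, ← map_pow, hs]
      rfl
    rcases sq_eq_sq_iff_eq_or_eq_neg.1 h3 with h4 | h4 <;> rw [h4] <;> simp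
  ext y
  obtain ⟨a, b, rfl⟩ := hτ.exists_eq_add_mul hs hτs y
  change star (φ _) = φ _
  rw [map_add, map_mul, star_add, star_mul', hK, hK, hs2]

theorem card_infinitePlace (hpos : ∀ σ : K →+* ℝ, 0 < σ x) :
    Fintype.card (InfinitePlace L) = Fintype.card (InfinitePlace K) * 2 := by
  have h1 : Algebra.IsQuadraticExtension K L := ⟨hτ.finrank_eq⟩
  have h2 := hτ.isUnramifiedAtInfinitePlaces hs hτs hpos
  rw [IsUnramifiedAtInfinitePlaces.card_infinitePlace K L, hτ.finrank_eq]

end IsQuadConj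
end

section
variable {K L : Type*} [Field K] [NumberField K] [Field L] [NumberField L] [Algebra K L]

theorem exists_valuation_eq_exp {S : Finset (HeightOneSpectrum (𝓞 K))}
    (hS : ∀ v ∉ S, ∃ π : Kˣ, v.valuation K π = WithZero.exp (-1 : ℤ) ∧
      ∀ w ∉ S, w ≠ v → w.valuation K π = 1)
    (n : HeightOneSpectrum (𝓞 K) → ℤ) (hn : {v | n v ≠ 0}.Finite) :
    ∃ c : Kˣ, ∀ v ∉ S, v.valuation K c = WithZero.exp (n v) := by
  classical
  choose! π hπ hπ' using hS
  refine ⟨∏ w ∈ hn.toFinset with w ∉ S, π w ^ (-n w), fun v hv ↦ ?_⟩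
  have hv1 : v.valuation K (π v : K) ^ (-n v) = WithZero.exp (n v) := by
    rw [hπ v hv, ← WithZero.exp_zsmul]
    simp
  rw [Units.coe_prod, map_prod]
  by_cases h : n v = 0
  · rw [h, WithZero.exp_zero]
    refine Finset.prod_eq_one fun w hw ↦ ?_
    rw [Finset.mem_filter, Set.Finite.mem_toFinset] at hw
    have hvw : v ≠ w := fun h' ↦ hw.1 (h' ▸ h)
    rw [Units.val_zpow_eq_zpow_val, map_zpow₀, hπ' w hw.2 v hv hvw, one_zpow]
  · rw [Finset.prod_eq_single v, Units.val_zpow_eq_zpow_val, map_zpow₀, hv1]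
    · intro w hw hvw
      rw [Finset.mem_filter] at hw
      rw [Units.val_zpow_eq_zpow_val, map_zpow₀, hπ' w hw.2 v hv hvw.symm, one_zpow]
    · intro h'
      rw [Finset.mem_filter, Set.Finite.mem_toFinset] at h'
      exact absurd ⟨h, hv⟩ h'

namespace IsQuadConj
variable {τ : L ≃ₐ[K] L} (hτ : IsQuadConj τ)
include hτ

variable {s : L} {x : Kˣ} (hs : s ^ 2 = algebraMap K L x) (hτs : τ s = -s)
include hs hτs

theorem exists_places_over (S : Finset (HeightOneSpectrum (𝓞 K)))
    (h2 : ∀ v ∈ S, (2 : 𝓞 K) ∉ v.asIdeal) [DecidablePred fun v ↦ x ∉ locSq v] :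
    ∃ SL : Finset (HeightOneSpectrum (𝓞 L)), (∀ W, W ∈ SL ↔ W.under (𝓞 K) ∈ S) ∧
      2 * S.card ≤ SL.card + {v ∈ S | x ∉ locSq v}.card := by
  classical
  have hfin := hτ.finite_preimage S.finite_toSet
  refine ⟨hfin.toFinset, fun W ↦ by simp, ?_⟩
  rw [Finset.card_eq_sum_card_fiberwise (s := hfin.toFinset) (f := fun W ↦ W.under (𝓞 K)) (t := S)
    (by intro W; simp), Finset.card_filter, ← Finset.sum_add_distrib, mul_comm,
    ← smul_eq_mul, ← Finset.sum_const]
  refine Finset.sum_le_sum fun v hv ↦ ?_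
  obtain ⟨W, rfl⟩ := exists_under_eq (L := L) v
  have hW : W ∈ {V ∈ hfin.toFinset | V.under (𝓞 K) = W.under (𝓞 K)} := by simpa using hv
  by_cases hx : x ∈ locSq (W.under (𝓞 K))
  swap
  · rw [if_pos hx]
    exact Nat.succ_le_succ (Finset.card_pos.2 ⟨W, hW⟩)
  · rw [if_neg (not_not.2 hx)]
    have h3 := conjPlace_ne_of_mem_locSq hs hτs W (h2 _ hv) hx
    refine (Finset.card_pair h3).ge.trans (Finset.card_le_card ?_)
    intro V hV
    rw [Finset.mem_insert, Finset.mem_singleton] at hV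
    rcases hV with rfl | rfl
    · rw [Finset.mem_filter]
      refine ⟨?_, conjPlace_under τ W⟩
      rw [Set.Finite.mem_toFinset, Set.mem_ofPred_eq, conjPlace_under]
      exact hv
    · exact hW

theorem exists_div_conj_eq {y : Lˣ} (hy : (y : L) * τ y = 1) :
    ∃ z : Lˣ, (z : L) = y * τ z := by
  have hs0 : s ≠ 0 := by
    rintro rfl
    refine x.ne_zero ((map_eq_zero (algebraMap K L)).1 ?_)
    rw [← hs, zero_pow two_ne_zero]
  by_cases h : 1 + (y : L) = 0
  · refine ⟨Units.mk0 s hs0, ?_⟩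
    rw [Units.val_mk0, hτs, ← neg_eq_of_add_eq_zero_right h]
    ring
  · refine ⟨Units.mk0 _ h, ?_⟩
    rw [Units.val_mk0, map_add, map_one, mul_add, hy]
    ring

theorem exists_unit_div_conj_eq {S : Finset (HeightOneSpectrum (𝓞 K))}
    (hS : ∀ v ∉ S, ∃ π : Kˣ, v.valuation K π = WithZero.exp (-1 : ℤ) ∧
      ∀ w ∉ S, w ≠ v → w.valuation K π = 1)
    {SL : Finset (HeightOneSpectrum (𝓞 L))} (hSL : ∀ W, W ∈ SL ↔ W.under (𝓞 K) ∈ S)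
    (hram : ∀ W ∉ SL, (W.under (𝓞 K)).asIdeal.ramificationIdx' W.asIdeal = 1)
    {y : Lˣ} (hyS : y ∈ (SL : Set (HeightOneSpectrum (𝓞 L))).unit L) (hy : (y : L) * τ y = 1) :
    ∃ z ∈ (SL : Set (HeightOneSpectrum (𝓞 L))).unit L, (z : L) = y * τ z := by
  obtain ⟨z, hz⟩ := hτ.exists_div_conj_eq hs hτs hy
  have hval (W) (hW : W ∉ SL) : (conjPlace τ W).valuation L z = W.valuation L z := by
    rw [valuation_conjPlace]
    conv_rhs => rw [hz, map_mul, show W.valuation L (y : L) = 1 from hyS W hW, one_mul]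
  choose P hP using fun v : HeightOneSpectrum (𝓞 K) ↦ exists_under_eq (L := L) v
  have hlog (W : HeightOneSpectrum (𝓞 L)) :
      WithZero.exp (WithZero.log (W.valuation L (z : L))) = W.valuation L z :=
    WithZero.exp_log (by simp)
  obtain ⟨c, hc⟩ := exists_valuation_eq_exp hS
      (fun v ↦ WithZero.log ((P v).valuation L (z : L))) (by
    refine ((finite_valuation_ne_one z).image fun W ↦ W.under (𝓞 K)).subset ?_
    intro v hv
    refine ⟨P v, fun h ↦ hv ?_, hP v⟩
    rw [h, WithZero.log_one])
  have hc' (W) (hW : W ∉ SL) : W.valuation L (algebraMap K L c) = W.valuation L z := by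
    rw [← valuation_under_pow K, hram W hW, pow_one, hc _ (fun h ↦ hW ((hSL W).2 h)), hlog]
    rcases hτ.eq_or_eq (W := W) (W' := P (W.under (𝓞 K))) (hP _) with h | h <;> rw [h]
    exact hval W hW
  refine ⟨z * (Units.map (algebraMap K L : K →* L) c)⁻¹, fun W hW ↦ ?_, ?_⟩
  · rw [Units.val_mul, map_mul, ← hc' W hW, ← map_mul]
    simp
  · rw [Units.val_mul, Units.val_inv_eq_inv_val, Units.coe_map, map_mul, map_inv₀, ← mul_assoc,
      ← hz]
    simp

omit hs hτs in
theorem mem_unit_map_iff {S : Finset (HeightOneSpectrum (𝓞 K))}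
    {SL : Finset (HeightOneSpectrum (𝓞 L))} (hSL : ∀ W, W ∈ SL ↔ W.under (𝓞 K) ∈ S) {c : Kˣ} :
    Units.map (algebraMap K L : K →* L) c ∈ (SL : Set (HeightOneSpectrum (𝓞 L))).unit L ↔
      c ∈ (S : Set (HeightOneSpectrum (𝓞 K))).unit K := by
  constructor
  · intro h v hv
    obtain ⟨W, rfl⟩ := exists_under_eq (L := L) v
    exact (valuation_algebraMap_eq_one_iff K W (c : K)).1 (h W fun h' ↦ hv ((hSL W).1 h'))
  · intro h W hW
    exact (valuation_algebraMap_eq_one_iff K W (c : K)).2 (h _ fun hv ↦ hW ((hSL W).2 hv))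

/-- The norms of `S`-units have small index if the `S`-class group is trivial and the quadratic
extension is unramified outside `S` and at infinity. -/
theorem exists_norm_relIndex_le {S : Finset (HeightOneSpectrum (𝓞 K))}
    (h2 : ∀ v ∈ S, (2 : 𝓞 K) ∉ v.asIdeal)
    (hS : ∀ v ∉ S, ∃ π : Kˣ, v.valuation K π = WithZero.exp (-1 : ℤ) ∧
      ∀ w ∉ S, w ≠ v → w.valuation K π = 1)
    (hxS : x ∈ (S : Set (HeightOneSpectrum (𝓞 K))).unit K) (hx4 : x ∈ sqModFour K)
    (hpos : ∀ σ : K →+* ℝ, 0 < σ x) [DecidablePred fun v ↦ x ∉ locSq v] :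
    ∃ H : Subgroup Kˣ, (∀ n ∈ H, ∃ α β : K, (n : K) = α ^ 2 - x * β ^ 2) ∧
      H.relIndex ((S : Set (HeightOneSpectrum (𝓞 K))).unit K) ≠ 0 ∧
      H.relIndex ((S : Set (HeightOneSpectrum (𝓞 K))).unit K) * 2 ≤
        2 ^ {v ∈ S | x ∉ locSq v}.card := by
  obtain ⟨SL, hSL, hcard⟩ := hτ.exists_places_over hs hτs S h2
  have hram (W) (hW : W ∉ SL) : (W.under (𝓞 K)).asIdeal.ramificationIdx' W.asIdeal = 1 :=
    hτ.ramificationIdx'_eq_one hs hτs W (hxS _ fun h ↦ hW ((hSL W).2 h)) (Or.inr hx4)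
  let σ : Lˣ →* Lˣ := Units.map τ
  have hσ (y : Lˣ) : σ (σ y) = y := Units.ext (hτ.apply_apply y)
  let j : Kˣ →* Lˣ := Units.map (algebraMap K L : K →* L)
  have hj : Function.Injective j := Units.map_injective (algebraMap K L).injective
  obtain ⟨M, hM⟩ : ∃ M, M = (SL : Set (HeightOneSpectrum (𝓞 L))).unit L := ⟨_, rfl⟩
  obtain ⟨U, hU⟩ : ∃ U, U = (S : Set (HeightOneSpectrum (𝓞 K))).unit K := ⟨_, rfl⟩
  have hMfin : Module.Finite ℤ (Additive M) := by rw [hM]; infer_instance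
  have hMσ {y : Lˣ} (hy : y ∈ M) : σ y ∈ M := by
    rw [hM] at hy ⊢
    intro W hW
    change W.valuation L (τ y) = 1
    rw [← valuation_conjPlace]
    refine hy _ fun h ↦ hW ?_
    rw [SetLike.mem_coe, hSL] at h ⊢
    rwa [conjPlace_under] at h
  have hA : M ⊓ (MonoidHom.id Lˣ / σ).ker = U.map j := by
    ext y
    rw [Subgroup.mem_inf, Subgroup.mem_map, MonoidHom.mem_ker, MonoidHom.div_apply, div_eq_one]
    constructor
    · rintro ⟨hy, hy'⟩
      obtain ⟨c, hc⟩ := hτ.fixed y (congrArg Units.val hy').symm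
      have hc0 : c ≠ 0 := by
        rintro rfl
        exact y.ne_zero (by rw [← hc, map_zero])
      have hjc : j (Units.mk0 c hc0) = y := Units.ext hc
      refine ⟨_, ?_, hjc⟩
      rwa [← hjc, hM, hτ.mem_unit_map_iff hSL, ← hU] at hy
    · rintro ⟨c, hc, rfl⟩
      rw [hM, hτ.mem_unit_map_iff hSL, ← hU]
      exact ⟨hc, Units.ext (τ.commutes _).symm⟩
  have hB : M ⊓ (MonoidHom.id Lˣ * σ).ker = M.map (MonoidHom.id Lˣ / σ) := by
    ext y
    rw [Subgroup.mem_inf, Subgroup.mem_map, MonoidHom.mem_ker, MonoidHom.mul_apply]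
    constructor
    · rintro ⟨hy, hy'⟩
      obtain ⟨z, hz, hz'⟩ := hτ.exists_unit_div_conj_eq hs hτs hS hSL hram (hM ▸ hy)
        (congrArg Units.val hy')
      refine ⟨z, hM ▸ hz, ?_⟩
      rw [MonoidHom.div_apply, div_eq_iff_eq_mul]
      exact Units.ext hz'
    · rintro ⟨z, hz, rfl⟩
      rw [MonoidHom.div_apply]
      refine ⟨M.div_mem hz (hMσ hz), ?_⟩
      simp [hσ]
  have hr1 := M.finrank_inf_ker_add_finrank_map (MonoidHom.id Lˣ / σ)
  have hr2 := Subgroup.map_sq_relIndex_map_norm hσ hB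
  rw [← hB, hA] at hr1
  rw [hA] at hr2
  have hfin (B : Subgroup Lˣ) (hB : B ≤ M) : Module.Finite ℤ (Additive B) :=
    Module.Finite.of_injective (Subgroup.inclusion hB).toAdditive.toIntLinearMap
      (Subgroup.inclusion_injective hB)
  have hBfin : Module.Finite ℤ (Additive (M ⊓ (MonoidHom.id Lˣ * σ).ker : Subgroup Lˣ)) :=
    hfin _ inf_le_left
  have hUfin : Module.Finite ℤ (Additive (U.map j)) := hfin _ (hA ▸ inf_le_left)
  have hB1 : -1 ∈ M ⊓ (MonoidHom.id Lˣ * σ).ker := by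
    rw [Subgroup.mem_inf, MonoidHom.mem_ker]
    refine ⟨hM ▸ neg_one_mem_unit _, ?_⟩
    ext
    simp [σ]
  rw [Subgroup.relIndex_map_sq _ hB1] at hr2
  have hr3 := Subgroup.relIndex_map_sq (U.map j)
    ⟨-1, hU ▸ neg_one_mem_unit _, by ext; simp [j]⟩
  have hr4 : Module.finrank ℤ (Additive (U.map j)) = Module.finrank ℤ (Additive U) :=
    (U.equivMapOfInjective j hj).toAdditive.toIntLinearEquiv.finrank_eq.symm
  have hNU : M.map (MonoidHom.id Lˣ * σ) ≤ U.map j := by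
    rintro _ ⟨y, hy, rfl⟩
    rw [← hA]
    refine ⟨mul_mem hy (hMσ hy), ?_⟩
    simp [hσ, mul_comm]
  have hUN : (U.map j).map (powMonoidHom 2) ≤ M.map (MonoidHom.id Lˣ * σ) := by
    rintro _ ⟨_, ⟨c, hc, rfl⟩, rfl⟩
    refine ⟨j c, ?_, ?_⟩
    · change j c ∈ M
      rwa [hM, hτ.mem_unit_map_iff hSL, ← hU]
    · refine Units.ext ?_
      change algebraMap K L c * τ (algebraMap K L c) = algebraMap K L c ^ 2
      rw [τ.commutes, pow_two]
  have hr5 := Subgroup.relIndex_mul_relIndex _ _ _ hUN hNU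
  refine ⟨(M.map (MonoidHom.id Lˣ * σ)).comap j, ?_, ?_⟩
  · rintro n ⟨y, hy, hyn⟩
    obtain ⟨a, b, hab⟩ := hτ.exists_eq_add_mul hs hτs y
    refine ⟨a, b, (algebraMap K L).injective ?_⟩
    have h3 : (y : L) * τ y = algebraMap K L n := congrArg Units.val hyn
    rw [← h3, hab]
    simp only [map_add, map_mul, map_sub, map_pow, AlgEquiv.commutes, hτs]
    linear_combination algebraMap K L b ^ 2 * (-hs)
  rw [Subgroup.relIndex_comap, ← hU]
  rw [hr2, hr3] at hr5
  refine ⟨?_, ?_⟩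
  · intro h0
    rw [h0, mul_zero] at hr5
    exact absurd hr5.symm (pow_ne_zero _ two_ne_zero)
  have hL : Module.finrank ℤ (Additive M) = Units.rank L + SL.card := by
    rw [hM, unit_finrank]
  have hK : Module.finrank ℤ (Additive U) = Units.rank K + S.card := by
    rw [hU, unit_finrank]
  have hinf := hτ.card_infinitePlace hs hτs hpos
  have p1 : 0 < Fintype.card (InfinitePlace K) := Fintype.card_pos
  rw [Units.rank] at hL hK
  refine Nat.le_of_mul_le_mul_left ?_ (pow_pos two_pos
    (Module.finrank ℤ (Additive (M ⊓ (MonoidHom.id Lˣ * σ).ker : Subgroup Lˣ)) + 1))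
  rw [← mul_assoc, hr5, ← pow_succ, ← pow_add]
  exact Nat.pow_le_pow_right two_pos (by omega)

end IsQuadConj
end

section
variable {K : Type*} [Field K] [NumberField K]

theorem exists_mul_mem_locSq {ι : Type*} {v : ι → HeightOneSpectrum (𝓞 K)} {e : ι → Kˣ}
    (h2 : ∀ i, (2 : 𝓞 K) ∉ (v i).asIdeal) {U : Subgroup Kˣ}
    (hU : ∀ z ∈ U, ∀ i, (v i).valuation K z = 1) (he : ∀ i, e i ∈ U)
    (hei : ∀ i, e i ∉ locSq (v i)) (hej : ∀ i j, j ≠ i → e i ∈ locSq (v j))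
    (J : Finset ι) {y : Kˣ} (hy : ∀ j ∈ J, (v j).valuation K y = 1) :
    ∃ z ∈ U, ∀ j ∈ J, y * z ∈ locSq (v j) := by
  classical
  refine ⟨∏ j ∈ J with y ∉ locSq (v j), e j, prod_mem fun j _ ↦ he j, fun j hj ↦ ?_⟩
  by_cases hyj : y ∈ locSq (v j)
  · refine mul_mem hyj (prod_mem fun k hk ↦ hej k j ?_)
    rintro rfl
    exact (Finset.mem_filter.1 hk).2 hyj
  · rw [← Finset.mul_prod_erase _ _ (Finset.mem_filter.2 ⟨hj, hyj⟩), ← mul_assoc]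
    exact mul_mem (mul_mem_locSq (h2 j) (hy j hj) (hU _ (he j) j) hyj (hei j))
      (prod_mem fun k hk ↦ hej k j (Finset.ne_of_mem_erase hk).symm)

end

section
variable {K : Type} [Field K] [NumberField K]

theorem isSquare_of_mem_primaryUnits {S₀ : Finset (HeightOneSpectrum (𝓞 K))}
    (h2S : ∀ v ∈ S₀, (2 : 𝓞 K) ∉ v.asIdeal)
    (hS₀ : ∀ v ∉ S₀, ∃ π : Kˣ, v.valuation K π = WithZero.exp (-1 : ℤ) ∧
      ∀ w ∉ S₀, w ≠ v → w.valuation K π = 1)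
    {ι : Type} [Fintype ι] [DecidableEq (HeightOneSpectrum (𝓞 K))]
    {v : ι → HeightOneSpectrum (𝓞 K)} {e : ι → Kˣ}
    (hv : Function.Injective v) (hvS : ∀ i, v i ∉ S₀) (h2 : ∀ i, (2 : 𝓞 K) ∉ (v i).asIdeal)
    (he : ∀ i, e i ∈ (S₀ : Set (HeightOneSpectrum (𝓞 K))).unit K)
    (hei : ∀ i, e i ∉ locSq (v i)) (hej : ∀ i j, j ≠ i → e i ∈ locSq (v j)) {x : Kˣ}
    (hx : x ∈ (↑(S₀ ∪ Finset.univ.image v) : Set (HeightOneSpectrum (𝓞 K))).unit K)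
    (hxΨ : x ∈ primaryUnits S₀) : IsSquare (x : K) := by
  classical
  by_contra hsq
  obtain ⟨L, _, _, _, τ, s, hτ, hs, hτs⟩ := exists_quadratic K (x : K) hsq
  obtain ⟨S, hS⟩ : ∃ S, S = S₀ ∪ Finset.univ.image v := ⟨_, rfl⟩
  rw [← hS] at hx
  have memS {w} : w ∈ S ↔ w ∈ S₀ ∨ ∃ i, v i = w := by simp [hS]
  have hle : (S₀ : Set (HeightOneSpectrum (𝓞 K))).unit K ≤
      (S : Set (HeightOneSpectrum (𝓞 K))).unit K :=
    fun y hy w hw ↦ hy w fun h ↦ hw (memS.2 (Or.inl h))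
  obtain ⟨hQ, hP, hL⟩ := hxΨ
  have hP' (σ : K →+* ℝ) : 0 < σ x := mem_posAt.1 (Subgroup.mem_iInf.1 hP σ)
  have hL' (w) (hw : w ∈ S₀) : x ∈ locSq w := Subgroup.mem_iInf.1 hL ⟨w, hw⟩
  obtain ⟨H, hH, hH0, hHle⟩ := hτ.exists_norm_relIndex_le hs hτs (S := S)
    (fun w hw ↦ (memS.1 hw).elim (h2S w) (by rintro ⟨i, rfl⟩; exact h2 i))
    (fun w hw ↦ by
      obtain ⟨π, h1, h2⟩ := hS₀ w fun h ↦ hw (memS.2 (Or.inl h))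
      exact ⟨π, h1, fun u hu ↦ h2 u fun h ↦ hu (memS.2 (Or.inl h))⟩)
    hx hQ hP'
  let I := {i // x ∉ locSq (v i)}
  let J : Finset ι := {i | x ∉ evenOrd (v i)}
  obtain ⟨U, hU⟩ : ∃ U, U = (S : Set (HeightOneSpectrum (𝓞 K))).unit K := ⟨_, rfl⟩
  rw [← hU] at hH0 hHle hle
  have hcard : {w ∈ S | x ∉ locSq w}.card ≤ Nat.card I := by
    rw [Nat.card_eq_fintype_card, Fintype.card_subtype]
    refine (Finset.card_le_card ?_).trans (Finset.card_image_le (f := v))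
    intro w hw
    rw [Finset.mem_filter, memS] at hw
    obtain ⟨hw | ⟨i, rfl⟩, hw'⟩ := hw
    · exact absurd (hL' w hw) hw'
    · simp [hw', hv.eq_iff]
  let A : Subgroup Kˣ := U ⊓ ⨅ j : J, (v j).valuationOfNeZero.ker
  have memA {y : Kˣ} : y ∈ A ↔ y ∈ U ∧ ∀ j ∈ J, (v j).valuation K y = 1 := by
    simp only [A, Subgroup.mem_inf, Subgroup.mem_iInf, MonoidHom.mem_ker,
      HeightOneSpectrum.valuationOfNeZero_eq_one_iff, Subtype.forall]
  have hu (y : Kˣ) (hy : y ∈ (S₀ : Set (HeightOneSpectrum (𝓞 K))).unit K) (i) :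
    (v i).valuation K y = 1 := hy _ (hvS i)
  have hg (i : I) : ∃ g : A, (x ∈ evenOrd (v i) → (g : Kˣ) ∉ evenOrd (v i)) ∧
      (x ∉ evenOrd (v i) → (g : Kˣ) ∉ locSq (v i)) ∧ ∀ j : ι, j ≠ i →
      (x ∈ evenOrd (v j) → (g : Kˣ) ∈ evenOrd (v j)) ∧
      (x ∉ evenOrd (v j) → (g : Kˣ) ∈ locSq (v j)) := by
    by_cases hi : x ∈ evenOrd (v i)
    · obtain ⟨π, hπ, hπ'⟩ := hS₀ (v i) (hvS i)
      have hπv (j : ι) (hj : j ≠ i) : (v j).valuation K π = 1 := hπ' _ (hvS j) (hv.ne hj)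
      have hJ (j : ι) (hj : j ∈ J) : j ≠ i := by
        rintro rfl
        exact (Finset.mem_filter.1 hj).2 hi
      obtain ⟨z, hz, hz'⟩ := exists_mul_mem_locSq h2 hu he hei hej J fun j hj ↦ hπv j (hJ j hj)
      have hval (w : HeightOneSpectrum (𝓞 K)) :
          w.valuation K ((π * z : Kˣ) : K) = w.valuation K π * w.valuation K z := by
        rw [Units.val_mul, map_mul]
      refine ⟨⟨π * z, memA.2 ⟨?_, fun j hj ↦ ?_⟩⟩, fun _ h ↦ ?_, fun h ↦ absurd hi h,
        fun j hj ↦ ⟨fun _ ↦ ?_, fun h ↦ hz' j (by simpa [J] using h)⟩⟩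
      · rw [hU]
        refine mul_mem (fun w hw ↦ hπ' w (fun h ↦ hw (memS.2 (Or.inl h))) ?_) (hU ▸ hle hz)
        rintro rfl
        exact hw (memS.2 (Or.inr ⟨_, rfl⟩))
      · rw [hval, hπv j (hJ j hj), hu z hz, one_mul]
      · obtain ⟨y, hy⟩ := exists_sq_mul_valuation_eq_one h
        simp only [Units.val_mul, Units.val_pow_eq_pow_val, map_mul, map_pow, hπ, hu z hz] at hy
        have hy0 : (v i).valuation K (y : K) ≠ 0 := by simp
        have := congrArg WithZero.log hy
        rw [mul_one, WithZero.log_mul (by simp) (pow_ne_zero 2 hy0), WithZero.log_exp,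
          WithZero.log_pow, WithZero.log_one, nsmul_eq_mul] at this
        push_cast at this
        omega
      · exact mem_evenOrd.2 (by
          rw [(HeightOneSpectrum.valuationOfNeZero_eq_one_iff _ _).2 (by
            rw [hval, hπv j hj, hu z hz, one_mul])]
          simp)
    · refine ⟨⟨e i, memA.2 ⟨hle (he i), fun j _ ↦ hu _ (he i) _⟩⟩, fun h ↦ absurd h hi,
        fun _ ↦ hei i, fun j hj ↦ ⟨fun _ ↦ locSq_le_evenOrd (hej _ _ hj), fun _ ↦ hej _ _ hj⟩⟩
  choose g hg1 hg2 hg3 using hg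
  have hHA0 : H.relIndex A ≠ 0 := by
    exact fun h ↦ hH0 (Subgroup.relIndex_eq_zero_of_le_right inf_le_left h)
  have : (H.subgroupOf A).FiniteIndex := ⟨hHA0⟩
  have key := Subgroup.two_pow_card_le_index (H.subgroupOf A)
    (fun i : I ↦ (if x ∈ evenOrd (v i) then evenOrd (v i) else locSq (v i)).subgroupOf A) g
    (fun i n hn ↦ ?_) (fun i ↦ ?_) (fun i j hj ↦ ?_)
  · have h1 : H.relIndex A ≤ H.relIndex U := Subgroup.relIndex_le_of_le_right inf_le_left hH0
    have h3 := hHle.trans (Nat.pow_le_pow_right two_pos hcard)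
    change 2 ^ Nat.card I ≤ H.relIndex A at key
    have : 0 < 2 ^ Nat.card I := by positivity
    omega
  · rw [Subgroup.mem_subgroupOf] at hn ⊢
    obtain ⟨α, β, h⟩ := hH _ hn
    by_cases hi : x ∈ evenOrd (v i)
    · rw [if_pos hi]
      exact norm_mem_evenOrd hi i.2 h
    · rw [if_neg hi]
      exact norm_mem_locSq hi h ((memA.1 n.2).2 i (by simpa [J] using hi))
  · rw [Subgroup.mem_subgroupOf]
    by_cases hi : x ∈ evenOrd (v i)
    · rw [if_pos hi]
      exact hg1 i hi
    · rw [if_neg hi]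
      exact hg2 i hi
  · rw [Subgroup.mem_subgroupOf]
    by_cases hi : x ∈ evenOrd (v j)
    · rw [if_pos hi]
      exact (hg3 i j (Subtype.coe_ne_coe.2 hj)).1 hi
    · rw [if_neg hi]
      exact (hg3 i j (Subtype.coe_ne_coe.2 hj)).2 hi

theorem mem_oddUnits_of_valuation_eq_one {x : Kˣ}
    (hx : ∀ v : HeightOneSpectrum (𝓞 K), (2 : 𝓞 K) ∈ v.asIdeal → v.valuation K x = 1) :
    x ∈ oddUnits K := by
  have top_of (I : Ideal (𝓞 K)) (hI : ∀ v : HeightOneSpectrum (𝓞 K), (2 : 𝓞 K) ∈ v.asIdeal →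
      ¬ I ≤ v.asIdeal) : ∃ d ∈ I, IsCoprime d 2 := by
    have : I ⊔ Ideal.span {2} = ⊤ := by
      by_contra h
      obtain ⟨M, hM, hle⟩ := Ideal.exists_le_maximal _ h
      have h2 : (2 : 𝓞 K) ∈ M := hle (Ideal.mem_sup_right (Ideal.mem_span_singleton_self 2))
      refine hI ⟨M, hM.isPrime, fun h0 ↦ ?_⟩ h2 (le_sup_left.trans hle)
      rw [h0, Ideal.mem_bot] at h2
      exact two_ne_zero h2
    have h1 : (1 : 𝓞 K) ∈ I ⊔ Ideal.span {2} := this ▸ Submodule.mem_top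
    obtain ⟨d, hd, t, ht, h⟩ := Submodule.mem_sup.1 h1
    obtain ⟨c, rfl⟩ := Ideal.mem_span_singleton'.1 ht
    exact ⟨d, hd, 1, c, by rw [one_mul, h]⟩
  let D : Ideal (𝓞 K) :=
    { carrier := {d | ∃ n : 𝓞 K, (x : K) * algebraMap (𝓞 K) K d = algebraMap (𝓞 K) K n}
      zero_mem' := ⟨0, by simp⟩
      add_mem' := by
        rintro a b ⟨n, hn⟩ ⟨m, hm⟩
        exact ⟨n + m, by rw [map_add, mul_add, hn, hm, map_add]⟩
      smul_mem' := by
        rintro c a ⟨n, hn⟩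
        exact ⟨c * n, by rw [smul_eq_mul, map_mul, mul_left_comm, hn, map_mul]⟩ }
  obtain ⟨d, ⟨a, h⟩, hd⟩ := top_of D fun v hv hD ↦ by
    obtain ⟨n, d, h⟩ := v.exists_primeCompl_mul_eq_of_integer (x : K) (hx v hv).le
    exact d.2 (hD ⟨n, h⟩)
  refine ⟨a, d, ?_, hd, h⟩
  obtain ⟨a', ha', hc⟩ := top_of (Ideal.span {a}) fun v hv hle ↦ by
    have ha : a ∈ v.asIdeal := hle (Ideal.mem_span_singleton_self a)
    rw [← v.valuation_lt_one_iff_mem (K := K)] at ha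
    change v.valuation K (algebraMap (𝓞 K) K a) < 1 at ha
    rw [← h, map_mul, hx v hv, one_mul,
      v.valuation_lt_one_iff_mem] at ha
    obtain ⟨p, q, hpq⟩ := hd
    exact v.isPrime.ne_top (v.asIdeal.eq_top_of_isUnit_mem
      (add_mem (v.asIdeal.mul_mem_left p ha) (v.asIdeal.mul_mem_left q hv)) (hpq ▸ isUnit_one))
  obtain ⟨c, rfl⟩ := Ideal.mem_span_singleton'.1 ha'
  exact hc.of_mul_left_right

theorem exists_unit_sup_primaryUnits_relIndex_le (h1 : ¬ IsSquare (-1 : K)) :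
    ∃ S₀ S : Finset (HeightOneSpectrum (𝓞 K)), (∀ v ∈ S, (2 : 𝓞 K) ∉ v.asIdeal) ∧
      S₀ ⊆ S ∧ (∀ v ∈ S, v ∉ S₀ → (-1 : Kˣ) ∈ locSq v) ∧
      ((S : Set (HeightOneSpectrum (𝓞 K))).unit K ⊔ primaryUnits S₀).relIndex (oddUnits K) ≠ 0 ∧
      ((S : Set (HeightOneSpectrum (𝓞 K))).unit K ⊔ primaryUnits S₀).relIndex (oddUnits K) ≤ 2 := by
  classical
  obtain ⟨S₀, h2S, hS₀⟩ := exists_classGroup_generators K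
  obtain ⟨ι, _, v, e, hcard, hv, hvS, h2, hneg, he, hei, hej⟩ := exists_dual_places h1 S₀ _ le_rfl
  have key {x : Kˣ} := isSquare_of_mem_primaryUnits h2S hS₀ hv hvS h2 he hei hej (x := x)
  obtain ⟨S, hS⟩ : ∃ S, S = S₀ ∪ Finset.univ.image v := ⟨_, rfl⟩
  have memS {w} : w ∈ S ↔ w ∈ S₀ ∨ ∃ i, v i = w := by simp [hS]
  have hSc : S.card = S₀.card + Fintype.card ι := by
    rw [hS, Finset.card_union_of_disjoint, Finset.card_image_of_injective _ hv, Finset.card_univ]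
    rw [Finset.disjoint_left]
    rintro w hw hw'
    obtain ⟨i, -, rfl⟩ := Finset.mem_image.1 hw'
    exact hvS i hw
  rw [← hS] at key
  have h2S' (w) (hw : w ∈ S) : (2 : 𝓞 K) ∉ w.asIdeal :=
    (memS.1 hw).elim (h2S w) (by rintro ⟨i, rfl⟩; exact h2 i)
  refine ⟨S₀, S, h2S', fun w hw ↦ memS.2 (Or.inl hw), fun w hw hw' ↦ ?_, ?_⟩
  · obtain ⟨i, rfl⟩ := (memS.1 hw).resolve_left hw'
    exact hneg i
  obtain ⟨hΨ0, hΨ⟩ := primaryUnits_relIndex S₀ h2S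
  have hUodd : (S : Set (HeightOneSpectrum (𝓞 K))).unit K ≤ oddUnits K := fun x hx ↦
    mem_oddUnits_of_valuation_eq_one fun w hw ↦ hx w fun h ↦ h2S' w h hw
  have hsq := Subgroup.relIndex_map_sq ((S : Set (HeightOneSpectrum (𝓞 K))).unit K)
    (neg_one_mem_unit _)
  have hrank : Module.finrank ℤ (Additive ((S : Set (HeightOneSpectrum (𝓞 K))).unit K)) + 1 =
      2 * (NumberField.Units.rank K + S₀.card) + 1 := by
    rw [unit_finrank, hSc, hcard, unit_finrank]
    ring
  rw [hrank] at hsq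
  have hΨU0 : (primaryUnits S₀).relIndex ((S : Set (HeightOneSpectrum (𝓞 K))).unit K) ≠ 0 :=
    fun h ↦ hΨ0 (Subgroup.relIndex_eq_zero_of_le_right hUodd h)
  have hle : 2 ^ (2 * (NumberField.Units.rank K + S₀.card) + 1) ≤
      (primaryUnits S₀).relIndex ((S : Set (HeightOneSpectrum (𝓞 K))).unit K) := by
    rw [← hsq, ← Subgroup.inf_relIndex_right (primaryUnits S₀)]
    refine Subgroup.relIndex_le_of_le_left ?_ (by rwa [Subgroup.inf_relIndex_right])
    intro x hx
    obtain ⟨hxΨ, hxU⟩ := Subgroup.mem_inf.1 hx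
    obtain ⟨y, hy⟩ := key hxU hxΨ
    have hy0 : y ≠ 0 := by
      rintro rfl
      simp at hy
    have hxy : (Units.mk0 y hy0) ^ 2 = x := Units.ext (by simp [hy, sq])
    exact ⟨Units.mk0 y hy0, mem_unit_of_sq_mem (by rw [hxy]; exact hxU), hxy⟩
  have hmul := Subgroup.relIndex_mul_relIndex (primaryUnits S₀)
    ((S : Set (HeightOneSpectrum (𝓞 K))).unit K ⊔ primaryUnits S₀) (oddUnits K) le_sup_right
    (sup_le hUodd (inf_le_left.trans (sqModFour_le)))
  rw [Subgroup.relIndex_sup_right] at hmul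
  refine ⟨fun h ↦ hΨ0 (by rw [← hmul, h, mul_zero]), ?_⟩
  rw [← hmul] at hΨ
  by_contra! h
  have h3 := Nat.mul_le_mul hle h
  have : 2 ^ (2 * (NumberField.Units.rank K + 1 + S₀.card)) =
    2 ^ (2 * (NumberField.Units.rank K + S₀.card) + 1) * 2 := by ring
  have : 0 < 2 ^ (2 * (NumberField.Units.rank K + S₀.card) + 1) := by positivity
  omega

end

section
variable {K : Type*} [Field K] [NumberField K]

theorem even_card_neg_of_norm_pos {x : K} (hx : 0 < Algebra.norm ℚ x)
    [DecidablePred fun σ : K →+* ℝ ↦ σ x < 0] :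
    Even (Finset.univ.filter fun σ : K →+* ℝ ↦ σ x < 0).card := by
  classical
  have hx0 : x ≠ 0 := by
    rintro rfl
    simp at hx
  have h0 (φ : K →+* ℂ) : (‖φ x‖ : ℂ) ≠ 0 := by simpa using hx0
  have hconj (φ : K →+* ℂ) : ComplexEmbedding.conjugate φ x = star (φ x) := rfl
  have hN : ∏ φ : K →+* ℂ, φ x = ((Algebra.norm ℚ x : ℚ) : ℂ) := by
    have := Algebra.norm_eq_prod_embeddings ℚ ℂ x
    rw [eq_ratCast] at this
    rw [this]
    exact Fintype.prod_equiv (RingHom.equivRatAlgHom K ℂ) _ _ fun _ ↦ by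
      simp [RingHom.equivRatAlgHom_apply]
  have h1 : ∏ φ : K →+* ℂ, φ x / (‖φ x‖ : ℂ) = 1 := by
    rw [Finset.prod_div_distrib, ← Complex.ofReal_prod, ← norm_prod, hN, Complex.norm_ratCast,
      abs_of_pos (by exact_mod_cast hx), Complex.ofReal_ratCast]
    exact div_self (by exact_mod_cast hx.ne')
  rw [← Finset.prod_filter_mul_prod_filter_not _ fun φ : K →+* ℂ ↦ ComplexEmbedding.IsReal φ,
    Finset.prod_involution (s := {φ : K →+* ℂ | ¬ ComplexEmbedding.IsReal φ})
      (fun φ _ ↦ ComplexEmbedding.conjugate φ) ?_ ?_ ?_ ?_, mul_one] at h1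
  · rw [← Finset.prod_bij (s := Finset.univ)
      (f := fun σ : K →+* ℝ ↦ if σ x < 0 then (-1 : ℂ) else 1)
      (fun σ _ ↦ Complex.ofRealHom.comp σ) ?_ ?_ ?_ ?_, Finset.prod_ite, Finset.prod_const_one,
      mul_one, Finset.prod_const] at h1
    · exact (neg_one_pow_eq_one_iff_even (by norm_num)).1 h1
    · intro σ _
      rw [Finset.mem_filter, ComplexEmbedding.isReal_iff]
      refine ⟨Finset.mem_univ _, ?_⟩
      ext y
      simp
    · intro σ _ σ' _ h
      ext y
      simpa using RingHom.congr_fun h y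
    · intro φ hφ
      have hφ' := (Finset.mem_filter.1 hφ).2
      refine ⟨hφ'.embedding, Finset.mem_univ _, ?_⟩
      ext y
      exact ComplexEmbedding.IsReal.coe_embedding_apply hφ' y
    · intro σ _
      have hσ : σ x ≠ 0 := by simpa using hx0
      simp only [RingHom.comp_apply, Complex.ofRealHom_eq_coe, Complex.norm_real, Real.norm_eq_abs]
      split_ifs with h
      · rw [abs_of_neg h, ← Complex.ofReal_div, div_neg, div_self hσ]
        simp
      · rw [abs_of_nonneg (not_lt.1 h), ← Complex.ofReal_div, div_self hσ]
        simp
  · intro φ _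
    have h := h0 φ
    rw [hconj, norm_star, div_mul_div_comm, div_eq_one_iff_eq (mul_ne_zero h h)]
    have := Complex.mul_conj' (φ x)
    rw [sq] at this
    exact this
  · intro φ hφ _ h
    exact (Finset.mem_filter.1 hφ).2 (ComplexEmbedding.isReal_iff.2 h)
  · intro φ hφ
    simpa [ComplexEmbedding.isReal_conjugate_iff] using hφ
  · intro φ _
    exact star_star φ

theorem norm_intCast_eq_of_sub_dvd (n : ℕ) {a b : 𝓞 K} (h : (n : 𝓞 K) ∣ a - b) :
    ((Algebra.norm ℤ a : ℤ) : ZMod n) = ((Algebra.norm ℤ b : ℤ) : ZMod n) := by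
  classical
  obtain ⟨c, hc⟩ := h
  have B := Module.Free.chooseBasis ℤ (𝓞 K)
  have hab : a = b + (n : ℤ) • c := by
    rw [sub_eq_iff_eq_add'.1 hc]
    simp
  rw [Algebra.norm_eq_matrix_det B, Algebra.norm_eq_matrix_det B]
  change Int.castRingHom (ZMod n) _ = Int.castRingHom (ZMod n) _
  rw [RingHom.map_det, RingHom.map_det, hab, map_add, map_smul]
  congr 1
  ext i j
  have : algebraMap ℤ (Matrix _ _ ℤ) n * Algebra.leftMulMatrix B c =
    (n : ℤ) • Algebra.leftMulMatrix B c := (Algebra.smul_def _ _).symm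
  simp only [RingHom.mapMatrix_apply, Matrix.map_apply, Matrix.add_apply, Matrix.smul_apply,
    eq_intCast, smul_eq_mul, Int.cast_add, Int.cast_mul, Int.cast_natCast, CharP.cast_eq_zero,
    zero_mul, add_zero]

theorem odd_absNorm {v : HeightOneSpectrum (𝓞 K)} (h2 : (2 : 𝓞 K) ∉ v.asIdeal) :
    Odd (Ideal.absNorm v.asIdeal) := by
  let _ := Ideal.Quotient.field v.asIdeal
  have hfin : Finite (𝓞 K ⧸ v.asIdeal) := Ideal.finiteQuotientOfFreeOfNeBot _ v.ne_bot
  let _ := Fintype.ofFinite (𝓞 K ⧸ v.asIdeal)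
  rw [← Nat.not_even_iff_odd, Nat.even_iff, Ideal.absNorm_apply, Submodule.cardQuot_apply,
    Nat.card_eq_fintype_card, ← FiniteField.even_card_iff_char_two]
  intro h
  apply h2
  rw [← Ideal.Quotient.eq_zero_iff_mem, map_ofNat]
  have := ringChar.Nat.cast_ringChar (R := 𝓞 K ⧸ v.asIdeal)
  rw [h] at this
  exact_mod_cast this

theorem absNorm_mod_four {I : Ideal (𝓞 K)} (hI : I ≠ ⊥)
    (h : ∀ v : HeightOneSpectrum (𝓞 K), (Ideal.absNorm v.asIdeal ^
      (Associates.mk v.asIdeal).count (Associates.mk I).factors) % 4 = 1) :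
    Ideal.absNorm I % 4 = 1 := by
  rw [← Ideal.finprod_heightOneSpectrum_factorization hI]
  refine finprod_induction (fun J : Ideal (𝓞 K) ↦ Ideal.absNorm J % 4 = 1) (by simp)
    (fun J J' h h' ↦ ?_) fun v ↦ ?_
  · rw [map_mul, Nat.mul_mod, h, h']
  · rw [HeightOneSpectrum.maxPowDividing, map_pow]
    exact h v

theorem even_card_neg {S₀ S : Finset (HeightOneSpectrum (𝓞 K))} {b : Kˣ}
    (h2 : ∀ v ∈ S, (2 : 𝓞 K) ∉ v.asIdeal)
    (hneg : ∀ v ∈ S, v ∉ S₀ → (-1 : Kˣ) ∈ locSq v)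
    (hbS : b ∈ (S : Set (HeightOneSpectrum (𝓞 K))).unit K)
    (hb4 : b ∈ sqModFour K) (hb : ∀ v ∈ S₀, b ∈ locSq v)
    [DecidablePred fun σ : K →+* ℝ ↦ σ b < 0] :
    Even (Finset.univ.filter fun σ : K →+* ℝ ↦ σ b < 0).card := by
  obtain ⟨t, d, c, ht, hd, h⟩ := hb4
  have h7 : (b : K) * algebraMap (𝓞 K) K d ^ 2 = algebraMap (𝓞 K) K (t ^ 2 + 4 * c) := by
    simp only [map_mul, map_add, map_pow, map_ofNat]
    exact h
  obtain ⟨B, hB⟩ : ∃ B, B = t ^ 2 + 4 * c := ⟨_, rfl⟩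
  rw [← hB] at h7
  have hd0 : algebraMap (𝓞 K) K d ≠ 0 := by
    simpa using ne_zero_of_isCoprime_two hd
  have hB0 : B ≠ 0 := by
    rintro rfl
    simp [hd0] at h7
  have hNt : Algebra.norm ℤ t % 2 = 1 := by
    obtain ⟨p, q, hpq⟩ := ht
    have h1 := norm_intCast_eq_of_sub_dvd 2 (a := p * t) (b := 1)
      ⟨-q, by push_cast; linear_combination hpq⟩
    rw [ZMod.intCast_eq_intCast_iff', map_mul, map_one, Int.mul_emod] at h1
    rcases Int.emod_two_eq_zero_or_one (Algebra.norm ℤ t) with h | h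
    · rw [Nat.cast_ofNat, h] at h1
      simp at h1
    · exact h
  have hNB : Algebra.norm ℤ B % 4 = 1 := by
    have h1 := norm_intCast_eq_of_sub_dvd 4 (a := B) (b := t ^ 2)
      ⟨c, by push_cast; linear_combination hB⟩
    rw [ZMod.intCast_eq_intCast_iff', map_pow] at h1
    push_cast at h1
    rw [h1]
    exact Int.sq_mod_four_eq_one_of_odd (Int.odd_iff.2 hNt)
  have hcount := absNorm_mod_four (I := Ideal.span {B}) (by simpa using hB0) fun v ↦ by
    by_cases hv : v ∈ S ∧ v ∉ S₀
    · rw [Nat.pow_mod, card_quotient_mod_four (h2 v hv.1) (hneg v hv.1 hv.2)]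
      simp
    have hev : b ∈ evenOrd v := by
      by_cases hvS : v ∈ S
      · exact locSq_le_evenOrd (hb v (by_contra fun h ↦ hv ⟨hvS, h⟩))
      · rw [mem_evenOrd, (HeightOneSpectrum.valuationOfNeZero_eq_one_iff _ _).2 (hbS v hvS)]
        simp
    obtain ⟨y, hy⟩ := exists_sq_mul_valuation_eq_one hev
    have hval : v.valuation K (algebraMap (𝓞 K) K B) = WithZero.exp
        (-(Associates.mk v.asIdeal).count (Associates.mk (Ideal.span {B})).factors : ℤ) := by
      rw [v.valuation_of_algebraMap, v.intValuation_if_neg hB0]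
    obtain ⟨k, hk⟩ : ∃ k, k = (Associates.mk v.asIdeal).count
      (Associates.mk (Ideal.span {B})).factors := ⟨_, rfl⟩
    rw [← hk] at hval ⊢
    rcases Nat.eq_zero_or_pos k with h0 | h0
    · simp [h0]
    have h2v : (2 : 𝓞 K) ∉ v.asIdeal := fun h2v ↦ by
      have : B ∈ v.asIdeal := by
        rw [← v.valuation_lt_one_iff_mem (K := K)]
        change v.valuation K (algebraMap (𝓞 K) K B) < 1
        rw [hval, ← WithZero.exp_zero, WithZero.exp_lt_exp]
        omega
      obtain ⟨p, q, hpq⟩ := ht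
      have ht2 : t ^ 2 ∈ v.asIdeal := by
        have : t ^ 2 = B - 2 * (2 * c) := by rw [hB]; ring
        rw [this]
        exact sub_mem ‹_› (v.asIdeal.mul_mem_right _ h2v)
      exact v.isPrime.ne_top (v.asIdeal.eq_top_of_isUnit_mem
        (add_mem (v.asIdeal.mul_mem_left p (v.isPrime.mem_of_pow_mem 2 ht2))
        (v.asIdeal.mul_mem_left q h2v)) (hpq ▸ isUnit_one))
    have hke : Even k := by
      have h8 : v.valuation K (algebraMap (𝓞 K) K B) * v.valuation K (y : K) ^ 2 =
          v.valuation K (algebraMap (𝓞 K) K d) ^ 2 := by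
        rw [← h7, map_mul, map_pow, mul_right_comm, ← map_pow, ← map_mul]
        rw [Units.val_mul, Units.val_pow_eq_pow_val] at hy
        rw [hy, one_mul]
      have hy0 : v.valuation K (y : K) ≠ 0 := by simp
      have := congrArg WithZero.log h8
      rw [hval, WithZero.log_mul (by simp) (pow_ne_zero 2 hy0), WithZero.log_exp,
        WithZero.log_pow, WithZero.log_pow, nsmul_eq_mul, nsmul_eq_mul] at this
      push_cast at this
      rw [Nat.even_iff]
      omega
    obtain ⟨m, rfl⟩ := hke
    have h11 := Int.sq_mod_four_eq_one_of_odd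
      ((odd_absNorm h2v).pow (n := m)).natCast
    rw [pow_add, ← sq]
    exact_mod_cast h11
  rw [Ideal.absNorm_span_singleton] at hcount
  have hpos : 0 < Algebra.norm ℤ B := by omega
  refine even_card_neg_of_norm_pos ?_
  have h9 := congrArg (Algebra.norm ℚ) h7
  rw [map_mul, map_pow] at h9
  have h10 : 0 < Algebra.norm ℚ (algebraMap (𝓞 K) K B) := by
    change 0 < Algebra.norm ℚ (B : K)
    rw [← Algebra.coe_norm_int]
    exact_mod_cast hpos
  rw [← h9] at h10
  exact pos_of_mul_pos_left h10 (sq_nonneg _)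

end

section
variable {K : Type*} [Field K] [NumberField K]

theorem exists_isolating_element (σ : K →+* ℝ) :
    ∃ α : 𝓞 K, σ (algebraMap (𝓞 K) K α) < 0 ∧
      ∀ τ : K →+* ℝ, τ ≠ σ → 0 < τ (algebraMap (𝓞 K) K α) := by
  classical
  let pb := Field.powerBasisOfFiniteOfSeparable ℚ K
  have hinj (τ : K →+* ℝ) (h : τ pb.gen = σ pb.gen) : τ = σ := by
    have := pb.algHom_ext (f := τ.toRatAlgHom) (g := σ.toRatAlgHom) h
    ext x
    exact DFunLike.congr_fun this x
  have hfin : ((fun τ : K →+* ℝ ↦ τ pb.gen) '' {τ | τ ≠ σ}).Finite := Set.toFinite _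
  obtain ⟨ε, hε, hball⟩ := Metric.isOpen_iff.1 hfin.isClosed.isOpen_compl (σ pb.gen) (by
    rintro ⟨τ, hτ, h⟩
    exact hτ (hinj τ h))
  obtain ⟨p, hp1, hp2⟩ := exists_rat_btwn (sub_lt_self (σ pb.gen) hε)
  obtain ⟨q, hq1, hq2⟩ := exists_rat_btwn (lt_add_of_pos_right (σ pb.gen) hε)
  obtain ⟨a, d, hd, h⟩ := IsFractionRing.div_surjective (A := 𝓞 K) ((pb.gen - p) * (pb.gen - q))
  have hd0 : algebraMap (𝓞 K) K d ≠ 0 := by simpa using nonZeroDivisors.ne_zero hd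
  have key (τ : K →+* ℝ) : τ (algebraMap (𝓞 K) K (a * d)) =
      ((τ pb.gen - p) * (τ pb.gen - q)) * τ (algebraMap (𝓞 K) K d) ^ 2 := by
    rw [div_eq_iff hd0] at h
    rw [map_mul, h, map_mul, map_mul, map_mul, map_sub, map_sub, map_ratCast, map_ratCast]
    ring
  have hpos (τ : K →+* ℝ) : 0 < τ (algebraMap (𝓞 K) K d) ^ 2 := by
    have : τ (algebraMap (𝓞 K) K d) ≠ 0 := by simpa using hd0
    positivity
  refine ⟨a * d, ?_, fun τ hτ ↦ ?_⟩
  · rw [key]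
    exact mul_neg_of_neg_of_pos (mul_neg_of_pos_of_neg (by linarith) (by linarith)) (hpos σ)
  · rw [key]
    refine mul_pos ?_ (hpos τ)
    by_contra! hle
    refine hball ?_ ⟨τ, hτ, rfl⟩
    rw [Metric.mem_ball, Real.dist_eq, abs_lt]
    have hpq : (p : ℝ) < q := hp2.trans hq1
    constructor
    · by_contra! h1
      nlinarith [mul_pos (show 0 < (p : ℝ) - τ pb.gen by linarith)
        (show 0 < (q : ℝ) - τ pb.gen by linarith)]
    · by_contra! h1
      nlinarith [mul_pos (show 0 < τ pb.gen - (p : ℝ) by linarith)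
        (show 0 < τ pb.gen - (q : ℝ) by linarith)]

theorem exists_mem_sqModFour_neg (S : Finset (HeightOneSpectrum (𝓞 K))) (σ : K →+* ℝ) :
    ∃ c : Kˣ, c ∈ sqModFour K ∧ (∀ v ∈ S, c ∈ locSq v) ∧ σ c < 0 ∧
      ∀ τ : K →+* ℝ, τ ≠ σ → 0 < τ c := by
  obtain ⟨α, hα, hα'⟩ := exists_isolating_element σ
  let m : ℕ := ∏ v ∈ S, Ideal.absNorm v.asIdeal
  have hm0 : 0 < m := Finset.prod_pos fun v _ ↦ by
    have := two_le_absNorm v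
    omega
  have hm (v) (hv : v ∈ S) : (m : 𝓞 K) ∈ v.asIdeal := by
    obtain ⟨k, hk⟩ := Finset.dvd_prod_of_mem
      (fun v : HeightOneSpectrum (𝓞 K) ↦ Ideal.absNorm v.asIdeal) hv
    change m = _ at hk
    rw [hk, Nat.cast_mul]
    exact v.asIdeal.mul_mem_right _ (Ideal.absNorm_mem _)
  obtain ⟨N, hN⟩ := exists_nat_gt (-σ (algebraMap (𝓞 K) K α))⁻¹
  have hN0 : (0 : ℝ) < N := lt_trans (inv_pos.2 (neg_pos.2 hα)) hN
  let C : 𝓞 K := 1 + 4 * (m * N * α)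
  have hC (τ : K →+* ℝ) :
      τ (algebraMap (𝓞 K) K C) = 1 + 4 * (m * N * τ (algebraMap (𝓞 K) K α)) := by
    simp only [C, map_mul, map_add, map_one, map_ofNat, map_natCast]
  have hCσ : σ (algebraMap (𝓞 K) K C) < 0 := by
    rw [hC]
    rw [inv_lt_iff_one_lt_mul₀ (neg_pos.2 hα)] at hN
    have : (1 : ℝ) ≤ m := by exact_mod_cast hm0
    nlinarith
  have hC0 : algebraMap (𝓞 K) K C ≠ 0 := fun h ↦ by
    rw [h, map_zero] at hCσ
    exact lt_irrefl _ hCσ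
  refine ⟨Units.mk0 _ hC0, ⟨1, 1, m * N * α, isCoprime_one_left, isCoprime_one_left, ?_⟩,
    fun v hv ↦ ?_, hCσ, fun τ hτ ↦ ?_⟩
  · simp only [C, Units.val_mk0, map_mul, map_add, map_one, map_ofNat, map_natCast, one_pow,
      mul_one]
  · have h1 : C - 1 ^ 2 ∈ v.asIdeal := by
      have : C - 1 ^ 2 = m * (4 * N * α) := by simp only [C]; ring
      rw [this]
      exact v.asIdeal.mul_mem_right _ (hm v hv)
    refine mem_locSq_of_sub_mem rfl (fun h ↦ v.isPrime.ne_top ?_) h1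
    rw [Ideal.eq_top_iff_one]
    simpa using sub_mem h h1
  · rw [Units.val_mk0, hC]
    have := hα' τ hτ
    positivity

end

section
variable {K : Type} [Field K] [NumberField K]

theorem exists_unit_neg_iff (T : Finset (K →+* ℝ)) (hT : T.Nonempty) (hT' : Even T.card) :
    ∃ (S : Finset (HeightOneSpectrum (𝓞 K))) (b : Kˣ), (∀ v ∈ S, (2 : 𝓞 K) ∉ v.asIdeal) ∧
      b ∈ (S : Set (HeightOneSpectrum (𝓞 K))).unit K ∧ b ∈ sqModFour K ∧
      (∀ v ∈ S, b ∈ locSq v ∨ (-1 : Kˣ) ∈ locSq v) ∧ ∀ σ : K →+* ℝ, σ b < 0 ↔ σ ∈ T := by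
  classical
  obtain ⟨σ₀, -⟩ := hT
  have h1 : ¬ IsSquare (-1 : K) := by
    rintro ⟨y, hy⟩
    have := congrArg σ₀ hy
    rw [map_neg, map_one, map_mul] at this
    nlinarith [mul_self_nonneg (σ₀ y)]
  obtain ⟨S₀, S, h2, hle, hneg, hG0, hG⟩ := exists_unit_sup_primaryUnits_relIndex_le h1
  choose c hc4 hcS hcσ hcτ using exists_mem_sqModFour_neg (K := K) S₀
  have hΨ {ψ : Kˣ} (h : ψ ∈ primaryUnits S₀) : ψ ∈ sqModFour K ∧ (∀ v ∈ S₀, ψ ∈ locSq v) ∧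
      ∀ σ : K →+* ℝ, 0 < σ ψ := by
    obtain ⟨hQ, hP, hL⟩ := h
    exact ⟨hQ, fun v hv ↦ Subgroup.mem_iInf.1 hL ⟨v, hv⟩,
      fun σ ↦ mem_posAt.1 (Subgroup.mem_iInf.1 hP σ)⟩
  obtain ⟨U, hU⟩ : ∃ U, U = (S : Set (HeightOneSpectrum (𝓞 K))).unit K := ⟨_, rfl⟩
  rw [← hU] at hG0 hG
  have hcG (σ) : c σ ∉ U ⊔ primaryUnits S₀ := fun h ↦ by
    obtain ⟨u, hu, ψ, hψ, h⟩ := Subgroup.mem_sup.1 h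
    obtain ⟨hψ4, hψS, hψσ⟩ := hΨ hψ
    have hu' : u = c σ * ψ⁻¹ := eq_mul_inv_of_mul_eq h
    have := even_card_neg (b := u) h2 hneg (hU ▸ hu) (hu' ▸ mul_mem (hc4 σ) (inv_mem hψ4))
      fun v hv ↦ hu' ▸ mul_mem (hcS σ v hv) (inv_mem (hψS v hv))
    have huc (τ : K →+* ℝ) : τ (u : K) * τ ψ = τ (c σ) := by
      rw [← h, Units.val_mul, map_mul]
    have h3 : (Finset.univ.filter fun τ : K →+* ℝ ↦ τ u < 0) = {σ} := by
      ext τ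
      rw [Finset.mem_filter, Finset.mem_singleton]
      constructor
      · rintro ⟨-, h⟩
        by_contra hτ
        have h4 := hcτ σ τ hτ
        rw [← huc] at h4
        exact lt_asymm h (pos_of_mul_pos_left h4 (hψσ τ).le)
      · rintro rfl
        refine ⟨Finset.mem_univ _, ?_⟩
        have h4 := hcσ τ
        rw [← huc] at h4
        exact neg_of_mul_neg_left h4 (hψσ τ).le
    rw [h3] at this
    simp at this
  obtain ⟨a, ha, hab⟩ := Subgroup.relIndex_dvd_two_iff.1
    (show (U ⊔ primaryUnits S₀).relIndex (oddUnits K) ∣ 2 by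
      interval_cases h : (U ⊔ primaryUnits S₀).relIndex (oddUnits K) <;> simp_all)
  obtain ⟨G, hG'⟩ : ∃ G, G = U ⊔ primaryUnits S₀ := ⟨_, rfl⟩
  rw [← hG'] at hab
  simp only [← hG'] at hcG
  have haa : a * a ∈ G := (hab a ha).elim id fun h ↦ mul_mem h h
  have hprod (R : Finset (K →+* ℝ)) : ∏ σ ∈ R, c σ ∈ G ↔ Even R.card := by
    induction R using Finset.induction_on with
    | empty => simp
    | insert σ R hσ ih =>
      rw [Finset.prod_insert hσ, Finset.card_insert_of_notMem hσ, Nat.even_add_one, ← ih]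
      constructor
      · intro h h'
        exact hcG σ ((Subgroup.mul_mem_cancel_right G h').1 h)
      · intro h
        have h3 := (hab _ (prod_mem fun τ _ ↦ sqModFour_le (hc4 τ))).resolve_right h
        have h4 := (hab _ (sqModFour_le (hc4 σ))).resolve_right (hcG σ)
        have h5 := mul_mem (mul_mem h4 h3) (inv_mem haa)
        rwa [mul_mul_mul_comm, mul_inv_cancel_right] at h5
  have hTG := (hprod T).2 hT'
  rw [hG'] at hTG
  obtain ⟨u, hu, ψ, hψ, h⟩ := Subgroup.mem_sup.1 hTG
  obtain ⟨hψ4, hψS, hψσ⟩ := hΨ hψ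
  have hu' : u = (∏ σ ∈ T, c σ) * ψ⁻¹ := eq_mul_inv_of_mul_eq h
  refine ⟨S, u, h2, hU ▸ hu, hu' ▸ mul_mem (prod_mem fun σ _ ↦ hc4 σ) (inv_mem hψ4), fun v hv ↦ ?_,
    fun σ ↦ ?_⟩
  · by_cases hv' : v ∈ S₀
    · exact Or.inl (hu' ▸ mul_mem (prod_mem fun σ _ ↦ hcS σ v hv') (inv_mem (hψS v hv')))
    · exact Or.inr (hneg v hv hv')
  have huc : σ (u : K) * σ ψ = ∏ τ ∈ T, σ (c τ) := by
    rw [← map_mul, ← Units.val_mul, h, ← map_prod, Units.coe_prod]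
  by_cases hσ : σ ∈ T
  · simp only [hσ, iff_true]
    rw [← Finset.mul_prod_erase _ _ hσ] at huc
    have h3 : σ (c σ) * ∏ τ ∈ T.erase σ, σ (c τ) < 0 :=
      mul_neg_of_neg_of_pos (hcσ σ) (Finset.prod_pos fun τ hτ ↦
        hcτ τ σ (Finset.ne_of_mem_erase hτ).symm)
    rw [← huc] at h3
    exact neg_of_mul_neg_left h3 (hψσ σ).le
  · simp only [hσ, iff_false, not_lt]
    have h3 : 0 < ∏ τ ∈ T, σ (c τ) := Finset.prod_pos fun τ hτ ↦ hcτ τ σ (by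
      rintro rfl
      exact hσ hτ)
    rw [← huc] at h3
    exact (pos_of_mul_pos_left h3 (hψσ σ).le).le

end

section

theorem exists_sq_add_self_eq {F : Type*} [NormedField F] [CompleteSpace F] [IsUltrametricDist F]
    {e : F} (he : ‖e‖ < 1) : ∃ w : F, w ^ 2 + w = e := by
  let u : ℕ → F := fun n => Nat.rec 0 (fun _ w => e - w ^ 2) n
  have hu : ∀ n, u (n + 1) = e - u n ^ 2 := fun n => rfl
  have hle : ∀ n, ‖u n‖ ≤ ‖e‖ := by
    intro n
    induction n with
    | zero => simp [u]
    | succ n ih =>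
      rw [hu]
      rw [sub_eq_add_neg]
      refine (IsUltrametricDist.norm_add_le_max _ _).trans (max_le le_rfl ?_)
      rw [norm_neg, norm_pow]
      nlinarith [norm_nonneg (u n), norm_nonneg e]
  have hd : ∀ n, dist (u n) (u (n + 1)) ≤ ‖e‖ * ‖e‖ ^ n := by
    intro n
    induction n with
    | zero => simp [u, dist_eq_norm]
    | succ n ih =>
      rw [dist_eq_norm] at ih ⊢
      have : u (n + 1) - u (n + 1 + 1) = -(u n + u (n + 1)) * (u n - u (n + 1)) := by
        rw [hu (n + 1), hu n]; ring
      rw [this, norm_mul, norm_neg, pow_succ, ← mul_assoc, mul_comm]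
      exact mul_le_mul ih
        ((IsUltrametricDist.norm_add_le_max _ _).trans (max_le (hle n) (hle (n + 1))))
        (norm_nonneg _) (by positivity)
  obtain ⟨w, hw⟩ := cauchySeq_tendsto_of_complete (cauchySeq_of_le_geometric _ _ he hd)
  have h1 := hw.comp (Filter.tendsto_add_atTop_nat 1)
  have h2 : Filter.Tendsto (fun n => u (n + 1)) Filter.atTop (nhds (e - w ^ 2)) :=
    (hw.pow 2).const_sub e
  exact ⟨w, by linear_combination tendsto_nhds_unique h1 h2⟩

variable {K : Type} [Field K] [NumberField K] (v : HeightOneSpectrum (𝓞 K))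

theorem norm_algebraMap_adicCompletion_lt_one {x : K} :
    ‖algebraMap K (v.adicCompletion K) x‖ < 1 ↔ v.valuation K x < 1 := by
  change ‖FinitePlace.embedding v x‖ < 1 ↔ _
  rw [FinitePlace.norm_embedding, HeightOneSpectrum.adicAbv_def, NNReal.coe_lt_one,
    WithZeroMulInt.toNNReal_lt_one_iff (HeightOneSpectrum.one_lt_absNorm_nnreal v)]

theorem adicCompletion_exists_sq_add_self_eq {e : K} (he : v.valuation K e < 1) :
    ∃ w : v.adicCompletion K, w ^ 2 + w = algebraMap K _ e := by
  have : IsUltrametricDist (v.adicCompletion K) := inferInstance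
  have : CompleteSpace (v.adicCompletion K) := inferInstance
  exact exists_sq_add_self_eq ((norm_algebraMap_adicCompletion_lt_one v).2 he)

theorem isSquare_algebraMap_of_mem_locSq (h2 : (2 : 𝓞 K) ∉ v.asIdeal) {x : Kˣ}
    (hx : x ∈ locSq v) : IsSquare (algebraMap K (v.adicCompletion K) x) := by
  obtain ⟨y, hy⟩ := mem_locSq.1 hx
  have h4 : v.valuation K 4 = 1 := by
    have : v.valuation K (algebraMap (𝓞 K) K 2) = 1 := v.valuation_eq_one_iff_notMem.2 h2
    rw [map_ofNat] at this
    rw [show (4 : K) = 2 * 2 by norm_num, map_mul, this, one_mul]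
  obtain ⟨w, hw⟩ := adicCompletion_exists_sq_add_self_eq v (e := ((x : K) * y ^ 2 - 1) / 4)
    (by rwa [map_div₀, h4, div_one])
  have hy0 : algebraMap K (v.adicCompletion K) y ≠ 0 := by simp
  refine ⟨(1 + 2 * w) / algebraMap K _ y, ?_⟩
  simp only [map_div₀, map_sub, map_mul, map_pow, map_one, map_ofNat] at hw
  have h4' : (4 : v.adicCompletion K) ≠ 0 := by
    rw [← map_ofNat (algebraMap K (v.adicCompletion K)), map_ne_zero]; norm_num
  field_simp at hw ⊢
  linear_combination -hw

/-- Away from `2`, every element of even valuation is a local sum of two squares. -/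
theorem exists_mul_sum_two_sq_mem_locSq (h2 : (2 : 𝓞 K) ∉ v.asIdeal) {x : Kˣ}
    (hx : v.valuation K x = 1) :
    ∃ p q : K, ∃ s : Kˣ, (s : K) = p ^ 2 + q ^ 2 ∧ x * s ∈ locSq v := by
  obtain ⟨a, y, z, ha, hy, rfl⟩ := exists_eq_sq_mul_of_valuation_eq_one hx
  let _ := Ideal.Quotient.field v.asIdeal
  have hfin : Finite (𝓞 K ⧸ v.asIdeal) := Ideal.finiteQuotientOfFreeOfNeBot _ v.ne_bot
  let _ := Fintype.ofFinite (𝓞 K ⧸ v.asIdeal)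
  have hodd : Fintype.card (𝓞 K ⧸ v.asIdeal) % 2 = 1 := by
    rw [← Nat.odd_iff, ← Nat.card_eq_fintype_card]
    exact odd_absNorm h2
  open Polynomial in
  obtain ⟨p, q, hpq⟩ := FiniteField.exists_root_sum_quadratic (R := 𝓞 K ⧸ v.asIdeal)
    (f := X ^ 2) (g := X ^ 2 - C (Ideal.Quotient.mk _ a)) (degree_X_pow 2)
    (degree_X_pow_sub_C (by decide) _) hodd
  obtain ⟨p, rfl⟩ := Ideal.Quotient.mk_surjective p
  obtain ⟨q, rfl⟩ := Ideal.Quotient.mk_surjective q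
  have hs : p ^ 2 + q ^ 2 - a ∈ v.asIdeal := by
    rw [← Ideal.Quotient.eq_zero_iff_mem]
    simp only [map_sub, map_add, map_pow]
    simp only [Polynomial.eval_pow, Polynomial.eval_X, Polynomial.eval_sub,
      Polynomial.eval_C] at hpq
    linear_combination hpq
  have hs' : p ^ 2 + q ^ 2 ∉ v.asIdeal := fun h => ha (by
    have := v.asIdeal.sub_mem h hs
    rwa [sub_sub_cancel] at this)
  have hs0 : algebraMap (𝓞 K) K (p ^ 2 + q ^ 2) ≠ 0 := by
    rw [ne_eq, FaithfulSMul.algebraMap_eq_zero_iff]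
    rintro h
    exact hs' (h ▸ v.asIdeal.zero_mem)
  refine ⟨algebraMap _ K p, algebraMap _ K q, Units.mk0 _ hs0, by simp, ?_⟩
  have key : y * Units.mk0 _ hs0 ∈ locSq v := by
    refine mem_locSq_of_sub_mem (a := a * (p ^ 2 + q ^ 2)) (b := a) ?_ ?_ ?_
    · rw [Units.val_mul, hy, Units.val_mk0, map_mul]
    · exact fun h => (v.isPrime.mem_or_mem h).elim ha hs'
    · have := v.asIdeal.mul_mem_left a hs
      convert this using 1; ring
  have : y * z ^ 2 * Units.mk0 _ hs0 = y * Units.mk0 _ hs0 * z ^ 2 := by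
    rw [mul_right_comm]
  rw [this]
  refine mul_mem key ?_
  rw [mem_locSq]
  exact ⟨z⁻¹, by simp⟩

theorem exists_sq_add_sq_of_two_mem {b : Kˣ} (hb : b ∈ sqModFour K)
    (h2 : (2 : 𝓞 K) ∈ v.asIdeal) :
    ∃ α β : v.adicCompletion K, α ^ 2 + β ^ 2 = algebraMap K _ b := by
  obtain ⟨t, d, c, ht, hd, h⟩ := hb
  have hmem : ∀ {r : 𝓞 K}, IsCoprime r 2 → r ∉ v.asIdeal := by
    rintro r ⟨m, n, hmn⟩ hr
    exact v.isPrime.ne_top ((Ideal.eq_top_iff_one _).2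
      (hmn ▸ v.asIdeal.add_mem (v.asIdeal.mul_mem_left _ hr) (v.asIdeal.mul_mem_left _ h2)))
  have hvt : v.valuation K (algebraMap (𝓞 K) K t) = 1 := v.valuation_eq_one_iff_notMem.2 (hmem ht)
  have hvd : v.valuation K (algebraMap (𝓞 K) K d) = 1 := v.valuation_eq_one_iff_notMem.2 (hmem hd)
  have ht0 : algebraMap K (v.adicCompletion K) (algebraMap (𝓞 K) K t) ≠ 0 := by
    rw [map_ne_zero]; rintro h; simp [h] at hvt
  have hd0 : algebraMap K (v.adicCompletion K) (algebraMap (𝓞 K) K d) ≠ 0 := by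
    rw [map_ne_zero]; rintro h; simp [h] at hvd
  obtain ⟨w, hw⟩ := adicCompletion_exists_sq_add_self_eq v
    (e := algebraMap (𝓞 K) K (2 * c) / algebraMap (𝓞 K) K t ^ 2) (by
      rw [map_div₀, map_pow, hvt, one_pow, div_one, v.valuation_lt_one_iff_mem]
      exact v.asIdeal.mul_mem_right _ h2)
  have h' : algebraMap K (v.adicCompletion K) b * algebraMap K _ (algebraMap (𝓞 K) K d) ^ 2 =
      algebraMap K _ (algebraMap (𝓞 K) K t) ^ 2 + 4 * algebraMap K _ (algebraMap (𝓞 K) K c) := by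
    have := congrArg (algebraMap K (v.adicCompletion K)) h
    simpa only [map_mul, map_add, map_pow, map_ofNat] using this
  simp only [map_div₀, map_mul, map_pow, map_ofNat] at hw
  generalize algebraMap K (v.adicCompletion K) (algebraMap (𝓞 K) K t) = t' at *
  generalize algebraMap K (v.adicCompletion K) (algebraMap (𝓞 K) K d) = d' at *
  generalize algebraMap K (v.adicCompletion K) (algebraMap (𝓞 K) K c) = c' at *
  refine ⟨t' * (1 + w) / d', t' * w / d', ?_⟩
  field_simp at hw ⊢
  linear_combination -h' + 2 * hw

theorem exists_sq_add_sq_adicCompletion {b : Kˣ} {S : Finset (HeightOneSpectrum (𝓞 K))}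
    (hbS : b ∈ (S : Set (HeightOneSpectrum (𝓞 K))).unit K) (hb : b ∈ sqModFour K)
    (hloc : ∀ v ∈ S, b ∈ locSq v ∨ (-1 : Kˣ) ∈ locSq v) :
    ∃ α β : v.adicCompletion K, α ^ 2 + β ^ 2 = algebraMap K _ b := by
  by_cases h2 : (2 : 𝓞 K) ∈ v.asIdeal
  · exact exists_sq_add_sq_of_two_mem v hb h2
  have h20 : (2 : v.adicCompletion K) ≠ 0 := by
    rw [← map_ofNat (algebraMap K (v.adicCompletion K)), map_ne_zero]; norm_num
  by_cases hv : v ∈ S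
  · rcases hloc v hv with h | h
    · obtain ⟨r, hr⟩ := isSquare_algebraMap_of_mem_locSq v h2 h
      exact ⟨r, 0, by rw [hr]; ring⟩
    · obtain ⟨i, hi⟩ := isSquare_algebraMap_of_mem_locSq v h2 h
      simp only [Units.val_neg, Units.val_one, map_neg, map_one] at hi
      refine ⟨(algebraMap K _ b + 1) / 2, i * (algebraMap K _ b - 1) / 2, ?_⟩
      field_simp
      linear_combination -(algebraMap K (v.adicCompletion K) b - 1) ^ 2 * hi
  · obtain ⟨p, q, s, hs, h⟩ := exists_mul_sum_two_sq_mem_locSq v h2 (x := b) (hbS v hv)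
    obtain ⟨r, hr⟩ := isSquare_algebraMap_of_mem_locSq v h2 h
    have hs0 : algebraMap K (v.adicCompletion K) s ≠ 0 := by simp
    refine ⟨r * algebraMap K _ p / algebraMap K _ s, r * algebraMap K _ q / algebraMap K _ s, ?_⟩
    have hs' := congrArg (algebraMap K (v.adicCompletion K)) hs
    simp only [map_add, map_pow, Units.val_mul, map_mul] at hs' hr
    field_simp
    linear_combination -(algebraMap K (v.adicCompletion K) s) * hr - r ^ 2 * hs'

end

section

open Quaternion

theorem IsDivisionRing.of_ringEquiv {X Y : Type*} [Ring X] [Ring Y] (e : X ≃+* Y)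
    (h : IsDivisionRing X) : IsDivisionRing Y := by
  obtain ⟨h1, h2⟩ := h
  refine ⟨e.injective.nontrivial, fun y hy => ?_⟩
  have := (h2 (e.symm y) (by simpa using hy)).map e
  simpa using this

theorem not_isDivisionRing_matrix {F : Type*} [Field F] :
    ¬ IsDivisionRing (Matrix (Fin 2) (Fin 2) F) := by
  rintro ⟨-, h⟩
  have := h !![1, 0; 0, 0] (fun h => by simpa using congrFun (congrFun h 0) 0)
  rw [Matrix.isUnit_iff_isUnit_det] at this
  simp at this

theorem QuaternionAlgebra.isDivisionRing {F : Type*} [Field F] {c : F}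
    (h : ∀ q : ℍ[F,-1,0,c],
      q.re ^ 2 + q.imI ^ 2 - c * (q.imJ ^ 2 + q.imK ^ 2) = 0 → q = 0) :
    IsDivisionRing ℍ[F,-1,0,c] := by
  refine ⟨inferInstance, fun q hq => ?_⟩
  have hN := mt (h q) hq
  obtain ⟨n, hn⟩ : ∃ n, n = q.re ^ 2 + q.imI ^ 2 - c * (q.imJ ^ 2 + q.imK ^ 2) := ⟨_, rfl⟩
  rw [← hn] at hN
  have h1 : q * star q = algebraMap F _ n := by
    rw [hn]
    ext <;> simp [QuaternionAlgebra.algebraMap_eq] <;> ring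
  have h2 : star q * q = algebraMap F _ n := by
    rw [hn]
    ext <;> simp [QuaternionAlgebra.algebraMap_eq] <;> ring
  refine ⟨⟨q, n⁻¹ • star q, ?_, ?_⟩, rfl⟩
  · rw [mul_smul_comm, h1, Algebra.algebraMap_eq_smul_one, smul_smul, inv_mul_cancel₀ hN, one_smul]
  · rw [smul_mul_assoc, h2, Algebra.algebraMap_eq_smul_one, smul_smul, inv_mul_cancel₀ hN, one_smul]

theorem QuaternionAlgebra.isCentral {F : Type*} [Field F] [CharZero F] {c : F} :
    Algebra.IsCentral F ℍ[F,-1,0,c] := by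
  refine ⟨fun q hq => ?_⟩
  rw [Subalgebra.mem_center_iff] at hq
  have hi := hq ⟨0, 1, 0, 0⟩
  have hj := hq ⟨0, 0, 1, 0⟩
  have h1 := congrArg QuaternionAlgebra.imJ hi
  have h2 := congrArg QuaternionAlgebra.imK hi
  have h3 := congrArg QuaternionAlgebra.imK hj
  simp at h1 h2 h3
  rw [Algebra.mem_bot]
  refine ⟨q.re, ?_⟩
  have e1 : q.imI = 0 := by
    have : 2 * q.imI = 0 := by linear_combination -h3
    simpa using this
  have e2 : q.imJ = 0 := by
    have : 2 * q.imJ = 0 := by linear_combination h2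
    simpa using this
  have e3 : q.imK = 0 := by
    have : 2 * q.imK = 0 := by linear_combination -h1
    simpa using this
  ext <;> simp [QuaternionAlgebra.algebraMap_eq, e1, e2, e3]

theorem QuaternionAlgebra.Basis.nonempty_tensorProduct_equiv {K F A : Type*} [Field K] [Field F]
    [Algebra K F] [Ring A] [Algebra F A] [Algebra K A] [IsScalarTower K F A] {c₁ c₂ c₃ : K}
    (q : QuaternionAlgebra.Basis A c₁ c₂ c₃) (hA : Module.finrank F A = 4)
    (hspan : ∀ a : A, ∃ w x y z : F, a = w • (1 : A) + x • q.i + y • q.j + z • q.k) :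
    Nonempty (F ⊗[K] ℍ[K,c₁,c₂,c₃] ≃ₐ[F] A) := by
  let f : F ⊗[K] ℍ[K,c₁,c₂,c₃] →ₐ[F] A :=
    Algebra.TensorProduct.lift (Algebra.ofId F A) q.liftHom
      (fun x y => Algebra.commutes x (q.liftHom y))
  have hf : ∀ x y, f (x ⊗ₜ y) = x • q.lift y := fun x y => by
    rw [Algebra.smul_def]
    exact Algebra.TensorProduct.lift_tmul ..
  have hs : Function.Surjective f := by
    intro a
    obtain ⟨w, x, y, z, rfl⟩ := hspan a
    refine ⟨w ⊗ₜ ⟨1, 0, 0, 0⟩ + x ⊗ₜ ⟨0, 1, 0, 0⟩ + y ⊗ₜ ⟨0, 0, 1, 0⟩ + z ⊗ₜ ⟨0, 0, 0, 1⟩, ?_⟩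
    simp only [map_add, hf]
    simp [QuaternionAlgebra.Basis.lift]
  have hfr : Module.finrank F (F ⊗[K] ℍ[K,c₁,c₂,c₃]) = Module.finrank F A := by
    rw [Module.finrank_baseChange, QuaternionAlgebra.finrank_eq_four, hA]
  have : FiniteDimensional F A := Module.finite_of_finrank_pos (by omega)
  have hi : Function.Injective f :=
    (LinearMap.injective_iff_surjective_of_finrank_eq_finrank (f := f.toLinearMap) hfr).2 hs
  exact ⟨AlgEquiv.ofBijective f ⟨hi, hs⟩⟩

theorem QuaternionAlgebra.nonempty_tensorProduct_equiv_matrix {K F : Type*} [Field K] [Field F]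
    [CharZero F] [Algebra K F] {c : K} (hc : c ≠ 0) {α β : F}
    (h : α ^ 2 + β ^ 2 = algebraMap K F c) :
    Nonempty (F ⊗[K] ℍ[K,-1,0,c] ≃ₐ[F] Matrix (Fin 2) (Fin 2) F) := by
  have hc' : algebraMap K F c ≠ 0 := by simpa using hc
  let q : QuaternionAlgebra.Basis (Matrix (Fin 2) (Fin 2) F) (-1) 0 c :=
    { i := !![0, -1; 1, 0]
      j := !![α, β; β, -α]
      k := !![0, -1; 1, 0] * !![α, β; β, -α]
      i_mul_i := by
        ext i j; fin_cases i <;> fin_cases j <;> simp [Matrix.mul_apply]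
      j_mul_j := by
        ext i j; fin_cases i <;> fin_cases j <;>
          simp [Matrix.mul_apply, Algebra.smul_def, ← h] <;> ring
      i_mul_j := rfl
      j_mul_i := by
        ext i j; fin_cases i <;> fin_cases j <;> simp [Matrix.mul_apply] }
  refine q.nonempty_tensorProduct_equiv (by simp [Module.finrank_matrix]) fun a => ?_
  obtain ⟨p, q', r, s, rfl⟩ : ∃ p q r s, a = !![p, q; r, s] :=
    ⟨_, _, _, _, Matrix.eta_fin_two a⟩
  refine ⟨(p + s) / 2, (r - q') / 2,
    (α * ((p - s) / 2) + β * ((q' + r) / 2)) / algebraMap K F c,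
    (α * ((q' + r) / 2) - β * ((p - s) / 2)) / algebraMap K F c, ?_⟩
  rw [← h] at hc' ⊢
  ext i j
  fin_cases i <;> fin_cases j <;> simp [q, Matrix.mul_apply] <;> field_simp <;> ring

theorem QuaternionAlgebra.nonempty_tensorProduct_equiv_of_algebraMap {K F : Type*} [Field K]
    [Field F] [Algebra K F] (c : K) :
    Nonempty (F ⊗[K] ℍ[K,-1,0,c] ≃ₐ[F] ℍ[F,-1,0,algebraMap K F c]) := by
  let q : QuaternionAlgebra.Basis ℍ[F,-1,0,algebraMap K F c] (-1 : K) 0 c :=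
    { i := ⟨0, 1, 0, 0⟩
      j := ⟨0, 0, 1, 0⟩
      k := ⟨0, 0, 0, 1⟩
      i_mul_i := by ext <;> simp
      j_mul_j := by
        rw [← algebraMap_smul F c]
        ext <;> simp [Algebra.algebraMap_eq_smul_one]
      i_mul_j := by ext <;> simp
      j_mul_i := by ext <;> simp }
  refine q.nonempty_tensorProduct_equiv (QuaternionAlgebra.finrank_eq_four _ _ _) fun a => ?_
  exact ⟨a.re, a.imI, a.imJ, a.imK, by ext <;> simp [q]⟩

theorem QuaternionAlgebra.isDivisionRing_of_neg {F : Type*} [Field F] {c : F} (σ : F →+* ℝ)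
    (hc : σ c < 0) : IsDivisionRing ℍ[F,-1,0,c] := by
  refine QuaternionAlgebra.isDivisionRing fun q hq => ?_
  have h := congrArg σ hq
  simp only [map_add, map_sub, map_mul, map_pow, map_zero] at h
  have h0 : ∀ x, σ x ^ 2 = 0 → x = 0 := fun x hx => by simpa using hx
  have hJK : 0 ≤ -σ c * (σ q.imJ ^ 2 + σ q.imK ^ 2) :=
    mul_nonneg (by linarith) (by positivity)
  have h1 := sq_nonneg (σ q.re)
  have h2 := sq_nonneg (σ q.imI)
  have h3 : σ q.imJ ^ 2 + σ q.imK ^ 2 = 0 := by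
    have : -σ c * (σ q.imJ ^ 2 + σ q.imK ^ 2) = 0 := by linarith
    exact (mul_eq_zero.1 this).resolve_left (by linarith)
  have h4 := sq_nonneg (σ q.imJ)
  have h5 := sq_nonneg (σ q.imK)
  ext
  · exact h0 _ (by linarith)
  · exact h0 _ (by linarith)
  · exact h0 _ (by linarith)
  · exact h0 _ (by linarith)

theorem QuaternionAlgebra.isDivisionRing_real_tensorProduct_iff {K : Type*} [Field K] {c : K}
    (hc : c ≠ 0) (σ : K →+* ℝ) :
    (letI : Algebra K ℝ := σ.toAlgebra
     IsDivisionRing (ℝ ⊗[K] ℍ[K,-1,0,c])) ↔ σ c < 0 := by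
  let _ : Algebra K ℝ := σ.toAlgebra
  change IsDivisionRing (ℝ ⊗[K] ℍ[K,-1,0,c]) ↔ σ c < 0
  constructor
  · intro h
    by_contra! hpos
    obtain ⟨e⟩ := QuaternionAlgebra.nonempty_tensorProduct_equiv_matrix (F := ℝ) hc
      (α := √(σ c)) (β := 0) (by
        rw [Real.sq_sqrt hpos, zero_pow two_ne_zero, add_zero]; rfl)
    exact not_isDivisionRing_matrix (h.of_ringEquiv e.toRingEquiv)
  · intro h
    obtain ⟨e⟩ := QuaternionAlgebra.nonempty_tensorProduct_equiv_of_algebraMap (F := ℝ) c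
    refine IsDivisionRing.of_ringEquiv e.symm.toRingEquiv ?_
    exact QuaternionAlgebra.isDivisionRing_of_neg (RingHom.id ℝ) h

end

/-- Let `K` be a number field and `T` a nonempty finite set of real embeddings
of `K` of even cardinality.  Then there is a quaternion division algebra `B₁` over `K` which is
ramified exactly at the real places in `T` (i.e. `ℝ ⊗_{K,σ} B₁` is a division ring iff `σ ∈ T`)
and split (a `2 × 2` matrix algebra) at every finite place of `K`. -/
theorem selectivity_stmt8
    (K : Type) [Field K] [NumberField K]
    (T : Finset (K →+* ℝ)) (hT : T.Nonempty) (hTcard : Even T.card) :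
    ∃ (B₁ : Type) (_ : DivisionRing B₁) (_ : Algebra K B₁),
      Algebra.IsCentral K B₁ ∧ Module.finrank K B₁ = 4 ∧
      (∀ σ : K →+* ℝ,
        (letI : Algebra K ℝ := σ.toAlgebra
         IsDivisionRing (ℝ ⊗[K] B₁)) ↔ σ ∈ T) ∧
      (∀ v : HeightOneSpectrum (𝓞 K),
        Nonempty ((v.adicCompletion K ⊗[K] B₁) ≃ₐ[v.adicCompletion K]
          Matrix (Fin 2) (Fin 2) (v.adicCompletion K))) := by
  obtain ⟨S, b, -, hbS, hb, hloc, hsign⟩ := exists_unit_neg_iff T hT hTcard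
  obtain ⟨σ₀, hσ₀⟩ := hT
  obtain ⟨hnt, hunit⟩ :=
    QuaternionAlgebra.isDivisionRing_of_neg (c := (b : K)) σ₀ ((hsign σ₀).2 hσ₀)
  let D : DivisionRing (QuaternionAlgebra K (-1) 0 (b : K)) :=
    DivisionRing.ofIsUnitOrEqZero fun x => or_iff_not_imp_right.2 (hunit x)
  refine ⟨QuaternionAlgebra K (-1) 0 (b : K), D,
    (inferInstance : Algebra K (QuaternionAlgebra K (-1) 0 (b : K))),
    QuaternionAlgebra.isCentral, QuaternionAlgebra.finrank_eq_four _ _ _,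
    fun σ => ?_, fun v => ?_⟩
  · exact (QuaternionAlgebra.isDivisionRing_real_tensorProduct_iff b.ne_zero σ).trans (hsign σ)
  · obtain ⟨α, β, h⟩ := exists_sq_add_sq_adicCompletion v hbS hb hloc
    have : CharZero (v.adicCompletion K) :=
      charZero_of_injective_algebraMap (algebraMap K (v.adicCompletion K)).injective
    exact QuaternionAlgebra.nonempty_tensorProduct_equiv_matrix b.ne_zero h
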